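/- Let φ be a norm on ℝ², let Ω ⊆ ℝ² be a bounded convex open set, let m > 0, and let u be a minimizer of problem (1). Then for every j ∈ ℕ with j ≥ 1, the level set E_j = {x : u(x) ≥ j} is a minimizer of problem (10) with volume constraint m := |E_j|; in particular, each E_j (identified with its set of Lebesgue-density-1 points) is convex. -/

import Mathlib

open MeasureTheory Set ENNReal Filter

noncomputable section

/-- `φ` is a norm on `ℝⁿ` (represented as `Fin n → ℝ`). -/
structure IsNorm {n : ℕ} (φ : (Fin n → ℝ) → ℝ) : Prop where
  nonneg : ∀ x, 0 ≤ φ x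
  eq_zero_iff : ∀ x, φ x = 0 ↔ x = 0
  smul_eq : ∀ (a : ℝ) (x : Fin n → ℝ), φ (a • x) = |a| * φ x
  add_le : ∀ x y, φ (x + y) ≤ φ x + φ y

/-- The divergence of a vector field `η : ℝⁿ → ℝⁿ`. -/
def diverg {n : ℕ} (η : (Fin n → ℝ) → (Fin n → ℝ)) (x : Fin n → ℝ) : ℝ :=
  ∑ i, fderiv ℝ η x (Pi.single i 1) i

/-- The anisotropic total variation `∫ φ*(Du)` of `u : ℝⁿ → ℝ`:
`sup { ∫ u div η dx : η ∈ C¹_c(ℝⁿ;ℝⁿ), φ(η(x)) ≤ 1 ∀ x }`, as an extended real. -/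
def anisoTV {n : ℕ} (φ : (Fin n → ℝ) → ℝ) (u : (Fin n → ℝ) → ℝ) : ℝ≥0∞ :=
  ⨆ η ∈ {η : (Fin n → ℝ) → (Fin n → ℝ) |
      ContDiff ℝ 1 η ∧ HasCompactSupport η ∧ ∀ x, φ (η x) ≤ 1},
    ENNReal.ofReal (∫ x, u x * diverg η x)

/-- `u ∈ BV(ℝⁿ)` (with respect to the anisotropic total variation). -/
def IsBV {n : ℕ} (φ : (Fin n → ℝ) → ℝ) (u : (Fin n → ℝ) → ℝ) : Prop :=
  Integrable u volume ∧ anisoTV φ u ≠ ⊤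

/-- `u` is admissible for problem (1): `u ∈ BV(ℝⁿ)`, `u = 0` a.e. outside `Ω`,
`u` is a.e. `ℕ`-valued, and `∫_Ω u = m`. -/
def Admissible {n : ℕ} (φ : (Fin n → ℝ) → ℝ) (Ω : Set (Fin n → ℝ)) (m : ℝ)
    (u : (Fin n → ℝ) → ℝ) : Prop :=
  IsBV φ u ∧ (∀ᵐ x ∂volume, x ∉ Ω → u x = 0) ∧
    (∀ᵐ x ∂volume, ∃ k : ℕ, u x = k) ∧ (∫ x in Ω, u x) = m

/-- `u` is a minimizer of problem (1). -/
def IsMinimizer {n : ℕ} (φ : (Fin n → ℝ) → ℝ) (Ω : Set (Fin n → ℝ)) (m : ℝ)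
    (u : (Fin n → ℝ) → ℝ) : Prop :=
  Admissible φ Ω m u ∧ ∀ v, Admissible φ Ω m v → anisoTV φ u ≤ anisoTV φ v

/-- The anisotropic perimeter `P_φ(E)` of a set `E ⊆ ℝⁿ`. -/
def anisoPerimeter {n : ℕ} (φ : (Fin n → ℝ) → ℝ) (E : Set (Fin n → ℝ)) : ℝ≥0∞ :=
  anisoTV φ (E.indicator (1 : (Fin n → ℝ) → ℝ))

/-- The Wulff ball `W_r(x) = {y : φ(y-x) < r}`. -/
def wulffBall {n : ℕ} (φ : (Fin n → ℝ) → ℝ) (x : Fin n → ℝ) (r : ℝ) : Set (Fin n → ℝ) :=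
  {y | φ (y - x) < r}

/-- `E` satisfies the `rW_φ`-condition. -/
def rWCond {n : ℕ} (φ : (Fin n → ℝ) → ℝ) (E : Set (Fin n → ℝ)) (r : ℝ) : Prop :=
  ∀ x ∈ frontier E, ∃ y, wulffBall φ y r ⊆ E ∧ x ∈ frontier (wulffBall φ y r)

/-- The Wulff plaquette `E^r`, the union of all Wulff balls of radius `r` contained
in `E` (with `E^0 = E`). -/
def plaquette {n : ℕ} (φ : (Fin n → ℝ) → ℝ) (E : Set (Fin n → ℝ)) (r : ℝ) :
    Set (Fin n → ℝ) :=
  if r = 0 then E else ⋃ (x) (_ : wulffBall φ x r ⊆ E), wulffBall φ x r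

/-- `R_Ω`: the maximal `R > 0` such that some Wulff ball of radius `R` is contained in `Ω`. -/
def maxInradius {n : ℕ} (φ : (Fin n → ℝ) → ℝ) (Ω : Set (Fin n → ℝ)) : ℝ :=
  sSup {R | 0 < R ∧ ∃ x, wulffBall φ x R ⊆ Ω}

/-- `r_Ω`: the maximal `r > 0` such that `Ω` satisfies the `rW_φ`-condition
(`0` if there is none, since `sSup ∅ = 0`). -/
def maxRollRadius {n : ℕ} (φ : (Fin n → ℝ) → ℝ) (Ω : Set (Fin n → ℝ)) : ℝ :=
  sSup {r | 0 < r ∧ rWCond φ Ω r}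

/-- The set of points of Lebesgue density `1` of `E`. -/
def densityPoints {n : ℕ} (E : Set (Fin n → ℝ)) : Set (Fin n → ℝ) :=
  {x | Tendsto (fun r : ℝ => volume (E ∩ Metric.ball x r) / volume (Metric.ball x r))
    (nhdsWithin 0 (Ioi 0)) (nhds 1)}

/-- `E` is a minimizer of problem (10): the constrained isoperimetric problem
minimizing `P_φ` among measurable subsets of `Ω` of prescribed measure `m`. -/
def IsIsopMinimizer {n : ℕ} (φ : (Fin n → ℝ) → ℝ) (Ω : Set (Fin n → ℝ)) (m : ℝ)
    (E : Set (Fin n → ℝ)) : Prop :=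
  MeasurableSet E ∧ E ⊆ Ω ∧ (volume E).toReal = m ∧
    ∀ F, MeasurableSet F → F ⊆ Ω → (volume F).toReal = m →
      anisoPerimeter φ E ≤ anisoPerimeter φ F

/-- The Euclidean norm on `ℝ²`. -/
def euclNorm (v : Fin 2 → ℝ) : ℝ := Real.sqrt (v 0 ^ 2 + v 1 ^ 2)

/-- The crystalline norm `φ(ν) = |ν₁| + |ν₂|` on `ℝ²`. -/
def crysNorm (v : Fin 2 → ℝ) : ℝ := |v 0| + |v 1|

/-- The open unit square `(0,1)² ⊆ ℝ²`. -/
def unitSquare : Set (Fin 2 → ℝ) := univ.pi fun _ => Ioo (0 : ℝ) 1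

/-- The closed unit square `[0,1]² ⊆ ℝ²`. -/
def closedUnitSquare : Set (Fin 2 → ℝ) := univ.pi fun _ => Icc (0 : ℝ) 1

/-- `j` is the essential supremum `‖u‖_∞` of `u`. -/
def IsEssSup (u : (Fin 2 → ℝ) → ℝ) (j : ℕ) : Prop :=
  (∀ᵐ x ∂volume, u x ≤ (j : ℝ)) ∧ ∀ c : ℝ, (∀ᵐ x ∂volume, u x ≤ c) → (j : ℝ) ≤ c

open scoped Topology

/-- Admissible test fields in the definition of the anisotropic total variation. -/
def IsTestField {n : ℕ} (φ : (Fin n → ℝ) → ℝ) (η : (Fin n → ℝ) → (Fin n → ℝ)) : Prop :=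
  ContDiff ℝ 1 η ∧ HasCompactSupport η ∧ ∀ x, φ (η x) ≤ 1

section NormFacts

variable {n : ℕ} {φ : (Fin n → ℝ) → ℝ}

lemma IsNorm.map_zero (hφ : IsNorm φ) : φ 0 = 0 := (hφ.eq_zero_iff 0).2 rfl

lemma IsNorm.map_neg (hφ : IsNorm φ) (x : Fin n → ℝ) : φ (-x) = φ x := by
  have h := hφ.smul_eq (-1) x
  simpa using h

lemma IsNorm.exists_upper (hφ : IsNorm φ) : ∃ C : ℝ, 0 < C ∧ ∀ x, φ x ≤ C * ‖x‖ := by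
  refine ⟨1 + ∑ i, φ (Pi.single i 1), ?_, fun x => ?_⟩
  · have : 0 ≤ ∑ i, φ (Pi.single i (1 : ℝ)) := Finset.sum_nonneg fun i _ => hφ.nonneg _
    linarith
  · have hsum : ∀ s : Finset (Fin n), φ (∑ i ∈ s, x i • Pi.single i (1 : ℝ))
        ≤ ∑ i ∈ s, ‖x‖ * φ (Pi.single i 1) := by
      intro s
      classical
      induction s using Finset.induction_on with
      | empty => simp [hφ.map_zero]
      | insert a s ha ih =>
        rw [Finset.sum_insert ha, Finset.sum_insert ha]
        refine (hφ.add_le _ _).trans (add_le_add ?_ ih)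
        rw [hφ.smul_eq]
        exact mul_le_mul_of_nonneg_right (norm_le_pi_norm x a) (hφ.nonneg _)
    have hx : x = ∑ i, x i • Pi.single i (1 : ℝ) := by
      simpa using (pi_eq_sum_univ' x)
    calc φ x = φ (∑ i, x i • Pi.single i (1 : ℝ)) := by rw [← hx]
      _ ≤ ∑ i, ‖x‖ * φ (Pi.single i 1) := hsum _
      _ = (∑ i, φ (Pi.single i (1 : ℝ))) * ‖x‖ := by rw [← Finset.mul_sum, mul_comm]
      _ ≤ _ := by nlinarith [norm_nonneg x]

lemma IsNorm.sub_le (hφ : IsNorm φ) (x y : Fin n → ℝ) : φ x - φ y ≤ φ (x - y) := by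
  have := hφ.add_le (x - y) y
  simp at this; linarith

lemma IsNorm.continuous (hφ : IsNorm φ) : Continuous φ := by
  obtain ⟨C, hC, h⟩ := hφ.exists_upper
  refine LipschitzWith.continuous (K := C.toNNReal) (LipschitzWith.of_dist_le_mul fun x y => ?_)
  rw [Real.dist_eq, dist_eq_norm, abs_le]
  have h1 := hφ.sub_le x y
  have h2 := hφ.sub_le y x
  have h3 := h (x - y)
  have h4 : φ (y - x) = φ (x - y) := by rw [← hφ.map_neg, neg_sub]
  rw [Real.coe_toNNReal C hC.le]
  constructor <;> linarith

lemma IsNorm.exists_lower (hφ : IsNorm φ) : ∃ c : ℝ, 0 < c ∧ ∀ x, c * ‖x‖ ≤ φ x := by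
  by_cases hn : (Metric.sphere (0 : Fin n → ℝ) 1).Nonempty
  · obtain ⟨z, hz, hmin⟩ := (isCompact_sphere (0 : Fin n → ℝ) 1).exists_isMinOn hn
      hφ.continuous.continuousOn
    have hz0 : z ≠ 0 := by
      rintro rfl; simp at hz
    refine ⟨φ z, lt_of_le_of_ne (hφ.nonneg z) fun h => hz0 ((hφ.eq_zero_iff z).1 h.symm),
      fun x => ?_⟩
    by_cases hx : x = 0
    · simp [hx, hφ.map_zero]
    · have hx' : 0 < ‖x‖ := norm_pos_iff.2 hx
      have h1 : φ z ≤ φ (‖x‖⁻¹ • x) := hmin (by simp [norm_smul, hx'.ne'])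
      rw [hφ.smul_eq, abs_of_pos (inv_pos.2 hx')] at h1
      calc φ z * ‖x‖ ≤ ‖x‖⁻¹ * φ x * ‖x‖ := by gcongr
        _ = φ x := by field_simp
  · refine ⟨1, one_pos, fun x => ?_⟩
    have hx : x = 0 := by
      by_contra hx
      have hx' : 0 < ‖x‖ := norm_pos_iff.2 hx
      exact hn ⟨‖x‖⁻¹ • x, by simp [norm_smul, hx'.ne']⟩
    simp [hx, hφ.map_zero]

lemma IsNorm.combo_le_one (hφ : IsNorm φ) {x y : Fin n → ℝ} (hx : φ x ≤ 1) (hy : φ y ≤ 1)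
    {t : ℝ} (h0 : 0 ≤ t) (h1 : t ≤ 1) : φ ((1 - t) • x + t • y) ≤ 1 := by
  refine (hφ.add_le _ _).trans ?_
  rw [hφ.smul_eq, hφ.smul_eq, abs_of_nonneg h0, abs_of_nonneg (sub_nonneg.2 h1)]
  nlinarith

end NormFacts

section Divergence

variable {n : ℕ} {η ξ : (Fin n → ℝ) → (Fin n → ℝ)}

lemma diverg_continuous (hη : ContDiff ℝ 1 η) : Continuous (diverg η) := by
  unfold diverg
  refine continuous_finsetSum _ fun i _ => ?_
  have h := (hη.continuous_fderiv one_ne_zero).clm_apply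
    (continuous_const (y := (Pi.single i (1 : ℝ) : Fin n → ℝ)))
  exact (continuous_apply i).comp h

lemma diverg_hasCompactSupport (hη : HasCompactSupport η) : HasCompactSupport (diverg η) := by
  refine (hη.fderiv (𝕜 := ℝ)).comp_left (g := fun L : (Fin n → ℝ) →L[ℝ] (Fin n → ℝ) =>
    ∑ i, L (Pi.single i 1) i) ?_
  simp

lemma support_diverg_subset : Function.support (diverg η) ⊆ tsupport η := by
  intro x hx
  by_contra h
  apply hx
  have h0 : fderiv ℝ η x = 0 := by
    have := notMem_subset (support_fderiv_subset ℝ (f := η)) h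
    simpa using this
  simp [diverg, h0]

lemma diverg_add {x} (hη : DifferentiableAt ℝ η x) (hξ : DifferentiableAt ℝ ξ x) :
    diverg (fun x => η x + ξ x) x = diverg η x + diverg ξ x := by
  simp only [diverg]
  rw [← Finset.sum_add_distrib]
  have : fderiv ℝ (fun x => η x + ξ x) x = fderiv ℝ η x + fderiv ℝ ξ x := fderiv_add hη hξ
  simp [this]

lemma diverg_neg {x} : diverg (fun x => -η x) x = -diverg η x := by
  simp only [diverg]
  have : fderiv ℝ (fun x => - η x) x = - fderiv ℝ η x := fderiv_fun_neg
  simp [this]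

lemma diverg_const (c : Fin n → ℝ) (x) : diverg (fun _ => c) x = 0 := by
  simp [diverg]

lemma diverg_smul {x} {g : (Fin n → ℝ) → ℝ} (hg : DifferentiableAt ℝ g x)
    (hη : DifferentiableAt ℝ η x) :
    diverg (fun x => g x • η x) x = g x * diverg η x + fderiv ℝ g x (η x) := by
  have h : fderiv ℝ (fun x => g x • η x) x = g x • fderiv ℝ η x + (fderiv ℝ g x).smulRight (η x) :=
    fderiv_fun_smul hg hη
  have h2 : fderiv ℝ g x (η x) = ∑ i, fderiv ℝ g x (Pi.single i 1) * η x i := by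
    conv_lhs => rw [pi_eq_sum_univ' (η x)]
    simp [map_sum, mul_comm]
  simp only [diverg, h, h2, Finset.mul_sum]
  rw [← Finset.sum_add_distrib]
  simp

lemma integral_fderiv_apply_eq_zero {f : (Fin n → ℝ) → ℝ} (hf : ContDiff ℝ 1 f)
    (hc : HasCompactSupport f) (v : Fin n → ℝ) : ∫ x, fderiv ℝ f x v = 0 := by
  have hd : Continuous fun x => fderiv ℝ f x v :=
    (hf.continuous_fderiv one_ne_zero).clm_apply continuous_const
  have hdc : HasCompactSupport fun x => fderiv ℝ f x v := hc.fderiv_apply ℝ v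
  have h := integral_mul_fderiv_eq_neg_fderiv_mul_of_integrable (𝕜 := ℝ)
    (μ := (volume : Measure (Fin n → ℝ))) (v := v)
    (f := fun _ => (1 : ℝ)) (g := f)
    (by simp)
    (by simpa using hd.integrable_of_hasCompactSupport hdc)
    (by simpa using hf.continuous.integrable_of_hasCompactSupport hc)
    (fun _ _ => differentiableAt_const _) (fun x _ => hf.differentiable one_ne_zero x)
  simpa using h

lemma integral_diverg_eq_zero (hη : ContDiff ℝ 1 η) (hc : HasCompactSupport η) :
    ∫ x, diverg η x = 0 := by
  have key : ∀ i, ∀ x, fderiv ℝ η x (Pi.single i 1) i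
      = fderiv ℝ (fun y => η y i) x (Pi.single i 1) := by
    intro i x
    rw [fderiv_apply (hη.differentiable one_ne_zero x)]; rfl
  have hci : ∀ i, ContDiff ℝ 1 (fun y => η y i) := fun i => contDiff_pi.1 hη i
  have hsi : ∀ i, HasCompactSupport (fun y => η y i) := fun i =>
    hc.comp_left (g := fun v : Fin n → ℝ => v i) rfl
  simp only [diverg, key]
  rw [integral_finsetSum]
  · exact Finset.sum_eq_zero fun i _ => integral_fderiv_apply_eq_zero (hci i) (hsi i) _
  · intro i _
    exact (((hci i).continuous_fderiv one_ne_zero).clm_apply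
      continuous_const).integrable_of_hasCompactSupport ((hsi i).fderiv_apply ℝ _)

lemma integrable_mul_diverg {u : (Fin n → ℝ) → ℝ} (hu : LocallyIntegrable u)
    (hη : ContDiff ℝ 1 η) (hc : HasCompactSupport η) :
    Integrable (fun x => u x * diverg η x) := by
  have := hu.integrable_smul_left_of_hasCompactSupport (diverg_continuous hη)
    (diverg_hasCompactSupport hc)
  simpa [mul_comm] using this

end Divergence

section TestFields

variable {n : ℕ} {φ : (Fin n → ℝ) → ℝ} {η : (Fin n → ℝ) → (Fin n → ℝ)}

lemma IsNorm.isTestField_zero (hφ : IsNorm φ) : IsTestField φ (fun _ => 0) :=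
  ⟨contDiff_const, HasCompactSupport.zero, fun _ => by simp [hφ.map_zero]⟩

lemma IsTestField.exists_bound (hη : IsTestField φ η) : ∃ C : ℝ, 0 < C ∧ ∀ x, |diverg η x| ≤ C := by
  obtain ⟨C, hC⟩ := (diverg_continuous hη.1).bounded_above_of_compact_support
    (diverg_hasCompactSupport hη.2.1)
  exact ⟨max C 1, by positivity, fun x => (hC x).trans (le_max_left _ _)⟩

lemma IsTestField.integrable_mul {u : (Fin n → ℝ) → ℝ} (hη : IsTestField φ η)
    (hu : Integrable u) : Integrable (fun x => u x * diverg η x) :=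
  integrable_mul_diverg hu.locallyIntegrable hη.1 hη.2.1

lemma IsTestField.integrable_diverg (hη : IsTestField φ η) : Integrable (diverg η) :=
  (diverg_continuous hη.1).integrable_of_hasCompactSupport (diverg_hasCompactSupport hη.2.1)

end TestFields

section TotalVariation

variable {n : ℕ} {φ : (Fin n → ℝ) → ℝ} {η : (Fin n → ℝ) → (Fin n → ℝ)}
  {u v : (Fin n → ℝ) → ℝ}

lemma le_anisoTV (hη : IsTestField φ η) (u : (Fin n → ℝ) → ℝ) :
    ENNReal.ofReal (∫ x, u x * diverg η x) ≤ anisoTV φ u :=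
  le_iSup₂ (f := fun (η : (Fin n → ℝ) → (Fin n → ℝ)) (_ : η ∈ {η | ContDiff ℝ 1 η ∧
    HasCompactSupport η ∧ ∀ x, φ (η x) ≤ 1}) => ENNReal.ofReal (∫ x, u x * diverg η x)) η hη

lemma anisoTV_le {c : ℝ≥0∞} (h : ∀ η, IsTestField φ η →
    ENNReal.ofReal (∫ x, u x * diverg η x) ≤ c) : anisoTV φ u ≤ c :=
  iSup₂_le h

lemma integral_le_anisoTV (hη : IsTestField φ η) (hu : anisoTV φ u ≠ ⊤) :
    ∫ x, u x * diverg η x ≤ (anisoTV φ u).toReal :=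
  (ENNReal.ofReal_le_iff_le_toReal hu).1 (le_anisoTV hη u)

lemma anisoTV_congr (h : u =ᵐ[volume] v) : anisoTV φ u = anisoTV φ v := by
  unfold anisoTV
  congr 1; ext η; congr 1; ext _; congr 1
  refine integral_congr_ae ?_
  filter_upwards [h] with x hx
  rw [hx]

lemma anisoPerimeter_congr {E F : Set (Fin n → ℝ)} (h : E =ᵐ[volume] F) :
    anisoPerimeter φ E = anisoPerimeter φ F :=
  anisoTV_congr (indicator_ae_eq_of_ae_eq_set h)

lemma anisoTV_add_le (hu : Integrable u) (hv : Integrable v) :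
    anisoTV φ (fun x => u x + v x) ≤ anisoTV φ u + anisoTV φ v := by
  refine anisoTV_le fun η hη => ?_
  have : ∫ x, (u x + v x) * diverg η x = (∫ x, u x * diverg η x) + ∫ x, v x * diverg η x := by
    rw [← integral_add (hη.integrable_mul hu) (hη.integrable_mul hv)]
    simp only [add_mul]
  rw [this]
  exact ENNReal.ofReal_add_le.trans (add_le_add (le_anisoTV hη u) (le_anisoTV hη v))

lemma anisoTV_add_anisoTV_le (hφ : IsNorm φ) {c : ℝ≥0∞} (h : ∀ η₁ η₂, IsTestField φ η₁ →
    IsTestField φ η₂ →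
      ENNReal.ofReal ((∫ x, u x * diverg η₁ x) + ∫ x, v x * diverg η₂ x) ≤ c) :
    anisoTV φ u + anisoTV φ v ≤ c := by
  refine ENNReal.biSup_add_biSup_le' ⟨_, hφ.isTestField_zero⟩ ⟨_, hφ.isTestField_zero⟩ ?_
  intro η₁ h₁ η₂ h₂
  have hz : ∀ w : (Fin n → ℝ) → ℝ, ∫ x, w x * diverg (fun _ => (0 : Fin n → ℝ)) x = 0 := by
    intro w; simp [diverg_const]
  rcases le_total (∫ x, u x * diverg η₁ x) 0 with h1 | h1
  · rw [ENNReal.ofReal_of_nonpos h1, zero_add]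
    simpa [hz] using h _ _ hφ.isTestField_zero h₂
  · rcases le_total (∫ x, v x * diverg η₂ x) 0 with h2 | h2
    · rw [ENNReal.ofReal_of_nonpos h2, add_zero]
      simpa [hz] using h _ _ h₁ hφ.isTestField_zero
    · rw [← ENNReal.ofReal_add h1 h2]
      exact h _ _ h₁ h₂

lemma anisoTV_le_liminf {ι : Type*} {l : Filter ι} [l.NeBot] {w : ι → (Fin n → ℝ) → ℝ}
    (h : ∀ η, IsTestField φ η →
      Tendsto (fun k => ∫ x, w k x * diverg η x) l (𝓝 (∫ x, u x * diverg η x))) :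
    anisoTV φ u ≤ liminf (fun k => anisoTV φ (w k)) l := by
  refine anisoTV_le fun η hη => ?_
  have h1 := (ENNReal.continuous_ofReal.tendsto _).comp (h η hη)
  rw [← h1.liminf_eq]
  exact liminf_le_liminf (Eventually.of_forall fun k => le_anisoTV hη (w k))

lemma tendsto_integral_mul_diverg {ι : Type*} {l : Filter ι} [l.IsCountablyGenerated]
    {w : ι → (Fin n → ℝ) → ℝ} (hη : IsTestField φ η) (C : ℝ)
    (hm : ∀ k, AEStronglyMeasurable (w k) volume)
    (hC : ∀ k, ∀ᵐ x, |w k x| ≤ C) (hlim : ∀ᵐ x, Tendsto (fun k => w k x) l (𝓝 (u x))) :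
    Tendsto (fun k => ∫ x, w k x * diverg η x) l (𝓝 (∫ x, u x * diverg η x)) := by
  refine tendsto_integral_filter_of_dominated_convergence (fun x => C * |diverg η x|) ?_ ?_ ?_ ?_
  · exact Eventually.of_forall fun k => (hm k).mul (diverg_continuous hη.1).aestronglyMeasurable
  · refine Eventually.of_forall fun k => ?_
    filter_upwards [hC k] with x hx
    rw [Real.norm_eq_abs, abs_mul]
    gcongr
  · exact hη.integrable_diverg.abs.const_mul C
  · filter_upwards [hlim] with x hx
    exact hx.mul_const _

lemma anisoTV_le_liminf_of_ae {ι : Type*} {l : Filter ι} [l.NeBot] [l.IsCountablyGenerated]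
    {w : ι → (Fin n → ℝ) → ℝ} (C : ℝ)
    (hm : ∀ k, AEStronglyMeasurable (w k) volume)
    (hC : ∀ k, ∀ᵐ x, |w k x| ≤ C) (hlim : ∀ᵐ x, Tendsto (fun k => w k x) l (𝓝 (u x))) :
    anisoTV φ u ≤ liminf (fun k => anisoTV φ (w k)) l :=
  anisoTV_le_liminf fun _ hη => tendsto_integral_mul_diverg hη C hm hC hlim

lemma anisoTV_le_of_tendsto {ι : Type*} {l : Filter ι} [l.NeBot] [l.IsCountablyGenerated]
    {w : ι → (Fin n → ℝ) → ℝ} (C : ℝ)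
    (hm : ∀ k, AEStronglyMeasurable (w k) volume)
    (hC : ∀ k, ∀ᵐ x, |w k x| ≤ C) (hlim : ∀ᵐ x, Tendsto (fun k => w k x) l (𝓝 (u x)))
    {b : ι → ℝ≥0∞} {c : ℝ≥0∞} (hle : ∀ k, anisoTV φ (w k) ≤ b k) (hb : Tendsto b l (𝓝 c)) :
    anisoTV φ u ≤ c := by
  refine (anisoTV_le_liminf_of_ae C hm hC hlim).trans ?_
  rw [← hb.liminf_eq]
  exact liminf_le_liminf (Eventually.of_forall hle)

end TotalVariation

section Scaling

variable {φ : (Fin 2 → ℝ) → ℝ}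

lemma integral_comp_dilate {n : ℕ} (g : (Fin n → ℝ) → ℝ) {t : ℝ} (ht : 0 < t) (b : Fin n → ℝ) :
    ∫ x, g (t⁻¹ • (x - b)) = t ^ n * ∫ x, g x := by
  rw [integral_sub_right_eq_self (fun x => g (t⁻¹ • x)) b,
    Measure.integral_comp_inv_smul_of_nonneg volume g ht.le]
  simp

lemma diverg_comp_affine {n : ℕ} {η : (Fin n → ℝ) → (Fin n → ℝ)} (hη : ContDiff ℝ 1 η) (t : ℝ)
    (b x : Fin n → ℝ) : diverg (fun y => η (t • y + b)) x = t * diverg η (t • x + b) := by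
  have h1 : HasFDerivAt (fun y : Fin n → ℝ => t • y + b)
      (t • ContinuousLinearMap.id ℝ (Fin n → ℝ)) x :=
    ((hasFDerivAt_id x).const_smul t).add_const b
  have h2 := ((hη.differentiable one_ne_zero (t • x + b)).hasFDerivAt.comp x h1).fderiv
  have h3 : fderiv ℝ (fun y => η (t • y + b)) x = _ := h2
  simp only [diverg, h3, Finset.mul_sum]
  simp

lemma isTestField_comp_affine {n : ℕ} {φ : (Fin n → ℝ) → ℝ} {η : (Fin n → ℝ) → (Fin n → ℝ)}
    (hη : IsTestField φ η) {t : ℝ} (ht : t ≠ 0) (b : Fin n → ℝ) :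
    IsTestField φ (fun y => η (t • y + b)) := by
  refine ⟨hη.1.comp (by fun_prop), ?_, fun x => hη.2.2 _⟩
  have := hη.2.1.comp_homeomorph ((Homeomorph.smulOfNeZero t ht).trans (Homeomorph.addRight b))
  exact this

lemma anisoTV_dilate_le (u : (Fin 2 → ℝ) → ℝ) {t : ℝ} (ht : 0 < t) (b : Fin 2 → ℝ) :
    anisoTV φ (fun x => u (t⁻¹ • (x - b))) ≤ ENNReal.ofReal t * anisoTV φ u := by
  refine anisoTV_le fun η hη => ?_
  have h1 : ∫ x, u (t⁻¹ • (x - b)) * diverg η x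
      = t * ∫ x, u x * diverg (fun y => η (t • y + b)) x := by
    have h2 := integral_comp_dilate (fun y => u y * diverg η (t • y + b)) ht b
    have h3 : ∀ x : Fin 2 → ℝ, t • t⁻¹ • (x - b) + b = x := fun x => by
      rw [smul_smul, mul_inv_cancel₀ ht.ne', one_smul, sub_add_cancel]
    simp only [h3] at h2
    rw [h2]
    simp only [diverg_comp_affine hη.1]
    rw [← integral_const_mul, ← integral_const_mul]
    congr 1; ext x; ring
  rw [h1, ENNReal.ofReal_mul ht.le]
  gcongr
  exact le_anisoTV (isTestField_comp_affine hη ht.ne' b) u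

end Scaling

section Mollification

/-- A sequence of smooth bumps shrinking to the origin. -/
def mollBump (n k : ℕ) : ContDiffBump (0 : Fin n → ℝ) where
  rIn := 1 / ((k : ℝ) + 1)
  rOut := 2 / ((k : ℝ) + 1)
  rIn_pos := by positivity
  rIn_lt_rOut := by gcongr; norm_num

/-- The mollification of `w` at scale `2 / (k + 1)`. -/
def mollify {n : ℕ} (k : ℕ) (w : (Fin n → ℝ) → ℝ) : (Fin n → ℝ) → ℝ :=
  convolution ((mollBump n k).normed volume) w (ContinuousLinearMap.lsmul ℝ ℝ) volume

variable {n : ℕ} {φ : (Fin n → ℝ) → ℝ} {w g : (Fin n → ℝ) → ℝ}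

lemma mollBump_rOut_tendsto (n : ℕ) : Tendsto (fun k => (mollBump n k).rOut) atTop (𝓝 0) := by
  have h := (tendsto_one_div_add_atTop_nhds_zero_nat (𝕜 := ℝ)).const_mul 2
  simp only [mul_zero, mul_one_div] at h
  exact h

lemma integrable_mollBump (k : ℕ) : Integrable ((mollBump n k).normed volume) :=
  (mollBump n k).integrable_normed

lemma mollify_apply (k : ℕ) (w : (Fin n → ℝ) → ℝ) (x : Fin n → ℝ) :
    mollify k w x = ∫ t, (mollBump n k).normed volume t * w (x - t) := rfl

lemma mollify_contDiff (k : ℕ) (hw : LocallyIntegrable w) : ContDiff ℝ 1 (mollify k w) :=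
  ((mollBump n k).hasCompactSupport_normed).contDiff_convolution_left (n := 1) _
    (mollBump n k).contDiff_normed hw

lemma mollify_contDiff_two (k : ℕ) (hw : LocallyIntegrable w) : ContDiff ℝ 2 (mollify k w) :=
  ((mollBump n k).hasCompactSupport_normed).contDiff_convolution_left (n := 2) _
    (mollBump n k).contDiff_normed hw

lemma mollify_hasCompactSupport (k : ℕ) (hw : HasCompactSupport w) :
    HasCompactSupport (mollify k w) :=
  HasCompactSupport.convolution _ (mollBump n k).hasCompactSupport_normed hw

lemma mollify_integrable (k : ℕ) (hw : Integrable w) : Integrable (mollify k w) :=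
  (integrable_mollBump k).integrable_convolution _ hw

lemma mollify_ae_tendsto (hw : LocallyIntegrable w) :
    ∀ᵐ x, Tendsto (fun k => mollify k w x) atTop (𝓝 (w x)) := by
  refine ContDiffBump.ae_convolution_tendsto_right_of_locallyIntegrable (K := 2)
    (mollBump_rOut_tendsto n) (Eventually.of_forall fun k => ?_) hw
  simp only [mollBump]
  apply le_of_eq; ring

lemma mollify_nonneg (k : ℕ) (hw : ∀ x, 0 ≤ w x) (x) : 0 ≤ mollify k w x :=
  integral_nonneg fun t => mul_nonneg ((mollBump n k).nonneg_normed t) (hw _)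

lemma mollify_le {C : ℝ} (k : ℕ) (hw : LocallyIntegrable w) (hC : ∀ x, w x ≤ C) (x) :
    mollify k w x ≤ C := by
  rw [mollify_apply]
  calc ∫ t, (mollBump n k).normed volume t * w (x - t)
      ≤ ∫ t, (mollBump n k).normed volume t * C := by
        refine integral_mono ?_ ((integrable_mollBump k).mul_const C) fun t => ?_
        · exact ((mollBump n k).hasCompactSupport_normed).convolutionExists_left
            (ContinuousLinearMap.lsmul ℝ ℝ) (mollBump n k).continuous_normed hw x
        · exact mul_le_mul_of_nonneg_left (hC _) ((mollBump n k).nonneg_normed t)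
    _ = C := by rw [integral_mul_const, (mollBump n k).integral_normed, one_mul]

lemma integral_mollify_mul (k : ℕ) (hw : Integrable w) (hg : Continuous g) {C : ℝ}
    (hC : ∀ x, |g x| ≤ C) :
    ∫ x, mollify k w x * g x
      = ∫ t, (mollBump n k).normed volume t * ∫ x, w x * g (x + t) := by
  have hI : Integrable (Function.uncurry fun x t : Fin n → ℝ =>
      (mollBump n k).normed volume t * w (x - t) * g x) (volume.prod volume) := by
    have h := (integrable_mollBump (n := n) k).convolution_integrand
      (ContinuousLinearMap.lsmul ℝ ℝ) hw
    exact h.mul_bdd (c := C) (hg.comp continuous_fst).aestronglyMeasurable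
      (Eventually.of_forall fun p => hC _)
  have h1 : ∀ x, mollify k w x * g x
      = ∫ t, (mollBump n k).normed volume t * w (x - t) * g x := fun x => by
    rw [mollify_apply, integral_mul_const]
  simp only [h1]
  rw [integral_integral_swap hI]
  congr 1; ext t
  simp only [mul_assoc]
  rw [integral_const_mul]
  congr 1
  rw [← integral_add_right_eq_self _ t]
  simp

lemma mollify_continuous_shift (hw : Integrable w) (hg : Continuous g) {C : ℝ}
    (hC : ∀ x, |g x| ≤ C) : Continuous fun t => ∫ x, w x * g (x + t) := by
  refine continuous_of_dominated (bound := fun x => |w x| * C) ?_ ?_ (hw.abs.mul_const C) ?_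
  · intro t
    exact hw.aestronglyMeasurable.mul (hg.comp (continuous_add_const t)).aestronglyMeasurable
  · intro t
    refine Eventually.of_forall fun x => ?_
    rw [Real.norm_eq_abs, abs_mul]
    gcongr
    exact hC _
  · refine Eventually.of_forall fun x => ?_
    fun_prop

lemma tendsto_integral_mollify_mul (hw : Integrable w) (hg : Continuous g) {C : ℝ}
    (hC : ∀ x, |g x| ≤ C) :
    Tendsto (fun k => ∫ x, mollify k w x * g x) atTop (𝓝 (∫ x, w x * g x)) := by
  have h := ContDiffBump.convolution_tendsto_right_of_continuous (μ := volume)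
    (mollBump_rOut_tendsto n) (g := fun t : Fin n → ℝ => ∫ x, w x * g (x + t))
    (mollify_continuous_shift hw hg hC) 0
  simp only [add_zero] at h
  refine h.congr fun k => ?_
  rw [integral_mollify_mul k hw hg hC, convolution_def,
    ← integral_neg_eq_self (μ := (volume : Measure (Fin n → ℝ)))]
  simp [ContDiffBump.normed_neg]

lemma integral_mollify_mul_le (k : ℕ) (hw : Integrable w) (hg : Continuous g) {C c : ℝ}
    (hC : ∀ x, |g x| ≤ C) (hc : ∀ t, ∫ x, w x * g (x + t) ≤ c) :
    ∫ x, mollify k w x * g x ≤ c := by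
  rw [integral_mollify_mul k hw hg hC]
  calc ∫ t, (mollBump n k).normed volume t * ∫ x, w x * g (x + t)
      ≤ ∫ t, (mollBump n k).normed volume t * c := by
        refine integral_mono ?_ ((integrable_mollBump k).mul_const c) fun t => ?_
        · refine Continuous.integrable_of_hasCompactSupport
            ((mollBump n k).continuous_normed.mul (mollify_continuous_shift hw hg hC)) ?_
          exact ((mollBump n k).hasCompactSupport_normed).mul_right
        · exact mul_le_mul_of_nonneg_left (hc t) ((mollBump n k).nonneg_normed t)
    _ = c := by rw [integral_mul_const, (mollBump n k).integral_normed, one_mul]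

lemma anisoTV_mollify_le (k : ℕ) (hw : Integrable w) :
    anisoTV φ (mollify k w) ≤ anisoTV φ w := by
  by_cases hT : anisoTV φ w = ⊤
  · simp [hT]
  refine anisoTV_le fun η hη => ?_
  obtain ⟨C, -, hC⟩ := hη.exists_bound
  refine ENNReal.ofReal_le_of_le_toReal ?_
  refine integral_mollify_mul_le k hw (diverg_continuous hη.1) hC fun t => ?_
  have h1 := isTestField_comp_affine hη one_ne_zero t
  have h2 := integral_le_anisoTV h1 hT
  simp only [diverg_comp_affine hη.1] at h2
  simpa using h2

end Mollification

section SmoothStep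

/-- The primitive of the smooth transition function vanishing on `(-∞, 0]`. -/
def smoothRamp (s : ℝ) : ℝ := ∫ t in (0 : ℝ)..s, Real.smoothTransition t

lemma hasDerivAt_smoothRamp (s : ℝ) : HasDerivAt smoothRamp (Real.smoothTransition s) s :=
  Real.smoothTransition.continuous.integral_hasStrictDerivAt 0 s |>.hasDerivAt

lemma smoothRamp_of_nonpos {s : ℝ} (hs : s ≤ 0) : smoothRamp s = 0 := by
  unfold smoothRamp
  rw [intervalIntegral.integral_congr (g := fun _ => (0 : ℝ))]
  · simp
  · intro t ht
    rw [uIcc_of_ge hs] at ht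
    exact Real.smoothTransition.zero_of_nonpos ht.2

lemma smoothRamp_nonneg (s : ℝ) : 0 ≤ smoothRamp s := by
  rcases le_total s 0 with hs | hs
  · rw [smoothRamp_of_nonpos hs]
  · exact intervalIntegral.integral_nonneg hs fun t _ => Real.smoothTransition.nonneg t

lemma smoothRamp_le_max (s : ℝ) : smoothRamp s ≤ max s 0 := by
  rcases le_total s 0 with hs | hs
  · rw [smoothRamp_of_nonpos hs]; exact le_max_right _ _
  · refine le_trans ?_ (le_max_left _ _)
    have := intervalIntegral.integral_mono_on (μ := volume) hs
      (Real.smoothTransition.continuous.intervalIntegrable 0 s)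
      (intervalIntegrable_const (c := (1 : ℝ))) fun t _ => Real.smoothTransition.le_one t
    rw [intervalIntegral.integral_const, sub_zero, smul_eq_mul, mul_one] at this
    exact this

lemma sub_one_le_smoothRamp (s : ℝ) : s - 1 ≤ smoothRamp s := by
  rcases le_total s 1 with hs | hs
  · linarith [smoothRamp_nonneg s]
  · have h1 : smoothRamp s = smoothRamp 1 + ∫ t in (1 : ℝ)..s, Real.smoothTransition t := by
      unfold smoothRamp
      rw [intervalIntegral.integral_add_adjacent_intervals] <;>
        exact Real.smoothTransition.continuous.intervalIntegrable _ _
    have h2 : ∫ t in (1 : ℝ)..s, Real.smoothTransition t = s - 1 := by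
      rw [intervalIntegral.integral_congr (g := fun _ => (1 : ℝ))]
      · simp
      · intro t ht
        rw [uIcc_of_le hs] at ht
        exact Real.smoothTransition.one_of_one_le ht.1
    rw [h1, h2]
    linarith [smoothRamp_nonneg 1]

/-- A smooth approximation of `t ↦ max (t - x) 0` at scale `δ`. -/
def smoothExcess (x δ t : ℝ) : ℝ := δ * smoothRamp ((t - x) / δ)

/-- The derivative of `smoothExcess`. -/
def smoothStep (x δ t : ℝ) : ℝ := Real.smoothTransition ((t - x) / δ)

lemma smoothStep_contDiff (x δ : ℝ) : ContDiff ℝ 1 (smoothStep x δ) :=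
  (Real.smoothTransition.contDiff (n := 1)).comp
    ((contDiff_id.sub contDiff_const).div_const δ)

lemma smoothStep_nonneg (x δ t : ℝ) : 0 ≤ smoothStep x δ t := Real.smoothTransition.nonneg _

lemma smoothStep_le_one (x δ t : ℝ) : smoothStep x δ t ≤ 1 := Real.smoothTransition.le_one _

lemma smoothStep_of_le {x δ t : ℝ} (hδ : 0 < δ) (h : t ≤ x) : smoothStep x δ t = 0 :=
  Real.smoothTransition.zero_of_nonpos (div_nonpos_of_nonpos_of_nonneg (by linarith) hδ.le)

lemma smoothStep_of_ge {x δ t : ℝ} (hδ : 0 < δ) (h : x + δ ≤ t) : smoothStep x δ t = 1 :=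
  Real.smoothTransition.one_of_one_le ((one_le_div hδ).2 (by linarith))

lemma hasDerivAt_smoothExcess {x δ : ℝ} (hδ : 0 < δ) (t : ℝ) :
    HasDerivAt (smoothExcess x δ) (smoothStep x δ t) t := by
  have h1 : HasDerivAt (fun t : ℝ => (t - x) / δ) (1 / δ) t :=
    ((hasDerivAt_id t).sub_const x).div_const δ
  have h2 := ((hasDerivAt_smoothRamp ((t - x) / δ)).comp t h1).const_mul δ
  have h3 : δ * (Real.smoothTransition ((t - x) / δ) * (1 / δ)) = smoothStep x δ t := by
    unfold smoothStep
    field_simp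
  rw [← h3]
  exact h2

lemma smoothExcess_contDiff {x δ : ℝ} (hδ : 0 < δ) : ContDiff ℝ 1 (smoothExcess x δ) := by
  rw [contDiff_one_iff_deriv]
  refine ⟨fun t => (hasDerivAt_smoothExcess hδ t).differentiableAt, ?_⟩
  have : deriv (smoothExcess x δ) = smoothStep x δ :=
    funext fun t => (hasDerivAt_smoothExcess hδ t).deriv
  rw [this]
  exact (smoothStep_contDiff x δ).continuous

lemma smoothExcess_le {x δ : ℝ} (hδ : 0 < δ) (t : ℝ) : smoothExcess x δ t ≤ max (t - x) 0 := by
  unfold smoothExcess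
  calc δ * smoothRamp ((t - x) / δ) ≤ δ * max ((t - x) / δ) 0 := by
        gcongr; exact smoothRamp_le_max _
    _ = max (t - x) 0 := by
        rw [mul_max_of_nonneg _ _ hδ.le, mul_div_cancel₀ _ hδ.ne', mul_zero]

lemma smoothExcess_nonneg {x δ : ℝ} (hδ : 0 < δ) (t : ℝ) : 0 ≤ smoothExcess x δ t :=
  mul_nonneg hδ.le (smoothRamp_nonneg _)

lemma le_smoothExcess {x δ : ℝ} (hδ : 0 < δ) (t : ℝ) : max (t - x) 0 - δ ≤ smoothExcess x δ t := by
  have h := mul_le_mul_of_nonneg_left (sub_one_le_smoothRamp ((t - x) / δ)) hδ.le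
  rw [mul_sub, mul_div_cancel₀ _ hδ.ne'] at h
  rw [sub_le_iff_le_add]
  refine max_le ?_ ?_
  · unfold smoothExcess; linarith
  · linarith [smoothExcess_nonneg (x := x) hδ t]

end SmoothStep

section Truncation

variable {n : ℕ} {φ : (Fin n → ℝ) → ℝ} {η η₁ η₂ : (Fin n → ℝ) → (Fin n → ℝ)}
  {w : (Fin n → ℝ) → ℝ}

lemma hasCompactSupport_smul_field (g : (Fin n → ℝ) → ℝ) (hη : HasCompactSupport η) :
    HasCompactSupport (fun x => g x • η x) :=
  HasCompactSupport.smul_left (f := g) hη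

lemma contDiff_smul_field {g : (Fin n → ℝ) → ℝ} (hg : ContDiff ℝ 1 g) (hη : ContDiff ℝ 1 η) :
    ContDiff ℝ 1 (fun x => g x • η x) :=
  hg.smul hη

lemma IsNorm.isTestField_combo (hφ : IsNorm φ) {g : (Fin n → ℝ) → ℝ} (hg : ContDiff ℝ 1 g)
    (h0 : ∀ x, 0 ≤ g x) (h1 : ∀ x, g x ≤ 1) (h₁ : IsTestField φ η₁) (h₂ : IsTestField φ η₂) :
    IsTestField φ (fun x => η₁ x + g x • (η₂ x - η₁ x)) := by
  refine ⟨h₁.1.add (contDiff_smul_field hg (h₂.1.sub h₁.1)), ?_, fun x => ?_⟩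
  · exact h₁.2.1.add (hasCompactSupport_smul_field g (h₂.2.1.sub h₁.2.1))
  · have e : η₁ x + g x • (η₂ x - η₁ x) = (1 - g x) • η₁ x + g x • η₂ x := by module
    exact (congrArg φ e).trans_le <| hφ.combo_le_one (h₁.2.2 x) (h₂.2.2 x) (h0 x) (h1 x)

lemma integral_mul_diverg_smoothStep {x δ : ℝ} (hδ : 0 < δ) (hw : ContDiff ℝ 1 w)
    (hη : ContDiff ℝ 1 η) (hc : HasCompactSupport η) :
    ∫ y, w y * diverg (fun y => smoothStep x δ (w y) • η y) y
      = ∫ y, smoothExcess x δ (w y) * diverg η y := by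
  have hs : ContDiff ℝ 1 fun y => smoothStep x δ (w y) := (smoothStep_contDiff x δ).comp hw
  have he : ContDiff ℝ 1 fun y => smoothExcess x δ (w y) := (smoothExcess_contDiff hδ).comp hw
  have hG : ContDiff ℝ 1 fun y => w y * smoothStep x δ (w y) - smoothExcess x δ (w y) :=
    (hw.mul hs).sub he
  have h0 : ∫ y, diverg (fun y => (w y * smoothStep x δ (w y) - smoothExcess x δ (w y)) • η y) y
      = 0 := integral_diverg_eq_zero (contDiff_smul_field hG hη) (hasCompactSupport_smul_field _ hc)
  have key : ∀ y, w y * diverg (fun y => smoothStep x δ (w y) • η y) y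
      = diverg (fun y => (w y * smoothStep x δ (w y) - smoothExcess x δ (w y)) • η y) y
        + smoothExcess x δ (w y) * diverg η y := by
    intro y
    have dw := hw.differentiable one_ne_zero y
    have ds := hs.differentiable one_ne_zero y
    have de := he.differentiable one_ne_zero y
    have dη := hη.differentiable one_ne_zero y
    rw [diverg_smul ds dη, diverg_smul (hG.differentiable one_ne_zero y) dη]
    have e1 : fderiv ℝ (fun y => w y * smoothStep x δ (w y) - smoothExcess x δ (w y)) y
        = w y • fderiv ℝ (fun y => smoothStep x δ (w y)) y
          + smoothStep x δ (w y) • fderiv ℝ w y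
          - fderiv ℝ (fun y => smoothExcess x δ (w y)) y := by
      have := ((dw.hasFDerivAt.mul ds.hasFDerivAt).sub de.hasFDerivAt).fderiv
      exact this
    have e2 : fderiv ℝ (fun y => smoothExcess x δ (w y)) y
        = smoothStep x δ (w y) • fderiv ℝ w y := by
      have := ((hasDerivAt_smoothExcess (x := x) hδ (w y)).comp_hasFDerivAt y dw.hasFDerivAt).fderiv
      exact this
    rw [e1, e2]
    simp
    ring
  simp only [key]
  have i2 : Integrable fun y => smoothExcess x δ (w y) * diverg η y :=
    integrable_mul_diverg he.continuous.locallyIntegrable hη hc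
  have i1 : Integrable fun y => diverg
      (fun y => (w y * smoothStep x δ (w y) - smoothExcess x δ (w y)) • η y) y :=
    (diverg_continuous (contDiff_smul_field hG hη)).integrable_of_hasCompactSupport
      (diverg_hasCompactSupport (hasCompactSupport_smul_field _ hc))
  rw [integral_add i1 i2, h0, zero_add]

/-- Truncation splits the total variation. -/
lemma anisoTV_min_add_anisoTV_excess_le (hφ : IsNorm φ) (hw : Integrable w) (hw0 : ∀ y, 0 ≤ w y)
    {x : ℝ} (hx : 0 ≤ x) :
    anisoTV φ (fun y => min (w y) x) + anisoTV φ (fun y => max (w y - x) 0) ≤ anisoTV φ w := by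
  by_cases hT : anisoTV φ w = ⊤
  · simp [hT]
  refine anisoTV_add_anisoTV_le hφ fun η₁ η₂ h₁ h₂ => ENNReal.ofReal_le_of_le_toReal ?_
  have hsub : ContDiff ℝ 1 (fun y => η₂ y - η₁ y) := h₂.1.sub h₁.1
  have hsubc : HasCompactSupport (fun y => η₂ y - η₁ y) := h₂.2.1.sub h₁.2.1
  have hdsub : ∀ y, diverg (fun y => η₂ y - η₁ y) y = diverg η₂ y - diverg η₁ y := by
    intro y
    have := diverg_add (h₂.1.differentiable one_ne_zero y)
      (h₁.1.neg.differentiable one_ne_zero y)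
    simp only [diverg_neg] at this
    simpa [sub_eq_add_neg] using this
  set δ : ℕ → ℝ := fun k => 1 / ((k : ℝ) + 1) with hδdef
  have hδ : ∀ k, 0 < δ k := fun k => by simp only [hδdef]; positivity
  have hδ1 : ∀ k, δ k ≤ 1 := fun k => by
    simp only [hδdef]; rw [div_le_one (by positivity)]; linarith [k.cast_nonneg (α := ℝ)]
  have hδ0 : Tendsto δ atTop (𝓝 0) := tendsto_one_div_add_atTop_nhds_zero_nat
  have hmc : ∀ k, ContDiff ℝ 1 (mollify k w) := fun k => mollify_contDiff k hw.locallyIntegrable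
  have hmi : ∀ k, Integrable (mollify k w) := fun k => mollify_integrable k hw
  set B : ℕ → (Fin n → ℝ) → ℝ := fun k y =>
    mollify k w y - smoothExcess x (δ k) (mollify k w y) with hB
  have hBc : ∀ k, Continuous (B k) := fun k =>
    (hmc k).continuous.sub ((smoothExcess_contDiff (hδ k)).continuous.comp (hmc k).continuous)
  have hmin : ∀ t : ℝ, t - max (t - x) 0 = min t x := by
    intro t
    rcases le_total t x with h | h
    · rw [max_eq_right (by linarith), min_eq_left h, sub_zero]
    · rw [max_eq_left (by linarith), min_eq_right h]; ring
  have hBl : ∀ k y, min (mollify k w y) x ≤ B k y := fun k y => by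
    have := smoothExcess_le (x := x) (hδ k) (mollify k w y)
    rw [← hmin]; simp only [hB]; linarith
  have hBu : ∀ k y, B k y ≤ min (mollify k w y) x + δ k := fun k y => by
    have := le_smoothExcess (x := x) (hδ k) (mollify k w y)
    rw [← hmin]; simp only [hB]; linarith
  have hBlim : ∀ᵐ y, Tendsto (fun k => B k y) atTop (𝓝 (min (w y) x)) := by
    filter_upwards [mollify_ae_tendsto hw.locallyIntegrable] with y hy
    have h1 : Tendsto (fun k => min (mollify k w y) x) atTop (𝓝 (min (w y) x)) :=
      hy.min tendsto_const_nhds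
    have h2 : Tendsto (fun k => min (mollify k w y) x + δ k) atTop (𝓝 (min (w y) x)) := by
      simpa using h1.add hδ0
    exact tendsto_of_tendsto_of_tendsto_of_le_of_le h1 h2 (fun k => hBl k y) fun k => hBu k y
  have hBbd : ∀ k, ∀ᵐ y, |B k y| ≤ x + 1 := fun k => Eventually.of_forall fun y => by
    have h0 : 0 ≤ min (mollify k w y) x := le_min (mollify_nonneg k hw0 y) hx
    rw [abs_of_nonneg (h0.trans (hBl k y))]
    exact (hBu k y).trans (add_le_add (min_le_right _ _) (hδ1 k))
  have hle : ∀ k, (∫ y, mollify k w y * diverg η₂ y) + ((∫ y, B k y * diverg η₁ y)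
      - ∫ y, B k y * diverg η₂ y) ≤ (anisoTV φ w).toReal := by
    intro k
    have hsc : ContDiff ℝ 1 fun y => smoothStep x (δ k) (mollify k w y) :=
      (smoothStep_contDiff x (δ k)).comp (hmc k)
    have ht := hφ.isTestField_combo hsc (fun y => smoothStep_nonneg _ _ _)
      (fun y => smoothStep_le_one _ _ _) h₁ h₂
    have hk : anisoTV φ (mollify k w) ≠ ⊤ :=
      ne_top_of_le_ne_top hT (anisoTV_mollify_le k hw)
    refine le_trans (le_of_eq ?_) ((integral_le_anisoTV ht hk).trans
      (ENNReal.toReal_mono hT (anisoTV_mollify_le k hw)))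
    have e1 : ∀ y, mollify k w y * diverg (fun y => η₁ y +
        smoothStep x (δ k) (mollify k w y) • (η₂ y - η₁ y)) y
        = mollify k w y * diverg η₁ y + mollify k w y * diverg (fun y =>
          smoothStep x (δ k) (mollify k w y) • (η₂ y - η₁ y)) y := by
      intro y
      rw [diverg_add (h₁.1.differentiable one_ne_zero y)
        ((contDiff_smul_field hsc hsub).differentiable one_ne_zero y), mul_add]
    simp only [e1]
    rw [integral_add (h₁.integrable_mul (hmi k)) (integrable_mul_diverg
      (hmi k).locallyIntegrable (contDiff_smul_field hsc hsub)
        (hasCompactSupport_smul_field _ hsubc)),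
      integral_mul_diverg_smoothStep (hδ k) (hmc k) hsub hsubc]
    have hBi : ∀ {η}, IsTestField φ η → Integrable fun y => B k y * diverg η y := fun hη =>
      integrable_mul_diverg (hBc k).locallyIntegrable hη.1 hη.2.1
    have i1 := h₁.integrable_mul (hmi k)
    have i2 := h₂.integrable_mul (hmi k)
    have e2 : ∀ y, smoothExcess x (δ k) (mollify k w y) * diverg (fun y => η₂ y - η₁ y) y
        = (mollify k w y * diverg η₂ y - mollify k w y * diverg η₁ y)
          + (B k y * diverg η₁ y - B k y * diverg η₂ y) := by
      intro y
      rw [hdsub]; simp only [hB]; ring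
    simp only [e2]
    have i3 : Integrable fun y => mollify k w y * diverg η₂ y - mollify k w y * diverg η₁ y :=
      i2.sub i1
    have i4 : Integrable fun y => B k y * diverg η₁ y - B k y * diverg η₂ y :=
      (hBi h₁).sub (hBi h₂)
    rw [integral_add i3 i4, integral_sub i2 i1,
      integral_sub (hBi h₁) (hBi h₂)]
    ring
  have hlim : Tendsto (fun k => (∫ y, mollify k w y * diverg η₂ y) + ((∫ y, B k y * diverg η₁ y)
      - ∫ y, B k y * diverg η₂ y)) atTop (𝓝 ((∫ y, w y * diverg η₂ y)
        + ((∫ y, min (w y) x * diverg η₁ y) - ∫ y, min (w y) x * diverg η₂ y))) := by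
    obtain ⟨C, -, hC⟩ := h₂.exists_bound
    refine (tendsto_integral_mollify_mul hw (diverg_continuous h₂.1) hC).add (Tendsto.sub ?_ ?_)
    · exact tendsto_integral_mul_diverg h₁ (x + 1) (fun k => (hBc k).aestronglyMeasurable)
        hBbd hBlim
    · exact tendsto_integral_mul_diverg h₂ (x + 1) (fun k => (hBc k).aestronglyMeasurable)
        hBbd hBlim
  refine le_trans (le_of_eq ?_) (le_of_tendsto' hlim hle)
  have hmi' : Integrable fun y => min (w y) x := by
    refine hw.mono (hw.aestronglyMeasurable.inf aestronglyMeasurable_const)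
      (Eventually.of_forall fun y => ?_)
    rw [Real.norm_of_nonneg (le_min (hw0 y) hx), Real.norm_of_nonneg (hw0 y)]
    exact min_le_left _ _
  have e3 : ∀ y, max (w y - x) 0 * diverg η₂ y
      = w y * diverg η₂ y - min (w y) x * diverg η₂ y := by
    intro y
    rw [← hmin]; ring
  simp only [e3]
  rw [integral_sub (h₂.integrable_mul hw) (h₂.integrable_mul hmi')]
  ring

end Truncation

section LevelSets

variable {n : ℕ} {φ : (Fin n → ℝ) → ℝ} {u : (Fin n → ℝ) → ℝ}

lemma integrable_excess (hu : Integrable u) (hu0 : ∀ y, 0 ≤ u y) {x : ℝ} (hx : 0 ≤ x) :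
    Integrable fun y => max (u y - x) 0 := by
  refine hu.mono ((hu.aestronglyMeasurable.sub aestronglyMeasurable_const).sup
    aestronglyMeasurable_const) (Eventually.of_forall fun y => ?_)
  rw [Real.norm_of_nonneg (le_max_right _ _), Real.norm_of_nonneg (hu0 y)]
  exact max_le (by linarith) (hu0 y)

lemma integrable_truncate (hu : Integrable u) (hu0 : ∀ y, 0 ≤ u y) {x : ℝ} (hx : 0 ≤ x) :
    Integrable fun y => min (u y) x := by
  refine hu.mono (hu.aestronglyMeasurable.inf aestronglyMeasurable_const)
    (Eventually.of_forall fun y => ?_)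
  rw [Real.norm_of_nonneg (le_min (hu0 y) hx), Real.norm_of_nonneg (hu0 y)]
  exact min_le_left _ _

/-- Removing one level set from an integer-valued function splits the total variation. -/
lemma anisoTV_sub_indicator_add_le (hφ : IsNorm φ) (hu : Integrable u)
    (hN : ∀ x, ∃ k : ℕ, u x = k) {j : ℕ} (hj : 1 ≤ j) :
    anisoTV φ (fun x => u x - {x | (j : ℝ) ≤ u x}.indicator 1 x)
      + anisoPerimeter φ {x | (j : ℝ) ≤ u x} ≤ anisoTV φ u := by
  have hu0 : ∀ x, 0 ≤ u x := fun x => by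
    obtain ⟨k, hk⟩ := hN x
    rw [hk]; positivity
  obtain ⟨i, rfl⟩ : ∃ i, j = i + 1 := ⟨j - 1, by omega⟩
  have hi : (0 : ℝ) ≤ i := by positivity
  have h1 := anisoTV_min_add_anisoTV_excess_le hφ hu hu0 hi
  have hw := integrable_excess hu hu0 hi
  have h2 := anisoTV_min_add_anisoTV_excess_le hφ hw (fun _ => le_max_right _ _)
    (zero_le_one (α := ℝ))
  have hv := integrable_excess hw (fun _ => le_max_right _ _) (zero_le_one (α := ℝ))
  have e1 : (fun y => min (max (u y - i) 0) 1)
      = {x | ((i + 1 : ℕ) : ℝ) ≤ u x}.indicator 1 := by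
    ext y
    obtain ⟨k, hk⟩ := hN y
    by_cases h : i + 1 ≤ k
    · have hm : y ∈ {x | ((i + 1 : ℕ) : ℝ) ≤ u x} := by
        simp only [mem_ofPred_eq, hk]; exact_mod_cast h
      have h' : (i : ℝ) + 1 ≤ k := by exact_mod_cast h
      rw [indicator_of_mem hm, hk, max_eq_left (by linarith), min_eq_right (by linarith)]
      rfl
    · have hm : y ∉ {x | ((i + 1 : ℕ) : ℝ) ≤ u x} := by
        simp only [mem_ofPred_eq, hk]; exact_mod_cast h
      have h' : (k : ℝ) ≤ i := by exact_mod_cast (by omega : k ≤ i)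
      rw [indicator_of_notMem hm, hk, max_eq_right (by linarith), min_eq_left (by linarith)]
  have e2 : (fun x => u x - {x | ((i + 1 : ℕ) : ℝ) ≤ u x}.indicator 1 x)
      = fun y => min (u y) i + max (max (u y - i) 0 - 1) 0 := by
    ext y
    rw [← e1]
    dsimp only
    rcases le_total (u y) i with h | h
    · rw [min_eq_left h, max_eq_right (by linarith : u y - i ≤ 0), min_eq_left zero_le_one,
        max_eq_right (by linarith)]; ring
    · rw [min_eq_right h, max_eq_left (by linarith : 0 ≤ u y - i)]
      rcases le_total (u y - i) 1 with h' | h'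
      · rw [min_eq_left h', max_eq_right (by linarith)]; ring
      · rw [min_eq_right h', max_eq_left (by linarith)]; ring
  rw [e1] at h2
  rw [e2]
  have h3 := anisoTV_add_le (φ := φ) (integrable_truncate hu hu0 hi) hv
  calc _ ≤ (anisoTV φ (fun y => min (u y) i) + anisoTV φ fun y => max (max (u y - i) 0 - 1) 0)
        + anisoPerimeter φ {x | ((i + 1 : ℕ) : ℝ) ≤ u x} := by gcongr
    _ = anisoTV φ (fun y => min (u y) i) + (anisoPerimeter φ {x | ((i + 1 : ℕ) : ℝ) ≤ u x}
        + anisoTV φ fun y => max (max (u y - i) 0 - 1) 0) := by ring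
    _ ≤ anisoTV φ (fun y => min (u y) i) + anisoTV φ fun y => max (u y - i) 0 := by
        gcongr; exact h2
    _ ≤ _ := h1

lemma integrable_indicator_one {E : Set (Fin n → ℝ)} (hE : MeasurableSet E)
    (hf : volume E ≠ ⊤) : Integrable (E.indicator (1 : (Fin n → ℝ) → ℝ)) :=
  (integrable_indicator_iff hE).2 (integrableOn_const hf)

lemma anisoPerimeter_union_le (hφ : IsNorm φ) {A B : Set (Fin n → ℝ)} (hA : MeasurableSet A)
    (hB : MeasurableSet B) (hAf : volume A ≠ ⊤) (hBf : volume B ≠ ⊤) :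
    anisoPerimeter φ (A ∪ B) ≤ anisoPerimeter φ A + anisoPerimeter φ B := by
  have iA := integrable_indicator_one hA hAf
  have iB := integrable_indicator_one hB hBf
  have h1 := anisoTV_add_le (φ := φ) iA iB
  have h2 := anisoTV_sub_indicator_add_le hφ (iA.add iB) (j := 1) (fun x => by
    by_cases ha : x ∈ A <;> by_cases hb : x ∈ B
    · exact ⟨2, by simp [ha, hb]; norm_num⟩
    · exact ⟨1, by simp [ha, hb]⟩
    · exact ⟨1, by simp [ha, hb]⟩
    · exact ⟨0, by simp [ha, hb]⟩) le_rfl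
  have h3 : {x | ((1 : ℕ) : ℝ) ≤ (A.indicator (1 : (Fin n → ℝ) → ℝ)
      + B.indicator (1 : (Fin n → ℝ) → ℝ)) x} = A ∪ B := by
    ext x
    by_cases ha : x ∈ A <;> by_cases hb : x ∈ B <;> simp [ha, hb]
  rw [h3] at h2
  exact (le_add_self.trans h2).trans h1

end LevelSets

section Locality

variable {n : ℕ} {φ : (Fin n → ℝ) → ℝ}

lemma exists_smooth_cutoff {s t : Set (Fin n → ℝ)} (hs : IsClosed s) (ht : IsClosed t)
    (hd : Disjoint s t) : ∃ ζ : (Fin n → ℝ) → ℝ, ContDiff ℝ 1 ζ ∧ (∀ x ∈ s, ∀ᶠ y in 𝓝 x, ζ y = 0) ∧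
      (∀ x ∈ t, ∀ᶠ y in 𝓝 x, ζ y = 1) ∧ (∀ x, 0 ≤ ζ x) ∧ ∀ x, ζ x ≤ 1 := by
  obtain ⟨f, h0, h1, h⟩ := exists_contMDiffMap_zero_one_nhds_of_isClosed (n := 1)
    (modelWithCornersSelf ℝ (Fin n → ℝ)) hs ht hd
  exact ⟨f, f.contMDiff.contDiff, eventually_nhdsSet_iff_forall.1 h0,
    eventually_nhdsSet_iff_forall.1 h1, fun x => (h x).1, fun x => (h x).2⟩

lemma diverg_congr {η ξ : (Fin n → ℝ) → (Fin n → ℝ)} {x : Fin n → ℝ} (h : η =ᶠ[𝓝 x] ξ) :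
    diverg η x = diverg ξ x := by
  simp only [diverg, h.fderiv_eq]

/-- The total variations of pieces supported on disjoint closed sets add up. -/
lemma anisoTV_indicator_add_le (hφ : IsNorm φ) {g : (Fin n → ℝ) → ℝ} (hg : Integrable g)
    {s t : Set (Fin n → ℝ)} (hs : IsClosed s) (ht : IsClosed t) (hd : Disjoint s t)
    (h0 : ∀ x, x ∉ s ∪ t → g x = 0) :
    anisoTV φ (s.indicator g) + anisoTV φ (t.indicator g) ≤ anisoTV φ g := by
  obtain ⟨ζ, hζ, hζs, hζt, hζ0, hζ1⟩ := exists_smooth_cutoff hs ht hd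
  refine anisoTV_add_anisoTV_le hφ fun η₁ η₂ h₁ h₂ => ?_
  have hη := hφ.isTestField_combo hζ hζ0 hζ1 h₁ h₂
  refine le_trans (le_of_eq ?_) (le_anisoTV hη g)
  rw [← integral_add (h₁.integrable_mul (hg.indicator hs.measurableSet))
    (h₂.integrable_mul (hg.indicator ht.measurableSet))]
  congr 1
  refine integral_congr_ae (Eventually.of_forall fun x => ?_)
  dsimp only
  by_cases hxs : x ∈ s
  · have hxt : x ∉ t := disjoint_left.1 hd hxs
    rw [indicator_of_mem hxs, indicator_of_notMem hxt, zero_mul, add_zero]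
    congr 1
    refine (diverg_congr ?_).symm
    filter_upwards [hζs x hxs] with y hy
    simp [hy]
  · by_cases hxt : x ∈ t
    · rw [indicator_of_mem hxt, indicator_of_notMem hxs, zero_mul, zero_add]
      congr 1
      refine (diverg_congr ?_).symm
      filter_upwards [hζt x hxt] with y hy
      simp [hy]
    · rw [h0 x (by simp [hxs, hxt]), indicator_of_notMem hxs, indicator_of_notMem hxt]
      simp

end Locality

section Isoperimetric

lemma integral_abs_fderiv_le {n : ℕ} {φ : (Fin n → ℝ) → ℝ} {C : ℝ} (hC0 : 0 < C)
    (hC : ∀ x, φ x ≤ C * ‖x‖) {f : (Fin n → ℝ) → ℝ} (hf : ContDiff ℝ 2 f)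
    (hc : HasCompactSupport f) (hT : anisoTV φ f ≠ ⊤) (i : Fin n) :
    ∫ x, |fderiv ℝ f x (Pi.single i 1)| ≤ C * (anisoTV φ f).toReal := by
  set s : (Fin n → ℝ) → ℝ := fun x => fderiv ℝ f x (Pi.single i 1) with hs
  have hs1 : ContDiff ℝ 1 s :=
    (hf.fderiv_right (m := 1) (by norm_num)).clm_apply contDiff_const
  have hsc : HasCompactSupport s := hc.fderiv_apply ℝ _
  have hf1 : ContDiff ℝ 1 f := hf.of_le (by norm_num)
  have hsi : Integrable s := hs1.continuous.integrable_of_hasCompactSupport hsc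
  set δ : ℕ → ℝ := fun k => 1 / ((k : ℝ) + 1) with hδdef
  have hδ : ∀ k, 0 < δ k := fun k => by simp only [hδdef]; positivity
  have hδ0 : Tendsto δ atTop (𝓝 0) := tendsto_one_div_add_atTop_nhds_zero_nat
  set g : ℕ → (Fin n → ℝ) → ℝ := fun k x => s x / Real.sqrt (s x ^ 2 + δ k ^ 2) with hg
  have hpos : ∀ k x, 0 < s x ^ 2 + δ k ^ 2 := fun k x => by have := hδ k; positivity
  have hg1 : ∀ k, ContDiff ℝ 1 (g k) := fun k =>
    hs1.div (((hs1.pow 2).add contDiff_const).sqrt fun x => (hpos k x).ne')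
      fun x => (Real.sqrt_pos.2 (hpos k x)).ne'
  have hgb : ∀ k x, |g k x| ≤ 1 := fun k x => by
    rw [hg, abs_div, abs_of_pos (Real.sqrt_pos.2 (hpos k x)),
      div_le_one (Real.sqrt_pos.2 (hpos k x))]
    refine Real.le_sqrt_of_sq_le ?_
    rw [sq_abs]; nlinarith [sq_nonneg (δ k)]
  have hgc : ∀ k, HasCompactSupport (g k) := fun k => by
    refine hsc.mono fun x hx => ?_
    simp only [Function.mem_support] at hx ⊢
    contrapose! hx
    simp [hg, hx]
  have htest : ∀ k, IsTestField φ (fun x => g k x • (-C⁻¹ • Pi.single i (1 : ℝ) : Fin n → ℝ)) := by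
    intro k
    refine ⟨contDiff_smul_field (hg1 k) contDiff_const, (hgc k).smul_right, fun x => ?_⟩
    refine (hC _).trans ?_
    rw [norm_smul, norm_smul, norm_neg, Real.norm_eq_abs, norm_inv, Real.norm_of_nonneg hC0.le]
    have : ‖(Pi.single i (1 : ℝ) : Fin n → ℝ)‖ ≤ 1 := by
      rw [Pi.norm_single]; simp
    calc C * (|g k x| * (C⁻¹ * ‖(Pi.single i (1 : ℝ) : Fin n → ℝ)‖))
        ≤ C * (1 * (C⁻¹ * 1)) := by
          have := hgb k x
          gcongr
      _ = 1 := by field_simp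
  have hle : ∀ k, ∫ x, s x * g k x ≤ C * (anisoTV φ f).toReal := by
    intro k
    have h1 := integral_le_anisoTV (htest k) hT
    have h2 : ∫ x, f x * diverg (fun x => g k x • (-C⁻¹ • Pi.single i (1 : ℝ) : Fin n → ℝ)) x
        = C⁻¹ * ∫ x, s x * g k x := by
      have e : ∀ x, f x * diverg (fun x => g k x • (-C⁻¹ • Pi.single i (1 : ℝ) : Fin n → ℝ)) x
          = -C⁻¹ * (f x * fderiv ℝ (g k) x (Pi.single i 1)) := by
        intro x
        rw [diverg_smul ((hg1 k).differentiable one_ne_zero x) (differentiableAt_const _),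
          diverg_const, map_smul, smul_eq_mul]
        ring
      simp only [e]
      rw [integral_const_mul]
      have hgd : Continuous fun x => fderiv ℝ (g k) x (Pi.single i 1) :=
        ((hg1 k).continuous_fderiv one_ne_zero).clm_apply continuous_const
      rw [integral_mul_fderiv_eq_neg_fderiv_mul_of_integrable]
      · simp only [hs]; ring
      · exact (hs1.continuous.mul (hg1 k).continuous).integrable_of_hasCompactSupport
          hsc.mul_right
      · exact (hf1.continuous.mul hgd).integrable_of_hasCompactSupport hc.mul_right
      · exact (hf1.continuous.mul (hg1 k).continuous).integrable_of_hasCompactSupport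
          hc.mul_right
      · exact fun x _ => hf1.differentiable one_ne_zero x
      · exact fun x _ => (hg1 k).differentiable one_ne_zero x
    rw [h2] at h1
    calc ∫ x, s x * g k x = C * (C⁻¹ * ∫ x, s x * g k x) := by field_simp
      _ ≤ _ := by gcongr
  refine le_of_tendsto' (tendsto_integral_of_dominated_convergence (fun x => |s x|)
    (fun k => (hs1.continuous.mul (hg1 k).continuous).aestronglyMeasurable) hsi.abs
    (fun k => Eventually.of_forall fun x => ?_) (Eventually.of_forall fun x => ?_)) hle
  · rw [Pi.mul_apply, Real.norm_eq_abs, abs_mul]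
    exact mul_le_of_le_one_right (abs_nonneg _) (hgb k x)
  · by_cases h0 : s x = 0
    · change Tendsto (fun k => s x * g k x) atTop (𝓝 |s x|)
      rw [h0, abs_zero]
      simp only [zero_mul]
      exact tendsto_const_nhds
    · have h1 : Tendsto (fun k => s x * (s x / Real.sqrt (s x ^ 2 + δ k ^ 2))) atTop
          (𝓝 (s x * (s x / Real.sqrt (s x ^ 2 + 0 ^ 2)))) := by
        refine tendsto_const_nhds.mul (tendsto_const_nhds.div ?_ ?_)
        · exact (Real.continuous_sqrt.tendsto _).comp (tendsto_const_nhds.add (hδ0.pow 2))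
        · have : 0 < s x ^ 2 := by positivity
          simp [Real.sqrt_sq_eq_abs, h0]
      have h2 : s x * (s x / Real.sqrt (s x ^ 2 + 0 ^ 2)) = |s x| := by
        rw [zero_pow two_ne_zero, add_zero, Real.sqrt_sq_eq_abs, ← mul_div_assoc,
          ← abs_mul_abs_self, mul_div_assoc, div_self (abs_ne_zero.2 h0), mul_one]
      rw [h2] at h1
      exact h1

lemma norm_clm_le_sum {n : ℕ} (L : (Fin n → ℝ) →L[ℝ] ℝ) :
    ‖L‖ ≤ ∑ i, |L (Pi.single i 1)| := by
  refine L.opNorm_le_bound (Finset.sum_nonneg fun i _ => abs_nonneg _) fun x => ?_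
  conv_lhs => rw [pi_eq_sum_univ' x, map_sum]
  rw [Finset.sum_mul]
  refine (norm_sum_le _ _).trans (Finset.sum_le_sum fun i _ => ?_)
  rw [map_smul, norm_smul, mul_comm]
  exact mul_le_mul_of_nonneg_left (norm_le_pi_norm x i) (abs_nonneg _)

/-- A non-sharp isoperimetric inequality in the plane. -/
lemma exists_volume_le_sq_anisoPerimeter {φ : (Fin 2 → ℝ) → ℝ} (hφ : IsNorm φ) :
    ∃ C : NNReal, ∀ U : Set (Fin 2 → ℝ), MeasurableSet U → Bornology.IsBounded U →
      anisoPerimeter φ U ≠ ⊤ → volume U ≤ C * anisoPerimeter φ U ^ 2 := by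
  obtain ⟨C, hC0, hC⟩ := hφ.exists_upper
  have hp : ((Module.finrank ℝ (Fin 2 → ℝ) : ℕ) : ℝ).HolderConjugate 2 := by
    simp only [Module.finrank_fin_fun]
    exact Real.HolderConjugate.two_two
  set K := lintegralPowLePowLIntegralFDerivConst (volume : Measure (Fin 2 → ℝ)) 2 with hK
  have hmain : ∀ f : (Fin 2 → ℝ) → ℝ, ContDiff ℝ 2 f → HasCompactSupport f →
      anisoTV φ f ≠ ⊤ →
      ∫⁻ x, ‖f x‖ₑ ^ (2 : ℝ) ≤ K * (ENNReal.ofReal (2 * C) * anisoTV φ f) ^ 2 := by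
    intro f hf hc hT
    have hf1 : ContDiff ℝ 1 f := hf.of_le (by norm_num)
    refine (lintegral_pow_le_pow_lintegral_fderiv volume hf1 hc hp).trans ?_
    rw [ENNReal.rpow_two]
    gcongr
    have hfi : Integrable (fun x => fderiv ℝ f x) :=
      (hf1.continuous_fderiv one_ne_zero).integrable_of_hasCompactSupport (hc.fderiv (𝕜 := ℝ))
    rw [← ofReal_integral_norm_eq_lintegral_enorm hfi]
    rw [← ENNReal.ofReal_toReal hT, ← ENNReal.ofReal_mul (by positivity)]
    refine ENNReal.ofReal_le_ofReal ?_
    have hi : ∀ i : Fin 2, Integrable fun x => |fderiv ℝ f x (Pi.single i 1)| := fun i =>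
      (((hf1.continuous_fderiv one_ne_zero).clm_apply
        continuous_const).integrable_of_hasCompactSupport (hc.fderiv_apply ℝ _)).abs
    calc ∫ x, ‖fderiv ℝ f x‖ ≤ ∫ x, ∑ i, |fderiv ℝ f x (Pi.single i 1)| :=
          integral_mono hfi.norm (integrable_finsetSum _ fun i _ => hi i) fun x =>
            norm_clm_le_sum _
      _ = ∑ i, ∫ x, |fderiv ℝ f x (Pi.single i 1)| := integral_finsetSum _ fun i _ => hi i
      _ ≤ ∑ i : Fin 2, C * (anisoTV φ f).toReal :=
          Finset.sum_le_sum fun i _ => integral_abs_fderiv_le hC0 hC hf hc hT i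
      _ = 2 * C * (anisoTV φ f).toReal := by simp; ring
  refine ⟨K * (Real.toNNReal (2 * C)) ^ 2, fun U hU hb hT => ?_⟩
  have hUf : volume U ≠ ⊤ := hb.measure_lt_top.ne
  have hw := integrable_indicator_one hU hUf
  have hwc : HasCompactSupport (U.indicator (1 : (Fin 2 → ℝ) → ℝ)) := by
    refine HasCompactSupport.intro (hb.isCompact_closure) fun x hx => ?_
    exact indicator_of_notMem (fun h => hx (subset_closure h)) _
  have hvol : volume U = ∫⁻ x, ‖U.indicator (1 : (Fin 2 → ℝ) → ℝ) x‖ₑ ^ (2 : ℝ) := by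
    rw [← lintegral_indicator_one hU]
    congr 1; ext x
    by_cases hx : x ∈ U <;> simp [hx]
  have hlim : ∀ᵐ x, ‖U.indicator (1 : (Fin 2 → ℝ) → ℝ) x‖ₑ ^ (2 : ℝ)
      = liminf (fun k => ‖mollify k (U.indicator 1) x‖ₑ ^ (2 : ℝ)) atTop := by
    filter_upwards [mollify_ae_tendsto hw.locallyIntegrable] with x hx
    exact (((ENNReal.continuous_rpow_const (y := 2)).tendsto _).comp hx.enorm).liminf_eq.symm
  rw [hvol, lintegral_congr_ae hlim]
  refine (lintegral_liminf_le fun k => ?_).trans ?_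
  · exact (((mollify_contDiff k hw.locallyIntegrable).continuous.enorm).measurable).pow_const _
  · refine liminf_le_of_le (by isBoundedDefault) fun b hb' => ?_
    obtain ⟨k, hk⟩ := hb'.exists
    refine hk.trans ((hmain _ (mollify_contDiff_two k hw.locallyIntegrable)
      (mollify_hasCompactSupport k hwc)
      (ne_top_of_le_ne_top hT (anisoTV_mollify_le k hw))).trans ?_)
    rw [mul_pow, ← mul_assoc]
    push_cast
    gcongr
    · exact le_rfl
    · exact anisoTV_mollify_le k hw

end Isoperimetric

section Fill

variable {n : ℕ} {φ : (Fin n → ℝ) → ℝ}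

lemma IsNorm.isCompact_unit (hφ : IsNorm φ) : IsCompact {v | φ v ≤ 1} := by
  obtain ⟨c, hc, h⟩ := hφ.exists_lower
  refine Metric.isCompact_of_isClosed_isBounded (isClosed_le hφ.continuous continuous_const) ?_
  refine (Metric.isBounded_closedBall (x := (0 : Fin n → ℝ)) (r := c⁻¹)).subset fun v hv => ?_
  rw [mem_closedBall_zero_iff]
  have h1 := (h v).trans hv
  rw [← one_div, le_div_iff₀ hc]
  linarith

lemma integral_indicator_one_mul {E : Set (Fin n → ℝ)} (hE : MeasurableSet E)
    (g : (Fin n → ℝ) → ℝ) :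
    ∫ x, E.indicator (1 : (Fin n → ℝ) → ℝ) x * g x = ∫ x in E, g x := by
  rw [← integral_indicator hE]
  congr 1; ext x
  by_cases hx : x ∈ E <;> simp [hx]

/-- Adding to an open set the part of a compact set lying beyond a line does not increase the
perimeter, provided the remaining relative boundary is contained in the open set. -/
lemma anisoPerimeter_union_cap_le (hφ : IsNorm φ) {E T : Set (Fin n → ℝ)} (hE : IsOpen E)
    (hT : IsCompact T) (e : (Fin n → ℝ) →L[ℝ] ℝ) (c : ℝ)
    (h : T ∩ closure ({x | c < e x} \ T) ⊆ E) :
    IsOpen (E ∪ (T ∩ {x | c < e x})) ∧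
      anisoPerimeter φ (E ∪ (T ∩ {x | c < e x})) ≤ anisoPerimeter φ E := by
  have hS : IsOpen {x | c < e x} := isOpen_lt continuous_const e.continuous
  have hSm : MeasurableSet (T ∩ {x | c < e x}) := hT.measurableSet.inter hS.measurableSet
  refine ⟨?_, ?_⟩
  · rw [isOpen_iff_mem_nhds]
    rintro x (hx | ⟨hxT, hxS⟩)
    · exact mem_of_superset (hE.mem_nhds hx) subset_union_left
    · by_cases hxE : x ∈ E
      · exact mem_of_superset (hE.mem_nhds hxE) subset_union_left
      · have hx' : x ∉ closure ({x | c < e x} \ T) := fun h' => hxE (h ⟨hxT, h'⟩)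
        filter_upwards [isClosed_closure.isOpen_compl.mem_nhds hx', hS.mem_nhds hxS] with y h1 h2
        refine Or.inr ⟨?_, h2⟩
        by_contra h3
        exact h1 (subset_closure ⟨h2, h3⟩)
  by_cases hP : anisoPerimeter φ E = ⊤
  · rw [hP]; exact le_top
  refine anisoTV_le fun η hη => ENNReal.ofReal_le_of_le_toReal ?_
  obtain ⟨p, hp, hpmin⟩ := hφ.isCompact_unit.exists_isMinOn
    ⟨0, by simp [hφ.map_zero]⟩ e.continuous.continuousOn
  have hpmin' : ∀ v, φ v ≤ 1 → e p ≤ e v := fun v hv => hpmin hv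
  obtain ⟨R, hR⟩ := hT.isBounded.subset_ball 0
  have hcl : IsClosed ((closure ({x | c < e x} \ T) \ E) ∪ (Metric.ball 0 R)ᶜ) :=
    (isClosed_closure.sdiff hE).union Metric.isOpen_ball.isClosed_compl
  obtain ⟨ζ, hζ, hζ0, hζ1, hζnn, hζle⟩ := exists_smooth_cutoff hcl (hT.isClosed.sdiff hE)
    (disjoint_left.2 fun x hx hx' => hx.elim (fun h1 => h1.2 (h ⟨hx'.1, h1.1⟩))
      fun h1 => h1 (hR hx'.1))
  have hζc : HasCompactSupport ζ := by
    refine HasCompactSupport.intro (isCompact_closedBall (0 : Fin n → ℝ) R) fun x hx => ?_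
    exact (hζ0 x (Or.inr fun h1 => hx (Metric.ball_subset_closedBall h1))).self_of_nhds
  set δ : ℕ → ℝ := fun k => 1 / ((k : ℝ) + 1) with hδdef
  have hδ : ∀ k, 0 < δ k := fun k => by simp only [hδdef]; positivity
  have hδ0 : Tendsto δ atTop (𝓝 0) := tendsto_one_div_add_atTop_nhds_zero_nat
  have hec : ContDiff ℝ 1 e := e.contDiff
  set θ : ℕ → (Fin n → ℝ) → ℝ := fun k x => smoothStep c (δ k) (e x) with hθ
  have hθ1 : ∀ k, ContDiff ℝ 1 (θ k) := fun k => (smoothStep_contDiff c (δ k)).comp hec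
  set ξ : (Fin n → ℝ) → (Fin n → ℝ) := fun x => p - η x with hξ
  have hξ1 : ContDiff ℝ 1 ξ := contDiff_const.sub hη.1
  set χ : ℕ → (Fin n → ℝ) → ℝ := fun k x => ζ x * θ k x with hχ
  have hχ1 : ∀ k, ContDiff ℝ 1 (χ k) := fun k => hζ.mul (hθ1 k)
  have hχc : ∀ k, HasCompactSupport (χ k) := fun k => hζc.mul_right
  have hχξ : ∀ k, ContDiff ℝ 1 fun x => χ k x • ξ x := fun k => contDiff_smul_field (hχ1 k) hξ1
  have hχξc : ∀ k, HasCompactSupport fun x => χ k x • ξ x := fun k => (hχc k).smul_right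
  have htest : ∀ k, IsTestField φ (fun x => η x + χ k x • ξ x) := by
    intro k
    refine ⟨hη.1.add (hχξ k), hη.2.1.add (hχξc k), fun x => ?_⟩
    have e1 : η x + χ k x • ξ x = (1 - χ k x) • η x + χ k x • p := by simp only [hξ]; module
    refine (congrArg φ e1).trans_le (hφ.combo_le_one (hη.2.2 x) hp ?_ ?_)
    · exact mul_nonneg (hζnn x) (smoothStep_nonneg _ _ _)
    · exact mul_le_one₀ (hζle x) (smoothStep_nonneg _ _ _) (smoothStep_le_one _ _ _)
  have hdξ : ∀ x, diverg ξ x = -diverg η x := by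
    intro x
    have h1 := diverg_add (η := fun _ => p) (ξ := fun x => -η x) (x := x)
      (differentiableAt_const _) (hη.1.neg.differentiable one_ne_zero x)
    rw [diverg_const, diverg_neg, zero_add] at h1
    simpa [hξ, sub_eq_add_neg] using h1
  have hdθ : ∀ k x, ∃ d : ℝ, 0 ≤ d ∧ fderiv ℝ (θ k) x = d • e := by
    intro k x
    have hd := ((smoothStep_contDiff c (δ k)).differentiable one_ne_zero (e x)).hasDerivAt
    have h1 : HasFDerivAt (θ k) (deriv (smoothStep c (δ k)) (e x) • e) x :=
      hd.comp_hasFDerivAt x e.hasFDerivAt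
    refine ⟨_, ?_, h1.fderiv⟩
    refine Monotone.deriv_nonneg fun a b hab => ?_
    exact Real.smoothTransition.monotone (by have := hδ k; gcongr)
  have hout : ∀ k x, x ∉ E → diverg (fun x => χ k x • ξ x) x
      ≤ -(T ∩ {x | c < e x}).indicator (fun x => θ k x * diverg η x) x := by
    intro k x hxE
    by_cases hxS : c < e x
    · by_cases hxT : x ∈ T
      · rw [indicator_of_mem (show x ∈ T ∩ {x | c < e x} from ⟨hxT, hxS⟩)]
        have h1 : (fun x => χ k x • ξ x) =ᶠ[𝓝 x] fun x => θ k x • ξ x := by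
          filter_upwards [hζ1 x ⟨hxT, hxE⟩] with y hy
          simp [hχ, hy]
        obtain ⟨d, hd0, hd⟩ := hdθ k x
        rw [diverg_congr h1, diverg_smul ((hθ1 k).differentiable one_ne_zero x)
          (hξ1.differentiable one_ne_zero x), hdξ, hd]
        have h2 : e (ξ x) ≤ 0 := by
          simp only [hξ, map_sub]
          linarith [hpmin' _ (hη.2.2 x)]
        have h3 : (d • e) (ξ x) = d * e (ξ x) := rfl
        rw [h3]
        nlinarith
      · rw [indicator_of_notMem fun h' => hxT h'.1]
        have h1 : (fun x => χ k x • ξ x) =ᶠ[𝓝 x] fun _ => 0 := by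
          filter_upwards [hζ0 x (Or.inl ⟨subset_closure ⟨hxS, hxT⟩, hxE⟩)] with y hy
          simp [hχ, hy]
        rw [diverg_congr h1, diverg_const, neg_zero]
    · rw [indicator_of_notMem fun h' => hxS h'.2]
      have h0 : θ k x = 0 := smoothStep_of_le (hδ k) (not_lt.1 hxS)
      have h1 : fderiv ℝ (χ k) x = 0 := by
        refine IsLocalMin.fderiv_eq_zero (Eventually.of_forall fun y => ?_)
        simp only [hχ, h0, mul_zero]
        exact mul_nonneg (hζnn y) (smoothStep_nonneg _ _ _)
      rw [diverg_smul ((hχ1 k).differentiable one_ne_zero x)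
        (hξ1.differentiable one_ne_zero x), h1]
      simp [hχ, h0]
  have hdi := hη.integrable_diverg
  have hdχ : ∀ k, Integrable (diverg fun x => χ k x • ξ x) := fun k =>
    (diverg_continuous (hχξ k)).integrable_of_hasCompactSupport (diverg_hasCompactSupport (hχξc k))
  have hDm : MeasurableSet ((T ∩ {x | c < e x}) \ E) := hSm.diff hE.measurableSet
  have hθb : ∀ k x, |θ k x| ≤ 1 := fun k x => by
    rw [abs_of_nonneg (smoothStep_nonneg _ _ _)]; exact smoothStep_le_one _ _ _
  have hθi : ∀ k, Integrable fun x => θ k x * diverg η x := fun k =>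
    hdi.bdd_mul (c := 1) (hθ1 k).continuous.aestronglyMeasurable
      (Eventually.of_forall fun x => hθb k x)
  have hle : ∀ k, (∫ x in E, diverg η x) + ∫ x in (T ∩ {x | c < e x}) \ E, θ k x * diverg η x
      ≤ (anisoPerimeter φ E).toReal := by
    intro k
    refine le_trans ?_ (integral_le_anisoTV (htest k) hP)
    rw [integral_indicator_one_mul hE.measurableSet]
    have h1 : ∀ x, diverg (fun x => η x + χ k x • ξ x) x
        = diverg η x + diverg (fun x => χ k x • ξ x) x := fun x =>
      diverg_add (hη.1.differentiable one_ne_zero x) ((hχξ k).differentiable one_ne_zero x)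
    simp only [h1]
    rw [integral_add hdi.integrableOn (hdχ k).integrableOn]
    gcongr
    have h2 := integral_add_compl hE.measurableSet (hdχ k)
    rw [integral_diverg_eq_zero (hχξ k) (hχξc k)] at h2
    have h3 : ∫ x in Eᶜ, diverg (fun x => χ k x • ξ x) x
        ≤ ∫ x in Eᶜ, -(T ∩ {x | c < e x}).indicator (fun x => θ k x * diverg η x) x :=
      setIntegral_mono_on (hdχ k).integrableOn ((hθi k).indicator hSm).neg.integrableOn
        hE.measurableSet.compl fun x hx => hout k x hx
    rw [integral_neg, setIntegral_indicator hSm, inter_comm, ← sdiff_eq] at h3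
    linarith
  have hlim : Tendsto (fun k => (∫ x in E, diverg η x)
      + ∫ x in (T ∩ {x | c < e x}) \ E, θ k x * diverg η x) atTop
      (𝓝 ((∫ x in E, diverg η x) + ∫ x in (T ∩ {x | c < e x}) \ E, diverg η x)) := by
    refine tendsto_const_nhds.add (tendsto_integral_of_dominated_convergence
      (fun x => |diverg η x|) (fun k => (hθi k).aestronglyMeasurable.restrict)
      hdi.abs.integrableOn (fun k => Eventually.of_forall fun x => ?_) ?_)
    · rw [Real.norm_eq_abs, abs_mul]
      exact mul_le_of_le_one_left (abs_nonneg _) (hθb k x)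
    · refine (ae_restrict_iff' hDm).2 (Eventually.of_forall fun x hx => ?_)
      have h1 : ∀ᶠ k in atTop, δ k < e x - c :=
        hδ0.eventually (gt_mem_nhds (sub_pos.2 hx.1.2))
      refine tendsto_const_nhds.congr' ?_
      filter_upwards [h1] with k hk
      have : θ k x = 1 := smoothStep_of_ge (hδ k) (by linarith)
      rw [this, one_mul]
  refine le_trans (le_of_eq ?_) (le_of_tendsto' hlim hle)
  rw [integral_indicator_one_mul (hE.measurableSet.union hSm), ← union_sdiff_self,
    setIntegral_union disjoint_sdiff_right hDm hdi.integrableOn hdi.integrableOn]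

end Fill

section Hull

variable {φ : (Fin 2 → ℝ) → ℝ}

lemma exists_segment_subset_of_isOpen {E : Type*} [NormedAddCommGroup E] [NormedSpace ℝ E]
    {F : Set E} (hF : IsOpen F) {z p : E} (h : ∀ t ∈ Icc (0 : ℝ) 1, z + t • p ∈ F) :
    ∃ ε > 0, ∀ t ∈ Icc (0 : ℝ) (1 + ε), z + t • p ∈ F := by
  have hc : Continuous fun t : ℝ => z + t • p := by fun_prop
  obtain ⟨δ, hδ, hs⟩ := (isCompact_Icc (a := (0 : ℝ)) (b := 1)).exists_thickening_subset_open
    (hF.preimage hc) h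
  refine ⟨δ / 2, by positivity, fun t ht => ?_⟩
  rcases le_or_gt t 1 with h1 | h1
  · exact h t ⟨ht.1, h1⟩
  · refine hs (Metric.mem_thickening_iff.2 ⟨1, ⟨zero_le_one, le_rfl⟩, ?_⟩)
    rw [Real.dist_eq, abs_lt]
    constructor <;> linarith [ht.2]

/-- Filling the open corner spanned by two segments contained in an open set. -/
lemma exists_fill_corner (hφ : IsNorm φ) {F : Set (Fin 2 → ℝ)} (hF : IsOpen F)
    (hFc : IsPreconnected F) (z p q : Fin 2 → ℝ) (hD : p 0 * q 1 - p 1 * q 0 ≠ 0)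
    (hp : ∀ t ∈ Icc (0 : ℝ) 1, z + t • p ∈ F) (hq : ∀ t ∈ Icc (0 : ℝ) 1, z + t • q ∈ F) :
    ∃ F' : Set (Fin 2 → ℝ), IsOpen F' ∧ IsPreconnected F' ∧ F ⊆ F' ∧ F' ⊆ convexHull ℝ F ∧
      anisoPerimeter φ F' ≤ anisoPerimeter φ F ∧
      ∀ a b : ℝ, 0 ≤ a → 0 ≤ b → a + b < 1 → z + a • p + b • q ∈ F' := by
  set D := p 0 * q 1 - p 1 * q 0 with hDdef
  set α : (Fin 2 → ℝ) →L[ℝ] ℝ :=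
      D⁻¹ • (q 1 • ContinuousLinearMap.proj (R := ℝ) (φ := fun _ : Fin 2 => ℝ) 0
    - q 0 • ContinuousLinearMap.proj (R := ℝ) (φ := fun _ : Fin 2 => ℝ) 1) with hα
  set β : (Fin 2 → ℝ) →L[ℝ] ℝ :=
      D⁻¹ • (p 0 • ContinuousLinearMap.proj (R := ℝ) (φ := fun _ : Fin 2 => ℝ) 1
    - p 1 • ContinuousLinearMap.proj (R := ℝ) (φ := fun _ : Fin 2 => ℝ) 0) with hβ
  have hαv : ∀ v, α v = D⁻¹ * (q 1 * v 0 - q 0 * v 1) := fun v => rfl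
  have hβv : ∀ v, β v = D⁻¹ * (p 0 * v 1 - p 1 * v 0) := fun v => rfl
  have hdec : ∀ v, v = α v • p + β v • q := by
    intro v
    ext i
    rw [hαv, hβv]
    fin_cases i <;> simp <;> field_simp <;> rw [hDdef] <;> ring
  have hαc : ∀ a b : ℝ, α (a • p + b • q) = a := by
    intro a b; rw [hαv]; simp; field_simp; rw [hDdef]; ring
  have hβc : ∀ a b : ℝ, β (a • p + b • q) = b := by
    intro a b; rw [hβv]; simp; field_simp; rw [hDdef]; ring
  set T : Set (Fin 2 → ℝ) := {x | 0 ≤ α (x - z) ∧ 0 ≤ β (x - z) ∧ α (x - z) + β (x - z) ≤ 1}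
    with hTdef
  have hxz : ∀ x, x = z + (α (x - z) • p + β (x - z) • q) := fun x => by rw [← hdec]; abel
  have hTc : IsCompact T := by
    refine Metric.isCompact_of_isClosed_isBounded ?_ ?_
    · have h1 : Continuous fun x => α (x - z) := by fun_prop
      have h2 : Continuous fun x => β (x - z) := by fun_prop
      exact (isClosed_le continuous_const h1).inter
        ((isClosed_le continuous_const h2).inter (isClosed_le (h1.add h2) continuous_const))
    · refine (Metric.isBounded_closedBall (x := (0 : Fin 2 → ℝ))
        (r := ‖z‖ + (‖p‖ + ‖q‖))).subset fun x hx => ?_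
      rw [mem_closedBall_zero_iff, hxz x]
      refine (norm_add_le _ _).trans
          (add_le_add le_rfl ((norm_add_le _ _).trans (add_le_add ?_ ?_)))
      · rw [norm_smul, Real.norm_eq_abs, abs_of_nonneg hx.1]
        exact mul_le_of_le_one_left (norm_nonneg _) (by linarith [hx.2.1, hx.2.2])
      · rw [norm_smul, Real.norm_eq_abs, abs_of_nonneg hx.2.1]
        exact mul_le_of_le_one_left (norm_nonneg _) (by linarith [hx.1, hx.2.2])
  set e : (Fin 2 → ℝ) →L[ℝ] ℝ := -(α + β) with he
  set c : ℝ := -1 - (α z + β z) with hc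
  have hce : ∀ x, c < e x ↔ α (x - z) + β (x - z) < 1 := by
    intro x
    have : e x = -(α x + β x) := rfl
    rw [this, map_sub, map_sub, hc]
    constructor <;> intro h <;> linarith
  have hz : z ∈ F := by simpa using hp 0 ⟨le_rfl, zero_le_one⟩
  have hT : T ∩ closure ({x | c < e x} \ T) ⊆ F := by
    rintro x ⟨hxT, hx⟩
    have h1 : closure ({x | c < e x} \ T) ⊆ {x | α (x - z) ≤ 0} ∪ {x | β (x - z) ≤ 0} := by
      refine closure_minimal ?_ ((isClosed_le (by fun_prop) continuous_const).union
        (isClosed_le (by fun_prop) continuous_const))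
      rintro y ⟨hy, hyT⟩
      rw [mem_ofPred_eq, hce] at hy
      by_contra h2
      simp only [mem_union, mem_ofPred_eq, not_or, not_le] at h2
      exact hyT ⟨h2.1.le, h2.2.le, hy.le⟩
    rcases h1 hx with h2 | h2
    · have h3 : α (x - z) = 0 := le_antisymm h2 hxT.1
      have := hq (β (x - z)) ⟨hxT.2.1, by linarith [hxT.2.2]⟩
      rw [hxz x, h3, zero_smul, zero_add]
      exact this
    · have h3 : β (x - z) = 0 := le_antisymm h2 hxT.2.1
      have := hp (α (x - z)) ⟨hxT.1, by linarith [hxT.2.2]⟩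
      rw [hxz x, h3, zero_smul, add_zero]
      exact this
  obtain ⟨ho, hle⟩ := anisoPerimeter_union_cap_le hφ hF hTc e c hT
  have hconv : Convex ℝ (T ∩ {x | c < e x}) := by
    have h1 : Convex ℝ T := by
      intro x hx y hy s t hs ht hst
      have h2 : s • x + t • y - z = s • (x - z) + t • (y - z) := by
        have : z = (s + t) • z := by rw [hst, one_smul]
        nth_rewrite 1 [this]; module
      simp only [hTdef, mem_ofPred_eq, h2, map_add, map_smul, smul_eq_mul]
      refine ⟨add_nonneg (mul_nonneg hs hx.1) (mul_nonneg ht hy.1),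
        add_nonneg (mul_nonneg hs hx.2.1) (mul_nonneg ht hy.2.1), ?_⟩
      have := mul_le_mul_of_nonneg_left hx.2.2 hs
      have := mul_le_mul_of_nonneg_left hy.2.2 ht
      linarith
    exact h1.inter (convex_halfSpace_gt e.isLinear c)
  refine ⟨_, ho, ?_, subset_union_left, ?_, hle, ?_⟩
  · refine hFc.union z hz ⟨?_, ?_⟩ hconv.isPreconnected
    · simp [hTdef]
    · simp [hce]
  · refine union_subset (subset_convexHull ℝ F) fun x hx => ?_
    have hs := subset_convexHull ℝ F
    have h0 := hs hz
    have h1 := hs (hp 1 ⟨zero_le_one, le_rfl⟩)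
    have h2 := hs (hq 1 ⟨zero_le_one, le_rfl⟩)
    have key : ∀ a b : ℝ, 0 ≤ a → 0 ≤ b → a + b ≤ 1 → z + (a • p + b • q) ∈ convexHull ℝ F := by
      intro a b ha hb hab
      have h3 := (convex_convexHull ℝ F).sum_mem (t := Finset.univ)
        (w := ![1 - a - b, a, b]) (z := ![z, z + (1 : ℝ) • p, z + (1 : ℝ) • q]) ?_ ?_ ?_
      · convert h3 using 1
        simp only [Fin.sum_univ_three, Matrix.cons_val_zero, Matrix.cons_val_one, Matrix.cons_val]
        module
      · intro i _
        fin_cases i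
        · change 0 ≤ 1 - a - b
          linarith
        · exact ha
        · exact hb
      · simp only [Fin.sum_univ_three, Matrix.cons_val_zero, Matrix.cons_val_one, Matrix.cons_val]
        ring
      · intro i _
        fin_cases i
        · exact h0
        · exact h1
        · exact h2
    rw [hxz x]
    exact key _ _ hx.1.1 hx.1.2.1 hx.1.2.2
  · intro a b ha hb hab
    have e1 : z + a • p + b • q - z = a • p + b • q := by abel
    refine Or.inr ⟨?_, ?_⟩
    · simp only [hTdef, mem_ofPred_eq, e1, hαc, hβc]
      exact ⟨ha, hb, hab.le⟩
    · rw [mem_ofPred_eq, hce, e1, hαc, hβc]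
      exact hab

lemma anisoPerimeter_sUnion_le {𝒞 : Set (Set (Fin 2 → ℝ))} (hne : 𝒞.Nonempty)
    (hch : IsChain (· ⊆ ·) 𝒞) (ho : ∀ F ∈ 𝒞, IsOpen F) (hf : volume (⋃₀ 𝒞) ≠ ⊤) {c : ℝ≥0∞}
    (hc : ∀ F ∈ 𝒞, anisoPerimeter φ F ≤ c) : anisoPerimeter φ (⋃₀ 𝒞) ≤ c := by
  rcases eq_or_ne c ⊤ with rfl | hct
  · exact le_top
  refine anisoTV_le fun η hη => ENNReal.ofReal_le_of_le_toReal ?_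
  have hU : IsOpen (⋃₀ 𝒞) := isOpen_sUnion ho
  obtain ⟨B, hB⟩ := (diverg_continuous hη.1).bounded_above_of_compact_support
    (diverg_hasCompactSupport hη.2.1)
  have hB0 : 0 ≤ B := (norm_nonneg _).trans (hB 0)
  have hdi := hη.integrable_diverg
  refine le_of_forall_pos_le_add fun δ hδ => ?_
  set ε : ℝ := δ / (B + 1) with hε
  have hε0 : 0 < ε := by positivity
  obtain ⟨K, hKU, hK, hKv⟩ := hU.measurableSet.exists_isCompact_sdiff_lt hf
    (ENNReal.ofReal_pos.2 hε0).ne'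
  have : Nonempty 𝒞 := hne.to_subtype
  obtain ⟨F, hF⟩ := hK.elim_directed_cover (fun F : 𝒞 => (F : Set (Fin 2 → ℝ)))
    (fun F => ho F F.2) (by rwa [← sUnion_eq_iUnion]) hch.directed
  have hFU : (F : Set (Fin 2 → ℝ)) ⊆ ⋃₀ 𝒞 := subset_sUnion_of_mem F.2
  have hFm := (ho F F.2).measurableSet
  have h1 : ∫ x in (F : Set (Fin 2 → ℝ)), diverg η x ≤ c.toReal := by
    have hP := hc F F.2
    have h2 := integral_le_anisoTV hη (ne_top_of_le_ne_top hct hP)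
    rw [integral_indicator_one_mul hFm] at h2
    exact h2.trans (ENNReal.toReal_mono hct hP)
  rw [integral_indicator_one_mul hU.measurableSet, ← union_sdiff_cancel hFU,
    setIntegral_union disjoint_sdiff_right (hU.measurableSet.diff hFm) hdi.integrableOn
      hdi.integrableOn]
  refine add_le_add h1 ?_
  have hv : volume (⋃₀ 𝒞 \ (F : Set (Fin 2 → ℝ))) ≤ ENNReal.ofReal ε :=
    (measure_mono (sdiff_subset_sdiff_right hF)).trans hKv.le
  have h3 := norm_setIntegral_le_of_norm_le_const (s := ⋃₀ 𝒞 \ (F : Set (Fin 2 → ℝ)))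
    (hv.trans_lt ENNReal.ofReal_lt_top) (fun x _ => hB x)
  refine (le_abs_self _).trans (h3.trans ?_)
  have h4 : volume.real (⋃₀ 𝒞 \ (F : Set (Fin 2 → ℝ))) ≤ ε := by
    have := ENNReal.toReal_mono ENNReal.ofReal_ne_top hv
    rwa [ENNReal.toReal_ofReal hε0.le] at this
  calc B * _ ≤ (B + 1) * ε := by gcongr; linarith
    _ = δ := by rw [hε]; field_simp

/-- The convex hull of a bounded open connected planar set has no larger perimeter. -/
lemma anisoPerimeter_convexHull_le (hφ : IsNorm φ) {G : Set (Fin 2 → ℝ)} (hG : IsOpen G)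
    (hGc : IsPreconnected G) (hGb : Bornology.IsBounded G) :
    anisoPerimeter φ (convexHull ℝ G) ≤ anisoPerimeter φ G := by
  rcases G.eq_empty_or_nonempty with rfl | hGne
  · rw [convexHull_empty]
  have hHf : volume (convexHull ℝ G) ≠ ⊤ :=
    ((isBounded_convexHull.2 hGb).measure_lt_top).ne
  obtain ⟨F, hGF, ⟨⟨hFo, hFc, hFG, hFP⟩, hmax⟩⟩ := zorn_subset_nonempty
    {F : Set (Fin 2 → ℝ) | IsOpen F ∧ IsPreconnected F ∧ G ⊆ F ∧ F ⊆ convexHull ℝ G ∧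
      anisoPerimeter φ F ≤ anisoPerimeter φ G} (by
    intro 𝒞 h𝒞 hch hne
    obtain ⟨F₀, hF₀⟩ := hne
    refine ⟨⋃₀ 𝒞, ⟨isOpen_sUnion fun F hF => (h𝒞 hF).1, ?_,
      (h𝒞 hF₀).2.2.1.trans (subset_sUnion_of_mem hF₀), sUnion_subset fun F hF => (h𝒞 hF).2.2.2.1,
      anisoPerimeter_sUnion_le ⟨F₀, hF₀⟩ hch (fun F hF => (h𝒞 hF).1) ?_
        fun F hF => (h𝒞 hF).2.2.2.2⟩, fun F hF => subset_sUnion_of_mem hF⟩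
    · obtain ⟨x, hx⟩ := hGne
      exact isPreconnected_sUnion x 𝒞 (fun F hF => (h𝒞 hF).2.2.1 hx) fun F hF => (h𝒞 hF).2.1
    · exact ne_top_of_le_ne_top hHf (measure_mono (sUnion_subset fun F hF => (h𝒞 hF).2.2.2.1)))
    G ⟨hG, hGc, Subset.rfl, subset_convexHull ℝ G, le_rfl⟩
  obtain ⟨hFH, hFP⟩ := hFP
  have hfill : ∀ x y z, (∀ t ∈ Icc (0 : ℝ) 1, z + t • (x - z) ∈ F) →
      (∀ t ∈ Icc (0 : ℝ) 1, z + t • (y - z) ∈ F) → ∀ t ∈ Icc (0 : ℝ) 1, x + t • (y - x) ∈ F := by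
    intro x y z hx hy
    set p := x - z with hp
    set q := y - z with hq
    by_cases hD : p 0 * q 1 - p 1 * q 0 = 0
    · by_cases hp0 : p = 0
      · rw [sub_eq_zero.1 hp0]
        exact hy
      obtain ⟨s, hs⟩ : ∃ s : ℝ, q = s • p := by
        obtain ⟨i, hi⟩ := Function.ne_iff.1 hp0
        refine ⟨q i / p i, ?_⟩
        ext k
        simp only [Pi.smul_apply, smul_eq_mul]
        simp only [Pi.zero_apply] at hi
        field_simp
        fin_cases i <;> fin_cases k <;> simp <;> linarith
      intro t ht
      have e1 : x + t • (y - x) = z + (1 + t * (s - 1)) • p := by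
        have h1 : x = z + p := by rw [hp]; abel
        have h2 : y = z + s • p := by rw [← hs, hq]; abel
        rw [h1, h2]; module
      rw [e1]
      set w := 1 + t * (s - 1) with hw
      have hwq : s ≠ 0 → w / s ∈ Icc (0 : ℝ) 1 → z + w • p ∈ F := by
        intro hs0 h1
        have := hy _ h1
        rwa [hs, smul_smul, div_mul_cancel₀ _ hs0] at this
      rcases le_or_gt 0 w with h0 | h0
      · rcases le_or_gt w 1 with h1 | h1
        · exact hx w ⟨h0, h1⟩
        · have hs1 : 0 < s - 1 := by
            by_contra h2
            nlinarith [ht.1]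
          have hs0 : 0 < s := by linarith
          exact hwq hs0.ne' ⟨by positivity, (div_le_one hs0).2 (by nlinarith [ht.2])⟩
      · have hs1 : s < 0 := by
          by_contra h2
          nlinarith [ht.1, ht.2]
        exact hwq hs1.ne ⟨(div_pos_of_neg_of_neg h0 hs1).le,
          (div_le_one_of_neg hs1).2 (by nlinarith [ht.2])⟩
    · obtain ⟨ε, hε, hx'⟩ := exists_segment_subset_of_isOpen hFo hx
      obtain ⟨δ, hδ, hy'⟩ := exists_segment_subset_of_isOpen hFo hy
      obtain ⟨F', hF'o, hF'c, hFF', hF'H, hF'P, hF'⟩ := exists_fill_corner hφ hFo hFc z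
        ((1 + ε) • p) ((1 + δ) • q) (by
          have : ((1 + ε) • p) 0 * ((1 + δ) • q) 1 - ((1 + ε) • p) 1 * ((1 + δ) • q) 0
              = (1 + ε) * (1 + δ) * (p 0 * q 1 - p 1 * q 0) := by
            simp only [Pi.smul_apply, smul_eq_mul]; ring
          rw [this]
          exact mul_ne_zero (by positivity) hD)
        (fun t ht => by
          rw [smul_smul]
          exact hx' _ ⟨mul_nonneg ht.1 (by positivity), by nlinarith [ht.2]⟩)
        (fun t ht => by
          rw [smul_smul]
          exact hy' _ ⟨mul_nonneg ht.1 (by positivity), by nlinarith [ht.2]⟩)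
      have hF'F : F' ⊆ F := hmax ⟨hF'o, hF'c, hFG.trans hFF', hF'H.trans
        (convexHull_min hFH (convex_convexHull ℝ G)), hF'P.trans hFP⟩ hFF'
      intro t ht
      have h1 := hF' ((1 - t) / (1 + ε)) (t / (1 + δ))
        (div_nonneg (by linarith [ht.2]) (by positivity)) (div_nonneg ht.1 (by positivity)) (by
          rcases eq_or_lt_of_le ht.1 with h0 | h0
          · rw [← h0, zero_div, add_zero, sub_zero, div_lt_one (by positivity)]
            linarith
          · have h2 : (1 - t) / (1 + ε) ≤ 1 - t := div_le_self (by linarith [ht.2]) (by linarith)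
            have h3 : t / (1 + δ) < t := div_lt_self h0 (by linarith)
            linarith)
      rw [smul_smul, smul_smul, div_mul_cancel₀ _ (by positivity),
        div_mul_cancel₀ _ (by positivity)] at h1
      convert hF'F h1 using 1
      rw [hp, hq]
      module
  have hconv : Convex ℝ F := by
    rw [convex_iff_segment_subset]
    intro x hx y hy
    rw [segment_eq_image']
    rintro _ ⟨t, ht, rfl⟩
    have hsymm : ∀ x y : Fin 2 → ℝ, (∀ t ∈ Icc (0 : ℝ) 1, x + t • (y - x) ∈ F) →
        ∀ t ∈ Icc (0 : ℝ) 1, y + t • (x - y) ∈ F := by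
      intro x y h t ht
      convert h (1 - t) ⟨by linarith [ht.2], by linarith [ht.1]⟩ using 1
      module
    refine hFc.induction₂ (fun x y => ∀ t ∈ Icc (0 : ℝ) 1, x + t • (y - x) ∈ F) ?_ ?_
      (fun x y _ _ => hsymm x y) hx hy t ht
    · intro x hx
      obtain ⟨r, hr, hb⟩ := Metric.isOpen_iff.1 hFo x hx
      refine mem_nhdsWithin_of_mem_nhds (mem_of_superset (Metric.ball_mem_nhds x hr) ?_)
      intro y hy t ht
      exact hb ((convex_ball x r).add_smul_sub_mem (Metric.mem_ball_self hr) hy ht)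
    · intro x y z _ _ _ hxy hyz
      exact hfill x z y (hsymm x y hxy) hyz
  have hFeq : convexHull ℝ G = F := (convexHull_min hFG hconv).antisymm hFH
  rw [hFeq]
  exact hFP

end Hull

section RealAux

lemma ENNReal.sum_liminf_le {ι : Type*} (s : Finset ι) (f : ℕ → ι → ℝ≥0∞) :
    ∑ i ∈ s, liminf (fun k => f k i) atTop ≤ liminf (fun k => ∑ i ∈ s, f k i) atTop := by
  let _ : MeasurableSpace ι := ⊤
  have h := lintegral_liminf_le (μ := Measure.count.restrict (s : Set ι)) (f := f) (u := atTop)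
    fun k => measurable_from_top
  simpa [lintegral_finset] using h

lemma MonotoneOn.exists_hasDerivAt_lt {g : ℝ → ℝ} {a b L : ℝ} (hab : a < b)
    (hg : MonotoneOn g (Icc a b)) (hL : g b - g a < L * (b - a)) :
    ∃ t ∈ Ioo a b, ∃ L' < L, HasDerivAt g L' t := by
  by_contra! hcon
  have hg' : MonotoneOn g (uIcc a b) := by rwa [uIcc_of_le hab.le]
  have h1 := hg'.intervalIntegral_deriv_mem_uIcc
  rw [uIcc_of_le (sub_nonneg.2 (hg (left_mem_Icc.2 hab.le) (right_mem_Icc.2 hab.le) hab.le))] at h1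
  have h2 : ∫ _ in a..b, L ≤ ∫ x in a..b, deriv g x := by
    refine intervalIntegral.integral_mono_ae_restrict hab.le intervalIntegrable_const
      hg'.intervalIntegrable_deriv ?_
    rw [restrict_Ioo_eq_restrict_Icc.symm]
    refine (ae_restrict_iff' measurableSet_Ioo).2 ?_
    filter_upwards [hg.ae_differentiableWithinAt_of_mem] with t ht htI
    have hd := (ht (Ioo_subset_Icc_self htI)).differentiableAt (Icc_mem_nhds htI.1 htI.2)
    by_contra h3
    exact hcon t htI _ (not_le.1 h3) hd.hasDerivAt
  rw [intervalIntegral.integral_const, smul_eq_mul] at h2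
  linarith [h1.2]

lemma MonotoneOn.exists_slope_seq {g : ℝ → ℝ} {a b L t : ℝ} (hg : MonotoneOn g (Icc a b))
    (ht : t ∈ Ioo a b) (hd : HasDerivAt g L t) :
    ∃ s y c : ℕ → ℝ, (∀ k, t < s k ∧ s k < y k ∧ y k < b ∧
      (g (y k) - g (s k)) / (y k - s k) ≤ c k) ∧
      Tendsto s atTop (𝓝 t) ∧ Tendsto y atTop (𝓝 t) ∧ Tendsto c atTop (𝓝 L) := by
  set r : ℝ := min ((b - t) / 2) (1 / 2) with hr
  have hr0 : 0 < r := lt_min (by linarith [ht.2]) (by norm_num)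
  have hrb : r < b - t := (min_le_left _ _).trans_lt (by linarith [ht.2])
  have hr1 : r ≤ 1 / 2 := min_le_right _ _
  set ε : ℕ → ℝ := fun k => r * (1 / ((k : ℝ) + 1)) with hε
  have hε0 : ∀ k, 0 < ε k := fun k => by simp only [hε]; positivity
  have hεr : ∀ k, ε k ≤ r := fun k => by
    simp only [hε]
    refine mul_le_of_le_one_right hr0.le ?_
    rw [div_le_one (by positivity)]
    linarith [Nat.cast_nonneg (α := ℝ) k]
  have hεt : Tendsto ε atTop (𝓝 0) := by
    simpa [hε] using (tendsto_one_div_add_atTop_nhds_zero_nat (𝕜 := ℝ)).const_mul r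
  have hεt' : Tendsto ε atTop (𝓝[≠] 0) :=
    tendsto_nhdsWithin_iff.2 ⟨hεt, Eventually.of_forall fun k => (hε0 k).ne'⟩
  refine ⟨fun k => t + ε k ^ 2, fun k => t + ε k,
    fun k => ((ε k)⁻¹ * (g (t + ε k) - g t)) * (1 - ε k)⁻¹, fun k => ?_, ?_, ?_, ?_⟩
  · have h0 := hε0 k
    have h1 : ε k ≤ 1 / 2 := (hεr k).trans hr1
    have h2 : ε k ^ 2 < ε k := by nlinarith
    have h3 := hεr k
    refine ⟨by simp only [lt_add_iff_pos_right]; positivity, by linarith, by linarith, ?_⟩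
    have h4 : g t ≤ g (t + ε k ^ 2) :=
      hg ⟨ht.1.le, ht.2.le⟩ ⟨by nlinarith [ht.1], by nlinarith [ht.1]⟩ (by nlinarith)
    have h5 : t + ε k - (t + ε k ^ 2) = ε k * (1 - ε k) := by ring
    have h6 : 0 < 1 - ε k := by linarith
    rw [h5, div_eq_mul_inv, mul_inv]
    calc (g (t + ε k) - g (t + ε k ^ 2)) * ((ε k)⁻¹ * (1 - ε k)⁻¹)
        ≤ (g (t + ε k) - g t) * ((ε k)⁻¹ * (1 - ε k)⁻¹) := by gcongr
      _ = _ := by ring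
  · simpa using (hεt.pow 2).const_add t
  · simpa using hεt.const_add t
  · have h1 := hd.tendsto_slope_zero.comp hεt'
    have h2 : Tendsto (fun k => (1 - ε k)⁻¹) atTop (𝓝 1) := by
      simpa using (hεt.const_sub 1).inv₀ (by norm_num)
    simpa [smul_eq_mul, Function.comp_def] using h1.mul h2

end RealAux

section Lsc

variable {n : ℕ} {φ : (Fin n → ℝ) → ℝ}

lemma sum_anisoTV_le_of_tendsto {ι : Type*} (s : Finset ι) {w : ι → ℕ → (Fin n → ℝ) → ℝ}
    {u : ι → (Fin n → ℝ) → ℝ} (C : ℝ)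
    (hm : ∀ i ∈ s, ∀ k, AEStronglyMeasurable (w i k) volume)
    (hC : ∀ i ∈ s, ∀ k, ∀ᵐ x, |w i k x| ≤ C)
    (hlim : ∀ i ∈ s, ∀ᵐ x, Tendsto (fun k => w i k x) atTop (𝓝 (u i x)))
    {b : ℕ → ℝ≥0∞} {c : ℝ≥0∞} (hle : ∀ k, ∑ i ∈ s, anisoTV φ (w i k) ≤ b k)
    (hb : Tendsto b atTop (𝓝 c)) :
    ∑ i ∈ s, anisoTV φ (u i) ≤ c := by
  calc ∑ i ∈ s, anisoTV φ (u i)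
      ≤ ∑ i ∈ s, liminf (fun k => anisoTV φ (w i k)) atTop :=
        Finset.sum_le_sum fun i hi => anisoTV_le_liminf_of_ae C (hm i hi) (hC i hi) (hlim i hi)
    _ ≤ liminf (fun k => ∑ i ∈ s, anisoTV φ (w i k)) atTop := ENNReal.sum_liminf_le s _
    _ ≤ liminf b atTop := liminf_le_liminf (Eventually.of_forall hle)
    _ = c := hb.liminf_eq

lemma anisoTV_const_mul_le {t : ℝ} (ht : 0 ≤ t) (u : (Fin n → ℝ) → ℝ) :
    anisoTV φ (fun x => t * u x) ≤ ENNReal.ofReal t * anisoTV φ u := by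
  refine anisoTV_le fun η hη => ?_
  simp only [mul_assoc]
  rw [integral_const_mul, ENNReal.ofReal_mul ht]
  gcongr
  exact le_anisoTV hη u

/-- The total variations of the restrictions to finitely many disjoint relatively clopen pieces
are bounded by the total variation. -/
lemma sum_anisoTV_indicator_le (hφ : IsNorm φ) (𝒰 : Finset (Set (Fin n → ℝ)))
    (hd : (𝒰 : Set (Set (Fin n → ℝ))).PairwiseDisjoint id) {g : (Fin n → ℝ) → ℝ}
    (hg : Integrable g) {S : Set (Fin n → ℝ)} (hS : IsClosed S) (h0 : ∀ x, x ∉ S → g x = 0)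
    (ho : ∀ U ∈ 𝒰, IsOpen U) (hc : ∀ U ∈ 𝒰, IsClosed (S ∩ U)) :
    ∑ U ∈ 𝒰, anisoTV φ (U.indicator g) ≤ anisoTV φ g := by
  classical
  induction 𝒰 using Finset.induction_on generalizing g S with
  | empty => simp
  | insert U 𝒰 hU ih =>
    rw [Finset.sum_insert hU]
    have hSU : IsClosed (S \ U) := hS.sdiff (ho U (Finset.mem_insert_self _ _))
    have hd' : ∀ V ∈ 𝒰, Disjoint U V := fun V hV =>
      hd (by simp) (by simp [hV]) fun h => hU (h ▸ hV)
    have h1 := anisoTV_indicator_add_le hφ hg (hc U (Finset.mem_insert_self _ _)) hSU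
      (Set.disjoint_left.2 fun x hx hx' => hx'.2 hx.2) fun x hx => h0 x fun hxS => hx <| by
        by_cases hxU : x ∈ U
        · exact Or.inl ⟨hxS, hxU⟩
        · exact Or.inr ⟨hxS, hxU⟩
    have e1 : (S ∩ U).indicator g = U.indicator g := by
      ext x
      by_cases hxS : x ∈ S
      · by_cases hxU : x ∈ U <;> simp [hxS, hxU]
      · simp [hxS, indicator, h0 x hxS]
    have h2 := ih (hd.subset (by simp)) (g := (S \ U).indicator g)
      (hg.indicator hSU.measurableSet) hSU (fun x hx => indicator_of_notMem hx g)
      (fun V hV => ho V (Finset.mem_insert_of_mem hV)) (fun V hV => by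
        have : (S \ U) ∩ V = S ∩ V := by
          ext x
          have : x ∈ U → x ∉ V := fun h => Set.disjoint_left.1 (hd' V hV) h
          simp only [mem_inter_iff, Set.mem_sdiff]
          tauto
        rw [this]
        exact hc V (Finset.mem_insert_of_mem hV))
    rw [e1] at h1
    refine le_trans (add_le_add le_rfl (le_trans (Finset.sum_le_sum fun V hV => ?_) h2)) h1
    refine le_of_eq (congrArg (anisoTV φ) ?_)
    ext x
    by_cases hxV : x ∈ V
    · have hxU : x ∉ U := Set.disjoint_right.1 (hd' V hV) hxV
      by_cases hxS : x ∈ S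
      · simp [hxV, hxU, hxS]
      · simp [hxS, indicator, h0 x hxS]
    · simp [hxV]

/-- The perimeters of disjoint relatively clopen pieces of `G` sum up to at most `c`. -/
def SplitBound (φ : (Fin n → ℝ) → ℝ) (G : Set (Fin n → ℝ)) (c : ℝ≥0∞) : Prop :=
  ∀ 𝒰 : Finset (Set (Fin n → ℝ)), (∀ U ∈ 𝒰, IsOpen U ∧ U ⊆ G ∧ IsOpen (G \ U)) →
    (𝒰 : Set (Set (Fin n → ℝ))).PairwiseDisjoint id → ∑ U ∈ 𝒰, anisoPerimeter φ U ≤ c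

end Lsc

section Approximation

variable {n : ℕ} {φ : (Fin n → ℝ) → ℝ}

/-- If the total variation of the truncations of a continuous function grows slowly enough on
`[a, b]`, then some superlevel set satisfies a splitting bound. -/
lemma exists_splitBound_superlevel (hφ : IsNorm φ) {f : (Fin n → ℝ) → ℝ} (hf : Continuous f)
    (hfi : Integrable f) (hf0 : ∀ x, 0 ≤ f x) (hT : anisoTV φ f ≠ ⊤) {a b L : ℝ} (ha : 0 < a)
    (hab : a < b)
    (hL : (anisoTV φ fun x => min (f x) b).toReal - (anisoTV φ fun x => min (f x) a).toReal
      < L * (b - a)) :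
    ∃ t ∈ Ioo a b, SplitBound φ {x | t < f x} (ENNReal.ofReal L) := by
  set M : ℝ → ℝ≥0∞ := fun y => anisoTV φ fun x => min (f x) y with hM
  have hMT : ∀ y, 0 ≤ y → M y ≠ ⊤ := fun y hy => ne_top_of_le_ne_top hT
    (le_self_add.trans (anisoTV_min_add_anisoTV_excess_le hφ hfi hf0 hy))
  have hslab : ∀ x y, 0 ≤ x → x ≤ y →
      M x + anisoTV φ (fun z => max (min (f z) y - x) 0) ≤ M y := by
    intro x y hx hxy
    have h := anisoTV_min_add_anisoTV_excess_le hφ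
      (integrable_truncate hfi hf0 (hx.trans hxy)) (fun z => le_min (hf0 z) (hx.trans hxy)) hx
    simp only [min_assoc, min_eq_right hxy] at h
    exact h
  have hmono : MonotoneOn (fun y => (M y).toReal) (Icc a b) := fun x hx y hy hxy =>
    ENNReal.toReal_mono (hMT y (ha.le.trans hy.1))
      (le_self_add.trans (hslab x y (ha.le.trans hx.1) hxy))
  obtain ⟨t, ht, L', hL', hd⟩ := hmono.exists_hasDerivAt_lt hab hL
  obtain ⟨s, y, c, hsyc, hs, hy, hc⟩ := hmono.exists_slope_seq ht hd
  refine ⟨t, ht, fun 𝒰 h𝒰 hdis => ?_⟩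
  set h : ℕ → (Fin n → ℝ) → ℝ := fun k x => (y k - s k)⁻¹ * max (min (f x) (y k) - s k) 0 with hh
  have hs0 : ∀ k, 0 < s k := fun k => ha.trans (ht.1.trans (hsyc k).1)
  have hsy : ∀ k, 0 < y k - s k := fun k => sub_pos.2 (hsyc k).2.1
  have hhi : ∀ k, Integrable (h k) := fun k =>
    (integrable_excess (integrable_truncate hfi hf0 ((hs0 k).le.trans (hsyc k).2.1.le))
      (fun x => le_min (hf0 x) ((hs0 k).le.trans (hsyc k).2.1.le)) (hs0 k).le).const_mul _
  have hh1 : ∀ k x, |h k x| ≤ 1 := by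
    intro k x
    rw [abs_of_nonneg (mul_nonneg (inv_nonneg.2 (hsy k).le) (le_max_right _ _)),
      inv_mul_le_iff₀ (hsy k), mul_one]
    exact max_le (by linarith [min_le_right (f x) (y k)]) (hsy k).le
  have hh0 : ∀ k x, x ∉ {x | s k ≤ f x} → h k x = 0 := by
    intro k x hx
    have : f x < s k := not_le.1 hx
    simp only [hh]
    rw [max_eq_right (by linarith [min_le_left (f x) (y k)]), mul_zero]
  have hsub : ∀ k, {x | s k ≤ f x} ⊆ {x | t < f x} := fun k x hx => (hsyc k).1.trans_le hx
  have hTV : ∀ k, anisoTV φ (h k) ≤ ENNReal.ofReal (c k) := by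
    intro k
    refine (anisoTV_const_mul_le (inv_nonneg.2 (hsy k).le) _).trans ?_
    have h1 := hslab (s k) (y k) (hs0 k).le (hsyc k).2.1.le
    have hyT := hMT (y k) ((hs0 k).le.trans (hsyc k).2.1.le)
    have hsT := hMT (s k) (hs0 k).le
    have h2 : anisoTV φ (fun z => max (min (f z) (y k) - s k) 0)
        ≤ ENNReal.ofReal ((M (y k)).toReal - (M (s k)).toReal) := by
      rw [ENNReal.ofReal_sub _ ENNReal.toReal_nonneg, ENNReal.ofReal_toReal hyT,
        ENNReal.ofReal_toReal hsT]
      exact ENNReal.le_sub_of_add_le_left hsT h1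
    refine (mul_le_mul_right h2 _).trans ?_
    rw [← ENNReal.ofReal_mul (inv_nonneg.2 (hsy k).le), inv_mul_eq_div]
    exact ENNReal.ofReal_le_ofReal (hsyc k).2.2.2
  have hlim : ∀ x, Tendsto (fun k => h k x) atTop
      (𝓝 ({x | t < f x}.indicator (1 : (Fin n → ℝ) → ℝ) x)) := by
    intro x
    by_cases hx : t < f x
    · rw [indicator_of_mem (show x ∈ {x | t < f x} from hx)]
      refine tendsto_const_nhds.congr' ?_
      filter_upwards [hy.eventually (gt_mem_nhds hx)] with k hk
      simp only [hh]
      rw [min_eq_right hk.le, max_eq_left (hsy k).le, inv_mul_cancel₀ (hsy k).ne']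
      rfl
    · rw [indicator_of_notMem (show x ∉ {x | t < f x} from hx)]
      refine tendsto_const_nhds.congr fun k => (hh0 k x fun hk => hx (hsub k hk)).symm
  have hlim' : ∀ U ∈ 𝒰, ∀ x, Tendsto (fun k => U.indicator (h k) x) atTop
      (𝓝 (U.indicator (1 : (Fin n → ℝ) → ℝ) x)) := by
    intro U hU x
    by_cases hx : x ∈ U
    · have h1 := hlim x
      rw [indicator_of_mem (show x ∈ {x | t < f x} from (h𝒰 U hU).2.1 hx)] at h1
      simpa [hx] using h1
    · simp [hx]
  refine le_trans ?_ (ENNReal.ofReal_le_ofReal hL'.le)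
  refine sum_anisoTV_le_of_tendsto 𝒰 (w := fun U k => U.indicator (h k)) 1
    (fun U hU k => ((hhi k).indicator (h𝒰 U hU).1.measurableSet).aestronglyMeasurable)
    (fun U hU k => Eventually.of_forall fun x => ?_)
    (fun U hU => Eventually.of_forall (hlim' U hU)) (fun k => ?_)
    ((ENNReal.continuous_ofReal.tendsto L').comp hc)
  · by_cases hx : x ∈ U
    · simpa [hx] using hh1 k x
    · simp [hx]
  · refine (sum_anisoTV_indicator_le hφ 𝒰 hdis (hhi k) (isClosed_le continuous_const hf) (hh0 k)
      (fun U hU => (h𝒰 U hU).1) fun U hU => ?_).trans (hTV k)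
    have : {x | s k ≤ f x} ∩ U = {x | s k ≤ f x} \ ({x | t < f x} \ U) := by
      ext x
      have := @hsub k x
      simp only [mem_inter_iff, Set.mem_sdiff, mem_ofPred_eq] at this ⊢
      tauto
    rw [this]
    exact (isClosed_le continuous_const hf).sdiff (h𝒰 U hU).2.2

lemma mollify_indicator_le_half (k : ℕ) {Ω E : Set (Fin n → ℝ)} (hΩ : Convex ℝ Ω) (hE : E ⊆ Ω)
    (hEm : MeasurableSet E) {x : Fin n → ℝ} (hx : x ∉ Ω) :
    mollify k (E.indicator 1) x ≤ 1 / 2 := by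
  set ρ := (mollBump n k).normed volume with hρ
  have hi : Integrable fun t => ρ t * E.indicator (1 : (Fin n → ℝ) → ℝ) (x - t) := by
    refine (integrable_mollBump k).mul_bdd (c := 1) ?_ (Eventually.of_forall fun t => ?_)
    · exact ((measurable_const.indicator hEm).comp
        (measurable_const.sub measurable_id)).aestronglyMeasurable
    · by_cases h : x - t ∈ E <;> simp [h]
  have h1 : mollify k (E.indicator 1) x = ∫ t, ρ t * E.indicator (1 : (Fin n → ℝ) → ℝ) (x - t) :=
    mollify_apply _ _ _
  have hi2 := hi.comp_neg
  have h2 := integral_neg_eq_self (fun t => ρ t * E.indicator (1 : (Fin n → ℝ) → ℝ) (x - t)) volume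
  have h3 : (∫ t, ρ t * E.indicator (1 : (Fin n → ℝ) → ℝ) (x - t))
      + ∫ t, ρ (-t) * E.indicator (1 : (Fin n → ℝ) → ℝ) (x - -t) ≤ ∫ t, ρ t := by
    rw [← integral_add hi hi2]
    refine integral_mono (hi.add hi2) (integrable_mollBump k) fun t => ?_
    simp only [hρ, ContDiffBump.normed_neg, sub_neg_eq_add, ← mul_add]
    refine mul_le_of_le_one_right ((mollBump n k).nonneg_normed t) ?_
    by_cases ha : x - t ∈ E
    · by_cases hb : x + t ∈ E
      · refine absurd ?_ hx
        have := hΩ (hE ha) (hE hb) (a := 1 / 2) (b := 1 / 2) (by norm_num) (by norm_num)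
          (by norm_num)
        convert this using 1
        module
      · simp [ha, hb]
    · by_cases hb : x + t ∈ E <;> simp [ha, hb]
  rw [h2, (mollBump n k).integral_normed] at h3
  rw [h1]
  linarith

end Approximation

section OpenApproximation

variable {n : ℕ} {φ : (Fin n → ℝ) → ℝ}

lemma eventually_ofReal_lt_anisoTV {w : ℕ → (Fin n → ℝ) → ℝ} {u : (Fin n → ℝ) → ℝ}
    (hm : ∀ k, AEStronglyMeasurable (w k) volume)
    (hC : ∀ k, ∀ᵐ x, |w k x| ≤ 1) (hlim : ∀ᵐ x, Tendsto (fun k => w k x) atTop (𝓝 (u x)))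
    {c : ℝ} (hc : ENNReal.ofReal c < anisoTV φ u) :
    ∀ᶠ k in atTop, ENNReal.ofReal c < anisoTV φ (w k) :=
  eventually_lt_of_lt_liminf (hc.trans_le (anisoTV_le_liminf_of_ae 1 hm hC hlim))

lemma lt_toReal_of_ofReal_lt {c : ℝ} {X : ℝ≥0∞} (hX : X ≠ ⊤) (h : ENNReal.ofReal c < X) :
    c < X.toReal := by
  by_contra! hc
  exact (ENNReal.le_ofReal_iff_toReal_le hX (ENNReal.toReal_nonneg.trans hc)).2 hc |>.not_gt h

lemma eventually_mollify_growth (hφ : IsNorm φ) {E : Set (Fin n → ℝ)} (hEm : MeasurableSet E)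
    (hEf : volume E ≠ ⊤) (hP : anisoPerimeter φ E ≠ ⊤) (hP0 : anisoPerimeter φ E ≠ 0) {δ : ℝ}
    (hδ : 0 < δ) :
    ∀ᶠ k in atTop,
      (anisoTV φ fun x => min (mollify k (E.indicator 1) x) (3 / 4)).toReal
        - (anisoTV φ fun x => min (mollify k (E.indicator 1) x) (1 / 2)).toReal
        < ((anisoPerimeter φ E).toReal + δ) * (3 / 4 - 1 / 2) := by
  set u : (Fin n → ℝ) → ℝ := E.indicator 1 with hu
  set P := (anisoPerimeter φ E).toReal with hPdef
  have hPpos : 0 < P := ENNReal.toReal_pos hP0 hP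
  have hui : Integrable u := integrable_indicator_one hEm hEf
  have hu01 : ∀ x, 0 ≤ u x ∧ u x ≤ 1 := fun x => by
    by_cases h : x ∈ E <;> simp [hu, h]
  have hf0 : ∀ k x, 0 ≤ mollify k u x := fun k => mollify_nonneg k fun x => (hu01 x).1
  have hf1 : ∀ k x, mollify k u x ≤ 1 := fun k =>
    mollify_le k hui.locallyIntegrable fun x => (hu01 x).2
  have hfi : ∀ k, Integrable (mollify k u) := fun k => mollify_integrable k hui
  have hlim := mollify_ae_tendsto hui.locallyIntegrable
  have h1 : ∀ᶠ k in atTop, ENNReal.ofReal (P / 2 - δ / 16)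
      < anisoTV φ fun x => min (mollify k u x) (1 / 2) := by
    refine eventually_ofReal_lt_anisoTV (u := fun x => min (u x) (1 / 2))
      (fun k => (integrable_truncate (hfi k) (hf0 k) (by norm_num)).aestronglyMeasurable)
      (fun k => Eventually.of_forall fun x => ?_) ?_ ?_
    · rw [abs_of_nonneg (le_min (hf0 k x) (by norm_num))]
      exact (min_le_left _ _).trans (hf1 k x)
    · filter_upwards [hlim] with x hx
      exact hx.min tendsto_const_nhds
    · have h2 := anisoTV_const_mul_le (φ := φ) zero_le_two (fun x => min (u x) (1 / 2))
      have h3 : (fun x => 2 * min (u x) (1 / 2)) = u := by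
        ext x
        by_cases h : x ∈ E <;> simp [hu, h] <;> norm_num
      rw [h3] at h2
      have h4 : ENNReal.ofReal 2 * ENNReal.ofReal (P / 2) = anisoTV φ u := by
        rw [← ENNReal.ofReal_mul zero_le_two, mul_div_cancel₀ _ two_ne_zero]
        exact ENNReal.ofReal_toReal hP
      rw [← h4] at h2
      refine ((ENNReal.ofReal_lt_ofReal_iff (by positivity)).2 ?_).trans_le
        ((ENNReal.mul_le_mul_iff_right (by norm_num) (by norm_num)).1 h2)
      linarith
  have h2 : ∀ᶠ k in atTop, ENNReal.ofReal (P / 4 - δ / 16)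
      < anisoTV φ fun x => max (mollify k u x - 3 / 4) 0 := by
    refine eventually_ofReal_lt_anisoTV (u := fun x => max (u x - 3 / 4) 0)
      (fun k => (integrable_excess (hfi k) (hf0 k) (by norm_num)).aestronglyMeasurable)
      (fun k => Eventually.of_forall fun x => ?_) ?_ ?_
    · rw [abs_of_nonneg (le_max_right _ _)]
      exact max_le (by linarith [hf1 k x]) zero_le_one
    · filter_upwards [hlim] with x hx
      exact (hx.sub_const _).max tendsto_const_nhds
    · have h2 := anisoTV_const_mul_le (φ := φ) zero_le_four (fun x => max (u x - 3 / 4) 0)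
      have h3 : (fun x => 4 * max (u x - 3 / 4) 0) = u := by
        ext x
        by_cases h : x ∈ E <;> simp [hu, h] <;> norm_num
      rw [h3] at h2
      have h4 : ENNReal.ofReal 4 * ENNReal.ofReal (P / 4) = anisoTV φ u := by
        rw [← ENNReal.ofReal_mul zero_le_four, mul_div_cancel₀ _ four_ne_zero]
        exact ENNReal.ofReal_toReal hP
      rw [← h4] at h2
      refine ((ENNReal.ofReal_lt_ofReal_iff (by positivity)).2 ?_).trans_le
        ((ENNReal.mul_le_mul_iff_right (by norm_num) (by norm_num)).1 h2)
      linarith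
  filter_upwards [h1, h2] with k hk1 hk2
  have h5 := (anisoTV_min_add_anisoTV_excess_le hφ (hfi k) (hf0 k)
    (x := 3 / 4) (by norm_num)).trans (anisoTV_mollify_le k hui)
  have h6 := (anisoTV_min_add_anisoTV_excess_le hφ (hfi k) (hf0 k)
    (x := 1 / 2) (by norm_num)).trans (anisoTV_mollify_le k hui)
  have hT1 := ne_top_of_le_ne_top hP (le_self_add.trans h5)
  have hT2 := ne_top_of_le_ne_top hP (le_add_self.trans h5)
  have hT3 := ne_top_of_le_ne_top hP (le_self_add.trans h6)
  have h7 := ENNReal.toReal_mono hP h5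
  rw [ENNReal.toReal_add hT1 hT2] at h7
  have h8 := lt_toReal_of_ofReal_lt hT3 hk1
  have h9 := lt_toReal_of_ofReal_lt hT2 hk2
  change _ ≤ P at h7
  linarith

/-- A set of finite perimeter in a convex set is approximated by open subsets all of whose
splittings have almost no larger total perimeter. -/
lemma exists_open_approx (hφ : IsNorm φ) {Ω E : Set (Fin n → ℝ)} (hΩ : Convex ℝ Ω) (hE : E ⊆ Ω)
    (hEm : MeasurableSet E) (hEf : volume E ≠ ⊤) (hP : anisoPerimeter φ E ≠ ⊤)
    (hP0 : anisoPerimeter φ E ≠ 0) :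
    ∃ G : ℕ → Set (Fin n → ℝ),
      (∀ k, IsOpen (G k) ∧ G k ⊆ Ω ∧
        SplitBound φ (G k) (anisoPerimeter φ E + ENNReal.ofReal (1 / ((k : ℝ) + 1)))) ∧
      ∀ᵐ x, Tendsto (fun k => (G k).indicator (1 : (Fin n → ℝ) → ℝ) x) atTop
        (𝓝 (E.indicator 1 x)) := by
  set u : (Fin n → ℝ) → ℝ := E.indicator 1 with hu
  have hui : Integrable u := integrable_indicator_one hEm hEf
  have hu01 : ∀ x, 0 ≤ u x ∧ u x ≤ 1 := fun x => by
    by_cases h : x ∈ E <;> simp [hu, h]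
  have hf0 : ∀ k x, 0 ≤ mollify k u x := fun k => mollify_nonneg k fun x => (hu01 x).1
  have key : ∀ j : ℕ, ∃ k ≥ j, ∃ t ∈ Ioo (1 / 2 : ℝ) (3 / 4),
      SplitBound φ {x | t < mollify k u x}
        (anisoPerimeter φ E + ENNReal.ofReal (1 / ((j : ℝ) + 1))) := by
    intro j
    have hδ : 0 < 1 / ((j : ℝ) + 1) := by positivity
    obtain ⟨k, hk, hkj⟩ :=
      ((eventually_mollify_growth hφ hEm hEf hP hP0 hδ).and (eventually_ge_atTop j)).exists
    obtain ⟨t, ht, hs⟩ := exists_splitBound_superlevel hφ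
      (mollify_contDiff k hui.locallyIntegrable).continuous (mollify_integrable k hui) (hf0 k)
      (ne_top_of_le_ne_top hP (anisoTV_mollify_le k hui)) (by norm_num) (by norm_num) hk
    rw [ENNReal.ofReal_add ENNReal.toReal_nonneg hδ.le, ENNReal.ofReal_toReal hP] at hs
    exact ⟨k, hkj, t, ht, hs⟩
  choose k hk t ht hs using key
  refine ⟨fun j => {x | t j < mollify (k j) u x}, fun j => ⟨?_, ?_, hs j⟩, ?_⟩
  · exact isOpen_lt continuous_const (mollify_contDiff _ hui.locallyIntegrable).continuous
  · intro x hx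
    by_contra hxΩ
    have h1 := mollify_indicator_le_half (k j) hΩ hE hEm hxΩ
    have h2 : t j < mollify (k j) u x := hx
    linarith [(ht j).1]
  · filter_upwards [mollify_ae_tendsto hui.locallyIntegrable] with x hx
    have hx' := hx.comp (tendsto_atTop_mono hk tendsto_id)
    refine tendsto_const_nhds.congr' ?_
    by_cases h : x ∈ E
    · have h1 : u x = 1 := by simp [hu, h]
      rw [h1] at hx'
      filter_upwards [hx'.eventually (lt_mem_nhds (show (3 / 4 : ℝ) < 1 by norm_num))] with j hj
      have h2 : x ∈ {x | t j < mollify (k j) u x} := (ht j).2.trans hj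
      rw [h1, indicator_of_mem h2]; rfl
    · have h1 : u x = 0 := by simp [hu, h]
      rw [h1] at hx'
      filter_upwards [hx'.eventually (gt_mem_nhds (show (0 : ℝ) < 1 / 2 by norm_num))] with j hj
      have h2 : x ∉ {x | t j < mollify (k j) u x} := fun h3 =>
        absurd ((ht j).1.trans h3) (not_lt.2 (le_of_lt hj))
      rw [h1, indicator_of_notMem h2]

end OpenApproximation

section MassBound

variable {n : ℕ} {φ : (Fin n → ℝ) → ℝ} {Ω : Set (Fin n → ℝ)}

/-- Every `ℕ`-valued integrable function of mass `m` supported in `Ω` has total variation at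
least `p`. -/
def MassBound (φ : (Fin n → ℝ) → ℝ) (Ω : Set (Fin n → ℝ)) (m : ℝ) (p : ℝ≥0∞) : Prop :=
  ∀ v : (Fin n → ℝ) → ℝ, Integrable v → (∀ x ∉ Ω, v x = 0) → (∀ x, ∃ k : ℕ, v x = k) →
    ∫ x, v x = m → p ≤ anisoTV φ v

lemma exists_nat_indicator_one (E : Set (Fin n → ℝ)) (x : Fin n → ℝ) :
    ∃ k : ℕ, E.indicator (1 : (Fin n → ℝ) → ℝ) x = k := by
  by_cases hx : x ∈ E
  · exact ⟨1, by simp [hx]⟩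
  · exact ⟨0, by simp [hx]⟩

lemma integral_indicator_one' {E : Set (Fin n → ℝ)} (hE : MeasurableSet E) :
    ∫ x, E.indicator (1 : (Fin n → ℝ) → ℝ) x = (volume E).toReal :=
  integral_indicator_one hE

lemma MassBound.of_add {m r : ℝ} {p p' : ℝ≥0∞} {A : Set (Fin n → ℝ)} (h : MassBound φ Ω (m + r) p)
    (hA : MeasurableSet A) (hAΩ : A ⊆ Ω) (hAf : volume A ≠ ⊤) (hr : (volume A).toReal = r)
    (hP : anisoPerimeter φ A ≠ ⊤) (hle : p' + anisoPerimeter φ A ≤ p) : MassBound φ Ω m p' := by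
  intro v hv h0 hN hm
  have hAi := integrable_indicator_one hA hAf
  have h1 := h (fun x => v x + A.indicator (1 : (Fin n → ℝ) → ℝ) x) (hv.add hAi)
    (fun x hx => by
      have hxA : x ∉ A := fun h => hx (hAΩ h)
      simp [h0 x hx, hxA])
    (fun x => by
      obtain ⟨a, ha⟩ := hN x
      obtain ⟨b, hb⟩ := exists_nat_indicator_one A x
      exact ⟨a + b, by rw [ha, hb]; push_cast; rfl⟩)
    (by rw [integral_add hv hAi, hm, integral_indicator_one' hA, hr])
  have h2 := (hle.trans h1).trans (anisoTV_add_le hv hAi)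
  exact (ENNReal.add_le_add_iff_right hP).1 h2

lemma MassBound.le_sqrt_mul {φ : (Fin 2 → ℝ) → ℝ} {Ω : Set (Fin 2 → ℝ)} (hΩ : Convex ℝ Ω)
    {x₀ : Fin 2 → ℝ} (hx₀ : x₀ ∈ Ω) {m μ : ℝ} {p : ℝ≥0∞} (h : MassBound φ Ω m p) (hm : 0 < m)
    (hμ : m ≤ μ) {v : (Fin 2 → ℝ) → ℝ} (hv : Integrable v) (h0 : ∀ x ∉ Ω, v x = 0)
    (hN : ∀ x, ∃ k : ℕ, v x = k) (hvμ : ∫ x, v x = μ) :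
    p ≤ ENNReal.ofReal (√(m / μ)) * anisoTV φ v := by
  have hμ0 := hm.trans_le hμ
  set t := √(m / μ) with ht
  have ht0 : 0 < t := Real.sqrt_pos.2 (div_pos hm hμ0)
  have ht1 : t ≤ 1 := Real.sqrt_le_one.2 ((div_le_one hμ0).2 hμ)
  have ht2 : t ^ 2 = m / μ := Real.sq_sqrt (div_pos hm hμ0).le
  refine (h (fun x => v (t⁻¹ • (x - (1 - t) • x₀))) ?_ ?_ (fun x => hN _) ?_).trans
    (anisoTV_dilate_le v ht0 _)
  · exact (hv.comp_smul (inv_ne_zero ht0.ne')).comp_sub_right _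
  · intro x hx
    refine h0 _ fun hy => hx ?_
    have h1 := hΩ hy hx₀ ht0.le (sub_nonneg.2 ht1) (by ring)
    rwa [smul_inv_smul₀ ht0.ne', sub_add_cancel] at h1
  · rw [integral_comp_dilate v ht0, hvμ, ht2]
    field_simp

lemma MassBound.integral_le {φ : (Fin 2 → ℝ) → ℝ} {Ω : Set (Fin 2 → ℝ)} (hΩ : Convex ℝ Ω)
    {x₀ : Fin 2 → ℝ} (hx₀ : x₀ ∈ Ω) {m : ℝ} {p : ℝ≥0∞} (h : MassBound φ Ω m p) (hm : 0 < m)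
    (hp0 : p ≠ 0) (hp : p ≠ ⊤) {v : (Fin 2 → ℝ) → ℝ} (hv : Integrable v) (h0 : ∀ x ∉ Ω, v x = 0)
    (hN : ∀ x, ∃ k : ℕ, v x = k) (hle : anisoTV φ v ≤ p) : ∫ x, v x ≤ m := by
  by_contra! hlt
  have h1 := (h.le_sqrt_mul hΩ hx₀ hm hlt.le hv h0 hN rfl).trans (mul_le_mul_right hle _)
  have h2 : ENNReal.ofReal (√(m / ∫ x, v x)) < 1 := by
    rw [ENNReal.ofReal_lt_one, Real.sqrt_lt' one_pos, one_pow, div_lt_one (hm.trans hlt)]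
    exact hlt
  refine (ENNReal.mul_lt_mul_left hp0 hp h2).not_ge ?_
  simpa using h1

lemma MassBound.eventually_integral_lt {φ : (Fin 2 → ℝ) → ℝ} {Ω : Set (Fin 2 → ℝ)}
    (hΩ : Convex ℝ Ω) {x₀ : Fin 2 → ℝ} (hx₀ : x₀ ∈ Ω) {m : ℝ} {p : ℝ≥0∞} (h : MassBound φ Ω m p)
    (hm : 0 < m) (hp0 : p ≠ 0) (hp : p ≠ ⊤) {v : ℕ → (Fin 2 → ℝ) → ℝ}
    (hv : ∀ k, Integrable (v k)) (h0 : ∀ k, ∀ x ∉ Ω, v k x = 0)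
    (hN : ∀ k x, ∃ j : ℕ, v k x = j) {b : ℕ → ℝ≥0∞} (hle : ∀ k, anisoTV φ (v k) ≤ b k)
    (hb : Tendsto b atTop (𝓝 p)) {ε : ℝ} (hε : 0 < ε) :
    ∀ᶠ k in atTop, ∫ x, v k x < m + ε := by
  set s := ENNReal.ofReal (√(m / (m + ε))) with hs
  have hs1 : s < 1 := by
    rw [hs, ENNReal.ofReal_lt_one, Real.sqrt_lt' one_pos, one_pow, div_lt_one (by positivity)]
    linarith
  have h1 : Tendsto (fun k => s * b k) atTop (𝓝 (s * p)) :=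
    ENNReal.Tendsto.const_mul hb (Or.inr ENNReal.ofReal_ne_top)
  have h2 : s * p < p := by simpa using ENNReal.mul_lt_mul_left hp0 hp hs1
  filter_upwards [h1.eventually_lt_const h2] with k hk
  by_contra! hlt
  have h3 := h.le_sqrt_mul hΩ hx₀ hm (by linarith) (hv k) (h0 k) (hN k) rfl
  refine (h3.trans (mul_le_mul' (ENNReal.ofReal_le_ofReal (Real.sqrt_le_sqrt ?_))
      (hle k))).not_gt hk
  gcongr

end MassBound

section Components

variable {n : ℕ} {φ : (Fin n → ℝ) → ℝ}

lemma isOpen_diff_connectedComponentIn {G : Set (Fin n → ℝ)} (hG : IsOpen G) (x : Fin n → ℝ) :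
    IsOpen (G \ connectedComponentIn G x) := by
  refine isOpen_iff_forall_mem_open.2 fun y hy => ⟨connectedComponentIn G y, ?_,
    hG.connectedComponentIn, mem_connectedComponentIn hy.1⟩
  intro z hz
  refine ⟨connectedComponentIn_subset _ _ hz, fun hzx => hy.2 ?_⟩
  rw [connectedComponentIn_eq hzx, ← connectedComponentIn_eq hz]
  exact mem_connectedComponentIn hy.1

lemma connectedComponentIn_pairwiseDisjoint (G : Set (Fin n → ℝ)) :
    (connectedComponentIn G '' G).PairwiseDisjoint id := by
  rintro _ ⟨x, -, rfl⟩ _ ⟨y, -, rfl⟩ hne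
  refine Set.disjoint_left.2 fun z hzx hzy => hne ?_
  rw [connectedComponentIn_eq hzx, connectedComponentIn_eq hzy]

/-- If the perimeter of the pieces of `G` is controlled, some component of `G` is large. -/
lemma exists_large_component {C κ : NNReal} (hC : ∀ U : Set (Fin n → ℝ), MeasurableSet U →
      Bornology.IsBounded U → anisoPerimeter φ U ≠ ⊤ → volume U ≤ C * anisoPerimeter φ U ^ 2)
    {G : Set (Fin n → ℝ)} (hG : IsOpen G) (hGb : Bornology.IsBounded G) {c : ℝ≥0∞} (hc : c ≠ ⊤)
    (hS : SplitBound φ G c) (hκ : κ * c < volume G) :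
    ∃ U, IsOpen U ∧ IsConnected U ∧ U ⊆ G ∧ IsOpen (G \ U) ∧ (κ : ℝ≥0∞) ^ 2 < C * volume U := by
  by_contra! hcon
  have hprop : ∀ U ∈ connectedComponentIn G '' G, IsOpen U ∧ U ⊆ G ∧ IsOpen (G \ U) := by
    rintro _ ⟨x, hx, rfl⟩
    exact ⟨hG.connectedComponentIn, connectedComponentIn_subset _ _,
      isOpen_diff_connectedComponentIn hG x⟩
  have hd := connectedComponentIn_pairwiseDisjoint G
  have hcount : (connectedComponentIn G '' G).Countable :=
    hd.countable_of_isOpen (fun U hU => (hprop U hU).1) (by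
      rintro _ ⟨x, hx, rfl⟩
      exact ⟨x, mem_connectedComponentIn hx⟩)
  have hsmall : ∀ U ∈ connectedComponentIn G '' G, volume U ≤ κ * anisoPerimeter φ U := by
    intro U hU
    obtain ⟨ho, hsub, hco⟩ := hprop U hU
    have hP : anisoPerimeter φ U ≠ ⊤ := by
      refine ne_top_of_le_ne_top hc ?_
      simpa using hS {U} (by simpa using ⟨ho, hsub, hco⟩) (by simp)
    have hκU : C * volume U ≤ (κ : ℝ≥0∞) ^ 2 := by
      obtain ⟨x, hx, rfl⟩ := hU
      exact hcon _ ho (isConnected_connectedComponentIn_iff.2 hx) hsub hco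
    refine (ENNReal.pow_le_pow_left_iff two_ne_zero).1 ?_
    calc volume U ^ 2 = volume U * volume U := sq _
      _ ≤ volume U * (C * anisoPerimeter φ U ^ 2) := by
        gcongr
        exact hC U ho.measurableSet (hGb.subset hsub) hP
      _ = C * volume U * anisoPerimeter φ U ^ 2 := by ring
      _ ≤ (κ : ℝ≥0∞) ^ 2 * anisoPerimeter φ U ^ 2 := by gcongr
      _ = _ := by ring
  have hGU : G = ⋃₀ (connectedComponentIn G '' G) := by
    refine Subset.antisymm (fun x hx => ⟨_, mem_image_of_mem _ hx, mem_connectedComponentIn hx⟩) ?_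
    exact sUnion_subset fun U hU => (hprop U hU).2.1
  refine hκ.not_ge ?_
  rw [hGU, measure_sUnion hcount hd fun U hU => (hprop U hU).1.measurableSet,
    ENNReal.tsum_eq_iSup_sum]
  refine iSup_le fun s => ?_
  calc ∑ U ∈ s, volume U.1 ≤ ∑ U ∈ s, κ * anisoPerimeter φ U.1 :=
        Finset.sum_le_sum fun U _ => hsmall _ U.2
    _ = κ * ∑ U ∈ s, anisoPerimeter φ U.1 := by rw [Finset.mul_sum]
    _ ≤ κ * c := by
      gcongr
      have h := hS (s.map (Function.Embedding.subtype _)) (fun U hU => by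
          obtain ⟨⟨U', hU'⟩, -, rfl⟩ := Finset.mem_map.1 hU
          exact hprop _ hU') (by
          refine hd.subset fun U hU => ?_
          obtain ⟨⟨U', hU'⟩, -, rfl⟩ := Finset.mem_map.1 hU
          exact hU')
      simpa using h

end Components

section Blaschke

variable {n : ℕ}

/-- If a ball around `x` is close to the closure of an open convex set, this set contains `x`. -/
lemma mem_of_ball_subset_thickening {C : Set (Fin n → ℝ)} (hCo : IsOpen C) (hC : Convex ℝ C)
    {x : Fin n → ℝ} {δ : ℝ} (hδ : 0 < δ)
    (h : ∀ y, dist y x ≤ δ → ∃ z ∈ closure C, dist y z < δ / 4) : x ∈ C := by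
  by_contra hx
  obtain ⟨f, hf⟩ := geometric_hahn_banach_open_point hC hCo hx
  have hcl : ∀ z ∈ closure C, f z ≤ f x := fun z hz =>
    closure_minimal (fun y hy => (hf y hy).le) (isClosed_le f.continuous continuous_const) hz
  have hf0 : 0 < ‖f‖ := by
    refine norm_pos_iff.2 fun h0 => ?_
    obtain ⟨z, hz, -⟩ := h x (by simp [hδ.le])
    obtain ⟨y, hy⟩ := closure_nonempty_iff.1 ⟨z, hz⟩
    simpa [h0] using hf y hy
  obtain ⟨w, hw1, hw⟩ : ∃ w : Fin n → ℝ, ‖w‖ ≤ 1 ∧ ‖f‖ / 2 < f w := by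
    by_contra! hcon
    refine (f.opNorm_le_of_unit_norm (C := ‖f‖ / 2) (by positivity) fun w hw => ?_).not_gt
      (half_lt_self hf0)
    rw [Real.norm_eq_abs, abs_le]
    have h2 := hcon (-w) (by simp [hw])
    rw [map_neg] at h2
    exact ⟨by linarith, hcon w hw.le⟩
  obtain ⟨z, hz, hyz⟩ := h (x + δ • w) (by
    rw [dist_eq_norm, add_sub_cancel_left, norm_smul, Real.norm_of_nonneg hδ.le]
    nlinarith)
  have h3 := hcl z hz
  have h4 : f (x + δ • w) - f z ≤ ‖f‖ * (δ / 4) := by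
    rw [← map_sub]
    refine (le_abs_self _).trans ((f.le_opNorm _).trans ?_)
    rw [← dist_eq_norm]
    gcongr
  rw [map_add, map_smul, smul_eq_mul] at h4
  nlinarith

/-- **Blaschke selection** for open convex subsets of a bounded open convex set. -/
lemma exists_convex_limit {Ω : Set (Fin n → ℝ)} (hΩo : IsOpen Ω) (hΩb : Bornology.IsBounded Ω)
    (hΩ : Convex ℝ Ω) {C : ℕ → Set (Fin n → ℝ)} (hCo : ∀ k, IsOpen (C k))
    (hC : ∀ k, Convex ℝ (C k)) (hCΩ : ∀ k, C k ⊆ Ω) :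
    ∃ (A : Set (Fin n → ℝ)) (σ : ℕ → ℕ), StrictMono σ ∧ IsOpen A ∧ Convex ℝ A ∧ A ⊆ Ω ∧
      ∀ᵐ x, Tendsto (fun k => (C (σ k)).indicator (1 : (Fin n → ℝ) → ℝ) x) atTop
        (𝓝 (A.indicator 1 x)) := by
  let K : ℕ → TopologicalSpace.Compacts (Fin n → ℝ) := fun k =>
    ⟨closure (C k), (hΩb.subset (hCΩ k)).isCompact_closure⟩
  obtain ⟨L, hL, σ, hσ, hlim⟩ :=
    (TopologicalSpace.Compacts.isCompact_subsets_of_isCompact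
      hΩb.isCompact_closure).tendsto_subseq (x := K) fun k => closure_mono (hCΩ k)
  have hHd : ∀ ε : ℝ, 0 < ε → ∀ᶠ k in atTop,
      Metric.hausdorffEDist (closure (C (σ k))) (L : Set (Fin n → ℝ)) < ENNReal.ofReal ε :=
    fun ε hε => EMetric.tendsto_nhds.1 hlim _ (ENNReal.ofReal_pos.2 hε)
  have hto : ∀ ε : ℝ, 0 < ε → ∀ᶠ k in atTop,
      (∀ y ∈ closure (C (σ k)), ∃ z ∈ (L : Set (Fin n → ℝ)), dist y z < ε) ∧
      (∀ y ∈ (L : Set (Fin n → ℝ)), ∃ z ∈ closure (C (σ k)), dist y z < ε) := by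
    intro ε hε
    filter_upwards [hHd ε hε] with k hk
    constructor
    · intro y hy
      obtain ⟨z, hz, hd⟩ := Metric.exists_edist_lt_of_hausdorffEDist_lt hy hk
      exact ⟨z, hz, (edist_lt_ofReal).1 hd⟩
    · intro y hy
      rw [Metric.hausdorffEDist_comm] at hk
      obtain ⟨z, hz, hd⟩ := Metric.exists_edist_lt_of_hausdorffEDist_lt hy hk
      exact ⟨z, hz, (edist_lt_ofReal).1 hd⟩
  have hLcl : IsClosed (L : Set (Fin n → ℝ)) := L.isCompact.isClosed
  have hLc : Convex ℝ (L : Set (Fin n → ℝ)) := by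
    intro x hx y hy a b ha hb hab
    rw [← hLcl.closure_eq]
    refine Metric.mem_closure_iff.2 fun ε hε => ?_
    obtain ⟨k, hk1, hk2⟩ := (hto (ε / 2) (by positivity)).exists
    obtain ⟨x', hx', hdx⟩ := hk2 x hx
    obtain ⟨y', hy', hdy⟩ := hk2 y hy
    obtain ⟨z, hz, hdz⟩ := hk1 _ ((hC (σ k)).closure hx' hy' ha hb hab)
    refine ⟨z, hz, (dist_triangle _ (a • x' + b • y') _).trans_lt ?_⟩
    have h1 : dist (a • x + b • y) (a • x' + b • y') ≤ a * dist x x' + b * dist y y' := by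
      refine (dist_add_add_le _ _ _ _).trans ?_
      rw [dist_smul₀, dist_smul₀, Real.norm_of_nonneg ha, Real.norm_of_nonneg hb]
    have h2 : a * dist x x' + b * dist y y' ≤ ε / 2 := by nlinarith
    linarith
  refine ⟨interior L, σ, hσ, isOpen_interior, hLc.interior, ?_, ?_⟩
  · intro x hx
    have hx' : x ∈ interior (closure Ω) := interior_mono hL hx
    rcases Ω.eq_empty_or_nonempty with h | h
    · simp [h] at hx'
    · rwa [hΩ.interior_closure_eq_interior_of_nonempty_interior
        (by rwa [hΩo.interior_eq]), hΩo.interior_eq] at hx'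
  · have hnull := hLc.addHaar_frontier volume
    filter_upwards [measure_eq_zero_iff_ae_notMem.1 hnull] with x hx
    refine tendsto_const_nhds.congr' ?_
    by_cases hxL : x ∈ interior (L : Set (Fin n → ℝ))
    · obtain ⟨δ, hδ, hball⟩ :=
        Metric.nhds_basis_closedBall.mem_iff.1 (mem_interior_iff_mem_nhds.1 hxL)
      filter_upwards [hto (δ / 4) (by positivity)] with k hk
      have : x ∈ C (σ k) := mem_of_ball_subset_thickening (hCo _) (hC _) hδ
        fun y hy => hk.2 y (hball hy)
      simp [hxL, this]
    · have hxL' : x ∉ (L : Set (Fin n → ℝ)) := fun h => hx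
        ⟨subset_closure h, hxL⟩
      obtain ⟨δ, hδ, hball⟩ := Metric.nhds_basis_ball.mem_iff.1 (hLcl.isOpen_compl.mem_nhds hxL')
      filter_upwards [hto δ hδ] with k hk
      have : x ∉ C (σ k) := fun h => by
        obtain ⟨z, hz, hd⟩ := hk.1 x (subset_closure h)
        exact hball (by rwa [Metric.mem_ball, dist_comm]) hz
      simp [hxL, this]

end Blaschke

section LargePiece

variable {n : ℕ} {φ : (Fin n → ℝ) → ℝ}

lemma tendsto_volume_of_tendsto_indicator {Ω E : Set (Fin n → ℝ)} (hΩm : MeasurableSet Ω)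
    (hΩ : volume Ω ≠ ⊤) {S : ℕ → Set (Fin n → ℝ)} (hS : ∀ k, MeasurableSet (S k))
    (hSΩ : ∀ k, S k ⊆ Ω) (hE : MeasurableSet E)
    (h : ∀ᵐ x, Tendsto (fun k => (S k).indicator (1 : (Fin n → ℝ) → ℝ) x) atTop
      (𝓝 (E.indicator 1 x))) :
    Tendsto (fun k => (volume (S k)).toReal) atTop (𝓝 (volume E).toReal) := by
  simp only [← integral_indicator_one' hE, ← fun k => integral_indicator_one' (hS k)]
  refine tendsto_integral_of_dominated_convergence (Ω.indicator 1)
    (fun k => (measurable_one.indicator (hS k)).aestronglyMeasurable)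
    (integrable_indicator_one hΩm hΩ) (fun k => Eventually.of_forall fun x => ?_) h
  by_cases hx : x ∈ S k
  · simp [hx, hSΩ k hx]
  · rw [indicator_of_notMem hx, norm_zero]
    exact indicator_nonneg (fun _ _ => zero_le_one) _

lemma exists_subseq_tendsto_indicator_zero {S : ℕ → Set (Fin n → ℝ)}
    (h : Tendsto (fun k => volume (S k)) atTop (𝓝 0)) :
    ∃ τ : ℕ → ℕ, StrictMono τ ∧ ∀ᵐ x, Tendsto
      (fun k => (S (τ k)).indicator (1 : (Fin n → ℝ) → ℝ) x) atTop (𝓝 0) := by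
  have h1 : TendstoInMeasure volume (fun k => (S k).indicator (1 : (Fin n → ℝ) → ℝ)) atTop
      (fun _ => (0 : ℝ)) := by
    intro ε hε
    refine tendsto_of_tendsto_of_tendsto_of_le_of_le tendsto_const_nhds h (fun _ => zero_le)
      fun k => measure_mono fun x hx => ?_
    by_contra hxS
    simp [hxS, hε.ne'] at hx
  exact h1.exists_seq_tendsto_ae

lemma anisoPerimeter_ne_zero {φ : (Fin 2 → ℝ) → ℝ} (hφ : IsNorm φ) {E : Set (Fin 2 → ℝ)}
    (hEm : MeasurableSet E) (hEb : Bornology.IsBounded E) (hE0 : volume E ≠ 0) :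
    anisoPerimeter φ E ≠ 0 := by
  obtain ⟨C, hC⟩ := exists_volume_le_sq_anisoPerimeter hφ
  intro h
  have := hC E hEm hEb (by simp [h])
  simp [h, hE0] at this

/-- A set satisfying the mass bound with equality splits off a convex piece. -/
lemma MassBound.exists_convex_piece {φ : (Fin 2 → ℝ) → ℝ} (hφ : IsNorm φ) {Ω E : Set (Fin 2 → ℝ)}
    (hΩo : IsOpen Ω) (hΩb : Bornology.IsBounded Ω) (hΩ : Convex ℝ Ω) (hEΩ : E ⊆ Ω)
    (hEm : MeasurableSet E) (hE0 : volume E ≠ 0) (hP : anisoPerimeter φ E ≠ ⊤)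
    (hB : MassBound φ Ω (volume E).toReal (anisoPerimeter φ E)) :
    ∃ A, IsOpen A ∧ Convex ℝ A ∧ A.Nonempty ∧ A ⊆ Ω ∧ volume (A \ E) = 0 ∧
      anisoPerimeter φ A + anisoPerimeter φ (E \ A) ≤ anisoPerimeter φ E := by
  obtain ⟨C, hC⟩ := exists_volume_le_sq_anisoPerimeter hφ
  have hfin : ∀ S ⊆ Ω, volume S ≠ ⊤ := fun S hS => (hΩb.subset hS).measure_lt_top.ne
  have hP0 := anisoPerimeter_ne_zero hφ hEm (hΩb.subset hEΩ) hE0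
  have hm : 0 < (volume E).toReal := ENNReal.toReal_pos hE0 (hfin E hEΩ)
  obtain ⟨x₀, hx₀E⟩ := nonempty_of_measure_ne_zero hE0
  have hx₀ := hEΩ hx₀E
  set p := anisoPerimeter φ E with hp
  obtain ⟨G, hG, hGlim⟩ := exists_open_approx hφ hΩ hEΩ hEm (hfin E hEΩ) hP hP0
  have hGvol : Tendsto (fun k => (volume (G k)).toReal) atTop (𝓝 (volume E).toReal) :=
    tendsto_volume_of_tendsto_indicator hΩo.measurableSet (hfin Ω subset_rfl)
      (fun k => (hG k).1.measurableSet) (fun k => (hG k).2.1) hEm hGlim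
  obtain ⟨κ, hκ0, hκ⟩ : ∃ κ : NNReal, κ ≠ 0 ∧ ∀ᶠ k : ℕ in atTop,
      κ * (p + ENNReal.ofReal (1 / ((k : ℝ) + 1))) < volume (G k) := by
    have hp1 : (0 : ℝ) < p.toReal + 1 := by positivity
    refine ⟨((volume E).toReal / 2 / (p.toReal + 1)).toNNReal, ?_, ?_⟩
    · exact (Real.toNNReal_pos.2 (div_pos (half_pos hm) hp1)).ne'
    · filter_upwards [hGvol.eventually_const_lt (half_lt_self hm)] with k hk
      have hb : p + ENNReal.ofReal (1 / ((k : ℝ) + 1)) ≤ ENNReal.ofReal (p.toReal + 1) := by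
        rw [ENNReal.ofReal_add ENNReal.toReal_nonneg zero_le_one, ENNReal.ofReal_toReal hP]
        gcongr
        rw [div_le_one (by positivity)]
        linarith [k.cast_nonneg (α := ℝ)]
      refine (mul_le_mul_right hb _).trans_lt ?_
      change ENNReal.ofReal _ * _ < _
      rw [← ENNReal.ofReal_mul (by positivity)]
      refine (ENNReal.ofReal_lt_iff_lt_toReal (by positivity) (hfin _ (hG k).2.1)).2 ?_
      rwa [div_mul_cancel₀ _ hp1.ne']
  obtain ⟨N, hN⟩ := eventually_atTop.1 hκ
  set b : ℕ → ℝ≥0∞ := fun k => p + ENNReal.ofReal (1 / (((k + N : ℕ) : ℝ) + 1)) with hb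
  have hbfin : ∀ k, b k ≠ ⊤ := fun k => by simp [hb, hP]
  have hblim : Tendsto b atTop (𝓝 p) := by
    have h1 := (tendsto_add_atTop_iff_nat N).2 (tendsto_one_div_add_atTop_nhds_zero_nat (𝕜 := ℝ))
    have h2 := (ENNReal.tendsto_ofReal h1).const_add p
    rwa [ENNReal.ofReal_zero, add_zero] at h2
  choose g hgo hgc hgG hgd hgv using fun k => exists_large_component hC (hG (k + N)).1
    (hΩb.subset (hG (k + N)).2.1) (hbfin k) (hG (k + N)).2.2 (hN (k + N) (Nat.le_add_left _ _))
  have hgΩ : ∀ k, g k ⊆ Ω := fun k => (hgG k).trans (hG (k + N)).2.1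
  have hHΩ : ∀ k, convexHull ℝ (g k) ⊆ Ω := fun k => convexHull_min (hgΩ k) hΩ
  have hHo : ∀ k, IsOpen (convexHull ℝ (g k)) := fun k => (hgo k).convexHull
  have hDΩ : ∀ k, G (k + N) \ g k ⊆ Ω := fun k => sdiff_subset.trans (hG (k + N)).2.1
  have hsplit : ∀ k, anisoPerimeter φ (g k) + anisoPerimeter φ (G (k + N) \ g k) ≤ b k := by
    intro k
    have hne : g k ≠ G (k + N) \ g k := fun h => by
      obtain ⟨x, hx⟩ := (hgc k).nonempty
      exact (h ▸ hx : x ∈ G (k + N) \ g k).2 hx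
    have h1 := (hG (k + N)).2.2 {g k, G (k + N) \ g k} (by
      intro U hU
      rcases Finset.mem_insert.1 hU with rfl | hU
      · exact ⟨hgo k, hgG k, hgd k⟩
      · rw [Finset.mem_singleton.1 hU]
        exact ⟨hgd k, sdiff_subset, by rw [sdiff_sdiff_cancel_left (hgG k)]; exact hgo k⟩) (by
      rw [Finset.coe_pair]
      exact pairwise_pair.2 fun _ => ⟨disjoint_sdiff_right, disjoint_sdiff_left⟩)
    rwa [Finset.sum_pair hne] at h1
  have hHi := fun k => integrable_indicator_one (hHo k).measurableSet (hfin _ (hHΩ k))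
  have hDi := fun k => integrable_indicator_one (hgd k).measurableSet (hfin _ (hDΩ k))
  have hmass : ∀ ε : ℝ, 0 < ε → ∀ᶠ k in atTop,
      ∫ x, ((convexHull ℝ (g k)).indicator (1 : (Fin 2 → ℝ) → ℝ) x
        + (G (k + N) \ g k).indicator (1 : (Fin 2 → ℝ) → ℝ) x) < (volume E).toReal + ε := by
    intro ε hε
    refine hB.eventually_integral_lt hΩ hx₀ hm hP0 hP (fun k => (hHi k).add (hDi k)) ?_ ?_ ?_
      hblim hε
    · intro k x hx
      rw [Pi.add_apply, indicator_of_notMem (fun h => hx (hHΩ k h)),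
          indicator_of_notMem (fun h => hx (hDΩ k h)),
        add_zero]
    · intro k x
      obtain ⟨i, hi⟩ := exists_nat_indicator_one (convexHull ℝ (g k)) x
      obtain ⟨j, hj⟩ := exists_nat_indicator_one (G (k + N) \ g k) x
      exact ⟨i + j, by rw [Pi.add_apply, hi, hj]; push_cast; rfl⟩
    · intro k
      refine (anisoTV_add_le (hHi k) (hDi k)).trans (le_trans ?_ (hsplit k))
      exact add_le_add_left (anisoPerimeter_convexHull_le hφ (hgo k) (hgc k).isPreconnected
        (hΩb.subset (hgΩ k))) _
  have hdiff : Tendsto (fun k => volume (convexHull ℝ (g k) \ g k)) atTop (𝓝 0) := by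
    have hGvol' := (tendsto_add_atTop_iff_nat N).2 hGvol
    have h1 : ∀ k, (volume (convexHull ℝ (g k) \ g k)).toReal
        = (∫ x, ((convexHull ℝ (g k)).indicator (1 : (Fin 2 → ℝ) → ℝ) x
          + (G (k + N) \ g k).indicator (1 : (Fin 2 → ℝ) → ℝ) x))
            - (volume (G (k + N))).toReal := by
      intro k
      rw [integral_add (hHi k) (hDi k), integral_indicator_one' (hHo k).measurableSet,
        integral_indicator_one' (hgd k).measurableSet]
      have h2 := measureReal_sdiff_add_inter (μ := volume) (s := convexHull ℝ (g k))
        (hgo k).measurableSet (h := hfin _ (hHΩ k))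
      have h3 := measureReal_sdiff_add_inter (μ := volume) (s := G (k + N))
        (hgo k).measurableSet (h := hfin _ (hG (k + N)).2.1)
      rw [inter_eq_right.2 (subset_convexHull ℝ (g k))] at h2
      rw [inter_eq_right.2 (hgG k)] at h3
      simp only [measureReal_def] at h2 h3
      linarith
    rw [← ENNReal.tendsto_toReal_iff (fun k => hfin _ (sdiff_subset.trans (hHΩ k))) zero_ne_top,
      ENNReal.toReal_zero]
    refine tendsto_order.2 ⟨fun a ha => Eventually.of_forall fun k =>
      ha.trans_le ENNReal.toReal_nonneg, fun a ha => ?_⟩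
    filter_upwards [hmass (a / 2) (half_pos ha),
      hGvol'.eventually_const_lt (sub_lt_self _ (half_pos ha))] with k hk1 hk2
    rw [h1]
    linarith
  obtain ⟨A, σ, hσ, hAo, hA, hAΩ, hAlim⟩ := exists_convex_limit hΩo hΩb hΩ hHo
    (fun k => convex_convexHull ℝ _) hHΩ
  obtain ⟨τ, hτ, hτlim⟩ := exists_subseq_tendsto_indicator_zero (hdiff.comp hσ.tendsto_atTop)
  set ρ : ℕ → ℕ := σ ∘ τ with hρ
  have hρm : Tendsto ρ atTop atTop := hσ.tendsto_atTop.comp hτ.tendsto_atTop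
  have hglim : ∀ᵐ x, Tendsto (fun k => (g (ρ k)).indicator (1 : (Fin 2 → ℝ) → ℝ) x) atTop
      (𝓝 (A.indicator 1 x)) := by
    filter_upwards [hAlim, hτlim] with x h1 h2
    have h3 := (h1.comp hτ.tendsto_atTop).sub h2
    rw [sub_zero] at h3
    refine h3.congr fun k => ?_
    change (convexHull ℝ (g (ρ k))).indicator (1 : (Fin 2 → ℝ) → ℝ) x
      - (convexHull ℝ (g (ρ k)) \ g (ρ k)).indicator (1 : (Fin 2 → ℝ) → ℝ) x = _
    have hsub := subset_convexHull ℝ (g (ρ k))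
    by_cases h4 : x ∈ g (ρ k)
    · simp [h4, hsub h4]
    · by_cases h5 : x ∈ convexHull ℝ (g (ρ k)) <;> simp [h4, h5]
  have hDlim' : ∀ᵐ x, Tendsto (fun k => (G (ρ k + N) \ g (ρ k)).indicator
      (1 : (Fin 2 → ℝ) → ℝ) x) atTop (𝓝 (E.indicator 1 x - A.indicator 1 x)) := by
    filter_upwards [hglim, hGlim] with x h1 h2
    have h3 := ((h2.comp (tendsto_add_atTop_nat N)).comp hρm).sub h1
    refine h3.congr fun k => ?_
    change (G (ρ k + N)).indicator (1 : (Fin 2 → ℝ) → ℝ) x - _ = _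
    by_cases h4 : x ∈ g (ρ k)
    · simp [h4, hgG _ h4]
    · by_cases h5 : x ∈ G (ρ k + N) <;> simp [h4, h5]
  have hAE : ∀ᵐ x, x ∈ A → x ∈ E := by
    filter_upwards [hDlim'] with x hx hxA
    by_contra hxE
    have h1 := ge_of_tendsto' hx fun k => indicator_nonneg (fun _ _ => zero_le_one) _
    norm_num [hxA, hxE] at h1
  have hDlim : ∀ᵐ x, Tendsto (fun k => (G (ρ k + N) \ g (ρ k)).indicator
      (1 : (Fin 2 → ℝ) → ℝ) x) atTop (𝓝 ((E \ A).indicator 1 x)) := by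
    filter_upwards [hDlim', hAE] with x h1 h2
    convert h1 using 2
    by_cases h3 : x ∈ A
    · simp [h3, h2 h3]
    · by_cases h4 : x ∈ E <;> simp [h3, h4]
  refine ⟨A, hAo, hA, ?_, hAΩ, ?_, ?_⟩
  · by_contra hne
    rw [not_nonempty_iff_eq_empty] at hne
    have h1 := tendsto_volume_of_tendsto_indicator hΩo.measurableSet (hfin Ω subset_rfl)
      (fun k => (hgo (ρ k)).measurableSet) (fun k => hgΩ (ρ k)) hAo.measurableSet hglim
    rw [ENNReal.tendsto_toReal_iff (fun k => hfin _ (hgΩ _)) (hfin A hAΩ), hne,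
      measure_empty] at h1
    have h2 := ENNReal.Tendsto.const_mul (a := (C : ℝ≥0∞)) h1 (Or.inr ENNReal.coe_ne_top)
    rw [mul_zero] at h2
    have h3 := ge_of_tendsto' h2 fun k => (hgv (ρ k)).le
    simp [hκ0] at h3
  · rw [measure_eq_zero_iff_ae_notMem]
    filter_upwards [hAE] with x hx h
    exact h.2 (hx h.1)
  · have h1 := sum_anisoTV_le_of_tendsto (φ := φ) (Finset.univ : Finset Bool)
      (w := fun i k => bif i then (g (ρ k)).indicator 1 else (G (ρ k + N) \ g (ρ k)).indicator 1)
      (u := fun i => bif i then A.indicator 1 else (E \ A).indicator 1) 1 (b := fun k => b (ρ k))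
      (c := p) ?_ ?_ ?_ ?_ (hblim.comp hρm)
    · simpa [anisoPerimeter] using h1
    · rintro (_ | _) - k
      · exact (measurable_one.indicator (hgd _).measurableSet).aestronglyMeasurable
      · exact (measurable_one.indicator (hgo _).measurableSet).aestronglyMeasurable
    · have hle : ∀ (S : Set (Fin 2 → ℝ)) x, |S.indicator (1 : (Fin 2 → ℝ) → ℝ) x| ≤ 1 := by
        intro S x
        by_cases h : x ∈ S <;> simp [h]
      rintro (_ | _) - k
      · exact Eventually.of_forall fun x => hle _ x
      · exact Eventually.of_forall fun x => hle _ x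
    · rintro (_ | _) -
      · exact hDlim
      · exact hglim
    · intro k
      simpa [anisoPerimeter] using hsplit (ρ k)

end LargePiece

section Sliding

/-- Two disjoint compact convex planar sets can be swept one towards the other so that the moving
set stays in front of the fixed one. -/
lemma exists_sweep_direction {K L : Set (Fin 2 → ℝ)} (hK : IsCompact K) (hL : IsCompact L)
    (hKc : Convex ℝ K) (hLc : Convex ℝ L) (hKn : K.Nonempty) (hLn : L.Nonempty)
    (hd : Disjoint K L) :
    ∃ d : Fin 2 → ℝ, (∀ a ∈ K, ∃ t : ℝ, 0 ≤ t ∧ a + t • d ∈ L) ∨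
      ∀ b ∈ L, ∃ t : ℝ, 0 ≤ t ∧ b + t • d ∈ K := by
  obtain ⟨e, u, v, heK, huv, heL⟩ := geometric_hahn_banach_compact_closed hKc hK hLc hL.isClosed hd
  have hsep : ∀ a ∈ K, ∀ b ∈ L, e a < e b := fun a ha b hb =>
    (heK a ha).trans (huv.trans (heL b hb))
  have hex : ∀ w : Fin 2 → ℝ, e w = w 0 * e (Pi.single 0 1) + w 1 * e (Pi.single 1 1) := by
    intro w
    have h : w = w 0 • Pi.single 0 1 + w 1 • Pi.single 1 1 := by
      ext i
      fin_cases i <;> simp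
    conv_lhs => rw [h]
    simp
  set e₀ := e (Pi.single 0 1)
  set e₁ := e (Pi.single 1 1)
  have hne : 0 < e₀ ^ 2 + e₁ ^ 2 := by
    obtain ⟨a, ha⟩ := hKn
    obtain ⟨b, hb⟩ := hLn
    by_contra! h
    have h0 : e₀ = 0 := by nlinarith [sq_nonneg e₀, sq_nonneg e₁]
    have h1 : e₁ = 0 := by nlinarith [sq_nonneg e₀, sq_nonneg e₁]
    have h2 := hsep a ha b hb
    rw [hex a, hex b, h0, h1] at h2
    simp at h2
  let N : ℝ → (Fin 2 → ℝ) → ℝ := fun s w =>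
    (Real.cos s * e₀ - Real.sin s * e₁) * w 0 + (Real.cos s * e₁ + Real.sin s * e₀) * w 1
  have hNc : Continuous ↿N := by
    change Continuous fun q : ℝ × (Fin 2 → ℝ) => N q.1 q.2
    fun_prop
  have hNs : ∀ s, Continuous (N s) := fun s => by
    change Continuous fun w => N s w
    fun_prop
  have hF : Continuous fun s => sInf (N s '' K) - sInf (N s '' L) :=
    (hK.continuous_sInf hNc).sub (hL.continuous_sInf hNc)
  have hinf : ∀ s (S : Set (Fin 2 → ℝ)), IsCompact S → S.Nonempty →
      (∃ a ∈ S, N s a = sInf (N s '' S)) ∧ ∀ a ∈ S, sInf (N s '' S) ≤ N s a := by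
    intro s S hS hSn
    exact ⟨(hS.image (hNs s)).sInf_mem (hSn.image _), fun a ha =>
      csInf_le (hS.image (hNs s)).bddBelow (mem_image_of_mem _ ha)⟩
  obtain ⟨s, hs, hs0⟩ : ∃ s ∈ Ioo 0 Real.pi, sInf (N s '' K) - sInf (N s '' L) = 0 := by
    refine intermediate_value_Ioo Real.pi_pos.le hF.continuousOn ⟨?_, ?_⟩
    · obtain ⟨b, hb, hb'⟩ := (hinf 0 L hL hLn).1
      obtain ⟨a, ha⟩ := hKn
      have h1 := (hinf 0 K hK ⟨a, ha⟩).2 a ha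
      have h2 := hsep a ha b hb
      rw [hex a, hex b] at h2
      have h3 : ∀ w, N 0 w = w 0 * e₀ + w 1 * e₁ := fun w => by simp [N]; ring
      rw [h3] at hb' h1
      linarith
    · obtain ⟨a, ha, ha'⟩ := (hinf Real.pi K hK hKn).1
      obtain ⟨b, hb⟩ := hLn
      have h1 := (hinf Real.pi L hL ⟨b, hb⟩).2 b hb
      have h2 := hsep a ha b hb
      rw [hex a, hex b] at h2
      have h3 : ∀ w, N Real.pi w = -(w 0 * e₀ + w 1 * e₁) := fun w => by simp [N]; ring
      rw [h3] at ha' h1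
      linarith
  set n₀ := Real.cos s * e₀ - Real.sin s * e₁ with hn₀
  set n₁ := Real.cos s * e₁ + Real.sin s * e₀ with hn₁
  have hsin := Real.sin_pos_of_pos_of_lt_pi hs.1 hs.2
  have hdet : e₀ * n₁ - e₁ * n₀ = Real.sin s * (e₀ ^ 2 + e₁ ^ 2) := by
    rw [hn₀, hn₁]; ring
  have hdet0 : 0 < e₀ * n₁ - e₁ * n₀ := by rw [hdet]; positivity
  -- two points on a common level line differ by a positive multiple of the direction
  have hline : ∀ a ∈ K, ∀ b ∈ L, N s a = N s b →
      ∃ t : ℝ, 0 ≤ t ∧ b = a + t • ![n₁, -n₀] := by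
    intro a ha b hb hab
    have h2 := hsep a ha b hb
    rw [hex a, hex b] at h2
    have h3 : n₀ * a 0 + n₁ * a 1 = n₀ * b 0 + n₁ * b 1 := hab
    refine ⟨(e₀ * (b 0 - a 0) + e₁ * (b 1 - a 1)) / (e₀ * n₁ - e₁ * n₀),
      div_nonneg (by linarith) hdet0.le, ?_⟩
    ext i
    fin_cases i
    · simp only [Fin.zero_eta, Pi.add_apply, Pi.smul_apply, smul_eq_mul, Matrix.cons_val_zero]
      field_simp
      linear_combination e₁ * h3
    · simp only [Fin.mk_one, Pi.add_apply, Pi.smul_apply, smul_eq_mul, Matrix.cons_val_one,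
        Matrix.cons_val_fin_one]
      field_simp
      linear_combination (-e₀) * h3
  have hivt : ∀ S : Set (Fin 2 → ℝ), Convex ℝ S → ∀ x ∈ S, ∀ y ∈ S, ∀ c, N s x ≤ c → c ≤ N s y →
      ∃ z ∈ S, N s z = c := by
    intro S hS x hx y hy c h1 h2
    exact hS.isPreconnected.intermediate_value hx hy (hNs s).continuousOn ⟨h1, h2⟩
  obtain ⟨a₀, ha₀, ha₀'⟩ := (hinf s K hK hKn).1
  obtain ⟨b₀, hb₀, hb₀'⟩ := (hinf s L hL hLn).1
  obtain ⟨a₁, ha₁, ha₁'⟩ := hK.exists_isMaxOn hKn (hNs s).continuousOn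
  obtain ⟨b₁, hb₁, hb₁'⟩ := hL.exists_isMaxOn hLn (hNs s).continuousOn
  rcases le_total (N s a₁) (N s b₁) with h | h
  · refine ⟨![n₁, -n₀], Or.inl fun a ha => ?_⟩
    obtain ⟨b, hb, hab⟩ := hivt L hLc b₀ hb₀ b₁ hb₁ (N s a)
      (by linarith [(hinf s K hK hKn).2 a ha]) ((ha₁' ha).trans h)
    obtain ⟨t, ht, rfl⟩ := hline a ha b hb hab.symm
    exact ⟨t, ht, hb⟩
  · refine ⟨-![n₁, -n₀], Or.inr fun b hb => ?_⟩
    obtain ⟨a, ha, hab⟩ := hivt K hKc a₀ ha₀ a₁ ha₁ (N s b)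
      (by linarith [(hinf s L hL hLn).2 b hb]) ((hb₁' hb).trans h)
    obtain ⟨t, ht, rfl⟩ := hline a ha b hb hab
    refine ⟨t, ht, ?_⟩
    rwa [smul_neg, add_neg_cancel_right]

/-- Moving `A` along a sweep direction until its closure touches that of `B`. -/
lemma exists_translate_touching {n : ℕ} {Ω A B : Set (Fin n → ℝ)} (hΩo : IsOpen Ω) (hΩ : Convex ℝ Ω)
    (hAo : IsOpen A) (hBo : IsOpen B) (hAΩ : A ⊆ Ω) (hBΩ : B ⊆ Ω)
    (hAn : A.Nonempty) (hAb : Bornology.IsBounded A)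
    (hd : Disjoint A B) {d : Fin n → ℝ}
    (h : ∀ a ∈ closure A, ∃ t : ℝ, 0 ≤ t ∧ a + t • d ∈ closure B) :
    ∃ τ : Fin n → ℝ, {x | x - τ ∈ A} ⊆ Ω ∧ Disjoint {x | x - τ ∈ A} B ∧
      (closure {x | x - τ ∈ A} ∩ closure B).Nonempty := by
  set T : Set ℝ := {t | 0 ≤ t ∧ ∃ a ∈ closure A, a + t • d ∈ closure B} with hT
  have hTcl : IsClosed T := by
    have h1 : IsClosed {q : (Fin n → ℝ) × ℝ | q.1 ∈ closure A ∧ q.1 + q.2 • d ∈ closure B} :=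
      (isClosed_closure.preimage continuous_fst).inter
        (isClosed_closure.preimage (by fun_prop :
          Continuous fun q : (Fin n → ℝ) × ℝ => q.1 + q.2 • d))
    have h2 : T = Ici 0 ∩ {t | ∃ a ∈ closure A, a + t • d ∈ closure B} := rfl
    rw [h2]
    refine isClosed_Ici.inter (IsSeqClosed.isClosed fun t t₀ ht hlim => ?_)
    choose a ha hb using ht
    obtain ⟨a₀, ha₀, σ, hσ, hσl⟩ := hAb.isCompact_closure.tendsto_subseq ha
    exact ⟨a₀, ha₀, (isClosed_closure.mem_of_tendsto
      (hσl.add ((hlim.comp hσ.tendsto_atTop).smul_const d))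
        (Eventually.of_forall fun k => hb (σ k)))⟩
  obtain ⟨a₁, ha₁⟩ := hAn
  have hTn : T.Nonempty := by
    obtain ⟨t, ht, htb⟩ := h a₁ (subset_closure ha₁)
    exact ⟨t, ht, a₁, subset_closure ha₁, htb⟩
  have hTb : BddBelow T := ⟨0, fun t ht => ht.1⟩
  set t₀ := sInf T with ht₀
  obtain ⟨h0, a₀, ha₀, hb₀⟩ : t₀ ∈ T := hTcl.csInf_mem hTn hTb
  have hopen : IsOpen {x | x - t₀ • d ∈ A} := hAo.preimage (by fun_prop)
  refine ⟨t₀ • d, ?_, ?_, a₀ + t₀ • d, ?_, hb₀⟩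
  · have h1 : {x | x - t₀ • d ∈ A} ⊆ closure Ω := by
      intro x hx
      obtain ⟨t, ht, htb⟩ := h _ (subset_closure hx)
      have hle : t₀ ≤ t := csInf_le hTb ⟨ht, _, subset_closure hx, htb⟩
      rcases ht.eq_or_lt with rfl | htpos
      · have h3 : t₀ = 0 := le_antisymm hle h0
        have h4 : x ∈ A := by simpa [h3] using hx
        exact subset_closure (hAΩ h4)
      have h5 := hΩ.closure (subset_closure (hAΩ hx)) (closure_mono hBΩ htb)
        (sub_nonneg.2 ((div_le_one htpos).2 hle)) (div_nonneg h0 ht) (by ring)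
      convert h5 using 1
      rw [smul_add, ← add_assoc, ← add_smul, smul_smul, div_mul_cancel₀ _ htpos.ne', sub_add_cancel,
        one_smul, sub_add_cancel]
    intro x hx
    have h2 := interior_mono h1 (hopen.interior_eq.symm ▸ hx)
    rwa [hΩ.interior_closure_eq_interior_of_nonempty_interior
      (by rw [hΩo.interior_eq]; exact ⟨a₁, hAΩ ha₁⟩), hΩo.interior_eq] at h2
  · refine Set.disjoint_left.2 fun x hxA hxB => ?_
    rcases h0.eq_or_lt with h3 | hpos
    · have h4 : x ∈ A := by simpa [← h3] using hxA
      exact Set.disjoint_left.1 hd h4 hxB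
    · have h5 : Tendsto (fun s : ℝ => x - s • d) (𝓝[>] 0) (𝓝 x) := by
        have h6 : Continuous fun s : ℝ => x - s • d := by fun_prop
        simpa using (h6.tendsto 0).mono_left nhdsWithin_le_nhds
      obtain ⟨s, hs1, hs2, hs3⟩ := ((h5.eventually (hBo.mem_nhds hxB)).and
        (Ioo_mem_nhdsGT hpos)).exists
      refine (csInf_le hTb (?_ : t₀ - s ∈ T)).not_gt (sub_lt_self _ hs2)
      refine ⟨sub_nonneg.2 hs3.le, x - t₀ • d, subset_closure hxA, subset_closure ?_⟩
      have h8 : x - t₀ • d + (t₀ - s) • d = x - s • d := by rw [sub_smul]; abel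
      rw [h8]
      exact hs1
  · have h7 : Continuous fun x : Fin n → ℝ => x + t₀ • d := by fun_prop
    refine map_mem_closure (f := fun x : Fin n → ℝ => x + t₀ • d) h7 ha₀ fun x hx => ?_
    change x + t₀ • d - t₀ • d ∈ A
    rwa [add_sub_cancel_right]

end Sliding

section Merge

variable {φ : (Fin 2 → ℝ) → ℝ}

lemma closure_subset_dilate {n : ℕ} {A : Set (Fin n → ℝ)} (hAo : IsOpen A) (hA : Convex ℝ A)
    {a : Fin n → ℝ} (ha : a ∈ A) {t : ℝ} (ht : 1 < t) :
    closure A ⊆ {x | t⁻¹ • (x - (1 - t) • a) ∈ A} := by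
  intro x hx
  have ht0 : 0 < t := one_pos.trans ht
  have h1 := hA.combo_interior_closure_mem_interior (hAo.interior_eq.symm ▸ ha) hx
    (sub_pos.2 (inv_lt_one_of_one_lt₀ ht)) (inv_nonneg.2 ht0.le) (by ring)
  rw [hAo.interior_eq] at h1
  change t⁻¹ • (x - (1 - t) • a) ∈ A
  convert h1 using 1
  rw [smul_sub, smul_smul, add_comm, sub_eq_add_neg, ← neg_smul]
  congr 2
  field_simp
  ring

lemma dilate_subset_cthickening {n : ℕ} {A : Set (Fin n → ℝ)} {a : Fin n → ℝ} {M t : ℝ}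
    (hM : ∀ y ∈ A, ‖y - a‖ ≤ M) (ht : 1 ≤ t) :
    {x | t⁻¹ • (x - (1 - t) • a) ∈ A} ⊆ Metric.cthickening ((t - 1) * M) A := by
  intro x hx
  have ht0 : 0 < t := one_pos.trans_le ht
  refine Metric.mem_cthickening_of_dist_le x _ _ _ hx ?_
  set y := t⁻¹ • (x - (1 - t) • a) with hy
  have hxy : x = t • y + (1 - t) • a := by
    rw [hy, smul_inv_smul₀ ht0.ne', sub_add_cancel]
  have h1 : x - y = (t - 1) • (y - a) := by
    rw [hxy]; module
  rw [dist_eq_norm, h1, norm_smul, Real.norm_of_nonneg (sub_nonneg.2 ht)]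
  exact mul_le_mul_of_nonneg_left (hM y hx) (sub_nonneg.2 ht)

/-- The convex hull of two touching convex sets has at most their total perimeter. -/
lemma anisoPerimeter_convexHull_union_le (hφ : IsNorm φ) {A B : Set (Fin 2 → ℝ)} (hAo : IsOpen A)
    (hBo : IsOpen B) (hA : Convex ℝ A) (hB : Convex ℝ B) (hAn : A.Nonempty) (hBn : B.Nonempty)
    (hAb : Bornology.IsBounded A) (hBb : Bornology.IsBounded B)
    (h : (closure A ∩ closure B).Nonempty) :
    anisoPerimeter φ (convexHull ℝ (A ∪ B)) ≤ anisoPerimeter φ A + anisoPerimeter φ B := by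
  obtain ⟨z, hzA, hzB⟩ := h
  obtain ⟨a, ha⟩ := hAn
  obtain ⟨b, hb⟩ := hBn
  obtain ⟨MA, hMA⟩ := (hAb.sub (Bornology.isBounded_singleton (x := a))).exists_norm_le
  obtain ⟨MB, hMB⟩ := (hBb.sub (Bornology.isBounded_singleton (x := b))).exists_norm_le
  set M := max MA MB with hM
  have hMA' : ∀ y ∈ A, ‖y - a‖ ≤ M := fun y hy =>
    (hMA _ (sub_mem_sub hy rfl)).trans (le_max_left _ _)
  have hMB' : ∀ y ∈ B, ‖y - b‖ ≤ M := fun y hy =>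
    (hMB _ (sub_mem_sub hy rfl)).trans (le_max_right _ _)
  set C := convexHull ℝ (A ∪ B) with hCdef
  have hC : Convex ℝ C := convex_convexHull ℝ _
  have hAC : A ⊆ C := subset_union_left.trans (subset_convexHull ℝ _)
  have hBC : B ⊆ C := subset_union_right.trans (subset_convexHull ℝ _)
  set D : Set (Fin 2 → ℝ) → (Fin 2 → ℝ) → ℝ → Set (Fin 2 → ℝ) :=
    fun S s t => {x | t⁻¹ • (x - (1 - t) • s) ∈ S} with hD
  have hDo : ∀ S s t, IsOpen S → IsOpen (D S s t) := fun S s t hS =>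
    hS.preimage (by fun_prop : Continuous fun x : Fin 2 → ℝ => t⁻¹ • (x - (1 - t) • s))
  have hDc : ∀ S s t, Convex ℝ S → Convex ℝ (D S s t) := by
    intro S s t hS x hx y hy α β hα hβ hαβ
    have h1 := hS hx hy hα hβ hαβ
    change t⁻¹ • (α • x + β • y - (1 - t) • s) ∈ S
    convert h1 using 1
    have h2 : (1 - t) • s = α • ((1 - t) • s) + β • ((1 - t) • s) := by
      rw [← add_smul, hαβ, one_smul]
    conv_lhs => rw [h2]
    module
  have hDP : ∀ S s t, 0 < t → anisoPerimeter φ (D S s t) ≤ ENNReal.ofReal t * anisoPerimeter φ S :=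
    fun S s t ht => anisoTV_dilate_le (φ := φ) (S.indicator 1) ht ((1 - t) • s)
  set t : ℕ → ℝ := fun k => 1 + 1 / ((k : ℝ) + 1) with ht
  have ht1 : ∀ k, 1 < t k := fun k => lt_add_of_pos_right _ (by positivity)
  have htlim : Tendsto t atTop (𝓝 1) := by
    have h := (tendsto_one_div_add_atTop_nhds_zero_nat (𝕜 := ℝ)).const_add 1
    rwa [add_zero] at h
  set F : ℕ → Set (Fin 2 → ℝ) := fun k => D A a (t k) ∪ D B b (t k) with hF
  have hFo : ∀ k, IsOpen (F k) := fun k => (hDo _ _ _ hAo).union (hDo _ _ _ hBo)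
  have hFc : ∀ k, IsPreconnected (F k) := fun k =>
    (hDc A a (t k) hA).isPreconnected.union z (closure_subset_dilate hAo hA ha (ht1 k) hzA)
      (closure_subset_dilate hBo hB hb (ht1 k) hzB) (hDc B b (t k) hB).isPreconnected
  have hFsub : ∀ k, F k ⊆ Metric.cthickening ((t k - 1) * M) C := fun k => union_subset
    ((dilate_subset_cthickening hMA' (ht1 k).le).trans (Metric.cthickening_subset_of_subset _ hAC))
    ((dilate_subset_cthickening hMB' (ht1 k).le).trans (Metric.cthickening_subset_of_subset _ hBC))
  have hCb : Bornology.IsBounded C := isBounded_convexHull.2 (hAb.union hBb)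
  have hFb : ∀ k, Bornology.IsBounded (F k) := fun k => hCb.cthickening.subset (hFsub k)
  have hle : ∀ k, anisoPerimeter φ (convexHull ℝ (F k))
      ≤ ENNReal.ofReal (t k) * (anisoPerimeter φ A + anisoPerimeter φ B) := by
    intro k
    have ht0 := one_pos.trans (ht1 k)
    refine (anisoPerimeter_convexHull_le hφ (hFo k) (hFc k) (hFb k)).trans ?_
    refine (anisoPerimeter_union_le hφ (hDo _ _ _ hAo).measurableSet (hDo _ _ _ hBo).measurableSet
      ((hFb k).subset subset_union_left).measure_lt_top.ne
      ((hFb k).subset subset_union_right).measure_lt_top.ne).trans ?_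
    rw [mul_add]
    exact add_le_add (hDP A a _ ht0) (hDP B b _ ht0)
  have hblim : Tendsto (fun k => ENNReal.ofReal (t k) * (anisoPerimeter φ A + anisoPerimeter φ B))
      atTop (𝓝 (anisoPerimeter φ A + anisoPerimeter φ B)) := by
    have h1 := ENNReal.Tendsto.mul_const (b := anisoPerimeter φ A + anisoPerimeter φ B)
      (ENNReal.tendsto_ofReal htlim) (Or.inl (by simp))
    simpa using h1
  refine anisoTV_le_of_tendsto (w := fun k => (convexHull ℝ (F k)).indicator 1) 1
    (fun k => (measurable_one.indicator (hFo k).convexHull.measurableSet).aestronglyMeasurable)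
    (fun k => Eventually.of_forall fun x => ?_) ?_ hle hblim
  · by_cases h : x ∈ convexHull ℝ (F k) <;> simp [h]
  · filter_upwards [measure_eq_zero_iff_ae_notMem.1 (hC.addHaar_frontier volume)] with x hx
    refine tendsto_const_nhds.congr' ?_
    by_cases hxC : x ∈ C
    · refine Eventually.of_forall fun k => ?_
      have h1 : C ⊆ convexHull ℝ (F k) := convexHull_mono (union_subset_union
        (subset_closure.trans (closure_subset_dilate hAo hA ha (ht1 k)))
        (subset_closure.trans (closure_subset_dilate hBo hB hb (ht1 k))))
      simp [hxC, h1 hxC]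
    · have hxcl : x ∉ closure C := fun h => hx ⟨h, fun h' => hxC (interior_subset h')⟩
      have hpos : 0 < Metric.infEDist x C := by
        rw [pos_iff_ne_zero]
        exact fun h => hxcl (Metric.mem_closure_iff_infEDist_zero.2 h)
      have hlim : Tendsto (fun k => ENNReal.ofReal ((t k - 1) * M)) atTop (𝓝 0) := by
        have h1 := ENNReal.tendsto_ofReal ((htlim.sub_const 1).mul_const M)
        simpa using h1
      filter_upwards [hlim.eventually_lt_const hpos] with k hk
      have h1 : x ∉ convexHull ℝ (F k) := fun h =>
        ((convexHull_min (hFsub k) (hC.cthickening _)) h : _ ≤ _).not_gt hk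
      simp [hxC, h1]

/-- Two disjoint convex sets can be moved so that their convex hull does not cost more
perimeter. -/
lemma exists_merge (hφ : IsNorm φ) {Ω A B : Set (Fin 2 → ℝ)} (hΩo : IsOpen Ω) (hΩ : Convex ℝ Ω)
    (hΩb : Bornology.IsBounded Ω) (hAo : IsOpen A) (hBo : IsOpen B) (hA : Convex ℝ A)
    (hB : Convex ℝ B) (hAn : A.Nonempty) (hBn : B.Nonempty) (hAΩ : A ⊆ Ω) (hBΩ : B ⊆ Ω)
    (hd : Disjoint A B) :
    ∃ A' B' : Set (Fin 2 → ℝ), IsOpen A' ∧ IsOpen B' ∧ Convex ℝ A' ∧ A'.Nonempty ∧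
      B'.Nonempty ∧ A' ⊆ Ω ∧ B' ⊆ Ω ∧ Disjoint A' B' ∧ volume A' = volume A ∧
      volume B' = volume B ∧ anisoPerimeter φ A' ≤ anisoPerimeter φ A ∧
      anisoPerimeter φ B' ≤ anisoPerimeter φ B ∧
      anisoPerimeter φ (convexHull ℝ (A' ∪ B')) ≤ anisoPerimeter φ A + anisoPerimeter φ B := by
  have hAb := hΩb.subset hAΩ
  have hBb := hΩb.subset hBΩ
  have hvol : ∀ (S : Set (Fin 2 → ℝ)) τ, volume {x | x - τ ∈ S} = volume S := fun S τ => by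
    simp only [sub_eq_add_neg]
    exact measure_preimage_add_right volume (-τ) S
  have hper : ∀ (S : Set (Fin 2 → ℝ)) τ,
      anisoPerimeter φ {x | x - τ ∈ S} ≤ anisoPerimeter φ S := fun S τ => by
    have h1 := anisoTV_dilate_le (φ := φ) (S.indicator 1) one_pos τ
    rw [ENNReal.ofReal_one, one_mul] at h1
    simp only [inv_one, one_smul] at h1
    exact h1
  have hopen : ∀ (S : Set (Fin 2 → ℝ)) τ, IsOpen S → IsOpen {x | x - τ ∈ S} := fun S τ hS =>
    hS.preimage (continuous_id.sub continuous_const)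
  have hconv : ∀ (S : Set (Fin 2 → ℝ)) τ, Convex ℝ S → Convex ℝ {x | x - τ ∈ S} := fun S τ hS => by
    simp only [sub_eq_add_neg]
    exact hS.translate_preimage_left (-τ)
  have hne : ∀ (S : Set (Fin 2 → ℝ)) τ, S.Nonempty → {x | x - τ ∈ S}.Nonempty := by
    rintro S τ ⟨x, hx⟩
    exact ⟨x + τ, by simpa using hx⟩
  have key : (∃ τ : Fin 2 → ℝ, {x | x - τ ∈ A} ⊆ Ω ∧ Disjoint {x | x - τ ∈ A} B ∧
      (closure {x | x - τ ∈ A} ∩ closure B).Nonempty) ∨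
      ∃ τ : Fin 2 → ℝ, {x | x - τ ∈ B} ⊆ Ω ∧ Disjoint {x | x - τ ∈ B} A ∧
      (closure {x | x - τ ∈ B} ∩ closure A).Nonempty := by
    by_cases hcl : Disjoint (closure A) (closure B)
    · obtain ⟨d, h | h⟩ := exists_sweep_direction hAb.isCompact_closure hBb.isCompact_closure
        hA.closure hB.closure hAn.closure hBn.closure hcl
      · exact Or.inl (exists_translate_touching hΩo hΩ hAo hBo hAΩ hBΩ hAn hAb hd h)
      · exact Or.inr (exists_translate_touching hΩo hΩ hBo hAo hBΩ hAΩ hBn hBb hd.symm h)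
    · exact Or.inl ⟨0, by simpa using hAΩ, by simpa using hd,
        by simpa using not_disjoint_iff_nonempty_inter.1 hcl⟩
  rcases key with ⟨τ, h1, h2, h3⟩ | ⟨τ, h1, h2, h3⟩
  · exact ⟨_, B, hopen A τ hAo, hBo, hconv A τ hA, hne A τ hAn, hBn, h1, hBΩ, h2, hvol A τ,
      rfl, hper A τ, le_rfl, (anisoPerimeter_convexHull_union_le hφ (hopen A τ hAo) hBo
        (hconv A τ hA) hB (hne A τ hAn) hBn (hΩb.subset h1) hBb h3).trans
        (add_le_add_left (hper A τ) _)⟩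
  · refine ⟨A, _, hAo, hopen B τ hBo, hA, hAn, hne B τ hBn, hAΩ, h1, h2.symm, rfl, hvol B τ,
      le_rfl, hper B τ, (anisoPerimeter_convexHull_union_le hφ hAo (hopen B τ hBo)
        hA (hconv B τ hB) hAn (hne B τ hBn) hAb (hΩb.subset h1) ?_).trans
        (add_le_add_right (hper B τ) _)⟩
    rwa [inter_comm]

end Merge

section ChordStrictness

/-- If a set of finite measure contains a ball but misses a translate of it, then some bump function
has positive flux through the set in the translation direction. -/
lemma exists_bump_integral_fderiv_pos {n : ℕ} {A : Set (Fin n → ℝ)}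
    (hAf : volume A ≠ ⊤) {a b : Fin n → ℝ} {ε : ℝ} (hε : 0 < ε) (ha : Metric.ball a ε ⊆ A)
    (hb : Disjoint (Metric.ball b ε) A) :
    ∃ ψ : (Fin n → ℝ) → ℝ, ContDiff ℝ 1 ψ ∧ (∀ x, 0 ≤ ψ x) ∧ (∀ x, ψ x ≤ 1) ∧
      (∃ c ∈ segment ℝ a b, tsupport ψ ⊆ Metric.closedBall c (ε / 2)) ∧
      0 < ∫ x in A, fderiv ℝ (fun y => ψ y * ψ y) x (b - a) := by
  let ψ₀ : ContDiffBump b := ⟨ε / 4, ε / 2, by linarith, by linarith⟩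
  set q := b - a with hq
  set f : (Fin n → ℝ) → ℝ := fun x => ψ₀ x * ψ₀ x with hf
  have hψ₀ : ContDiff ℝ 1 ψ₀ := ψ₀.contDiff
  have hfc : ContDiff ℝ 1 f := hψ₀.mul hψ₀
  have hfs : HasCompactSupport f := ψ₀.hasCompactSupport.mul_right
  have hfd : Continuous (fderiv ℝ f) := hfc.continuous_fderiv one_ne_zero
  obtain ⟨M, hM⟩ := hfd.bounded_above_of_compact_support (hfs.fderiv (𝕜 := ℝ))
  obtain ⟨N, hN⟩ := hfc.continuous.bounded_above_of_compact_support hfs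
  have hInt : ∀ (g : (Fin n → ℝ) → ℝ) (K : ℝ), Continuous g → (∀ x, ‖g x‖ ≤ K) →
      IntegrableOn g A := fun g K hg hK =>
    Integrable.mono' (integrableOn_const (C := K) hAf) hg.aestronglyMeasurable
      (Eventually.of_forall hK)
  have hder : ∀ s : ℝ, HasDerivAt (fun s : ℝ => ∫ x in A, f (x + s • q))
      (∫ x in A, fderiv ℝ f (x + s • q) q) s := by
    intro s
    refine (hasDerivAt_integral_of_dominated_loc_of_deriv_le
      (F := fun (s : ℝ) x => f (x + s • q)) (F' := fun s x => fderiv ℝ f (x + s • q) q)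
      (bound := fun _ => M * ‖q‖) univ_mem
      (Eventually.of_forall fun t => ?_) ?_ ?_ ?_ (integrableOn_const hAf) ?_).2
    · exact (hfc.continuous.comp (by fun_prop)).aestronglyMeasurable
    · exact hInt _ N (hfc.continuous.comp (by fun_prop)) fun x => hN _
    · exact ((hfd.comp (by fun_prop : Continuous fun x : Fin n → ℝ => x + s • q)).clm_apply
        continuous_const).aestronglyMeasurable
    · exact Eventually.of_forall fun x t _ => (ContinuousLinearMap.le_opNorm _ _).trans
        (mul_le_mul_of_nonneg_right (hM _) (norm_nonneg _))
    · refine Eventually.of_forall fun x t _ => ?_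
      have h1 : HasDerivAt (fun t : ℝ => x + t • q) q t := by
        simpa using ((hasDerivAt_id t).smul_const q).const_add x
      exact ((hfc.differentiable one_ne_zero _).hasFDerivAt).comp_hasDerivAt t h1
  obtain ⟨c, hc, hcs⟩ := exists_hasDerivAt_eq_slope (fun s : ℝ => ∫ x in A, f (x + s • q)) _
    one_pos (fun s _ => (hder s).continuousAt.continuousWithinAt) fun s _ => hder s
  have h0 : ∫ x in A, f (x + (0 : ℝ) • q) = 0 := by
    refine setIntegral_eq_zero_of_forall_eq_zero fun x hx => ?_
    have h1 : ψ₀ x = 0 := ψ₀.zero_of_le_dist (not_lt.1 fun h => disjoint_left.1 hb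
      (Metric.ball_subset_ball (by change ε / 2 ≤ ε; linarith) h) hx)
    simp [hf, h1]
  have h1 : 0 < ∫ x in A, f (x + (1 : ℝ) • q) := by
    have hfn : ∀ x, 0 ≤ f x := fun x => mul_self_nonneg _
    refine lt_of_lt_of_le ?_ (setIntegral_mono_set
      (hInt _ N (hfc.continuous.comp (by fun_prop)) fun x => hN _)
      (Eventually.of_forall fun x => hfn _)
      (Metric.ball_subset_ball (by linarith : ε / 4 ≤ ε) |>.trans ha).eventuallyLE)
    have h2 : ∀ x ∈ Metric.ball a (ε / 4), f (x + (1 : ℝ) • q) = 1 := by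
      intro x hx
      have h3 : ψ₀ (x + (1 : ℝ) • q) = 1 := by
        refine ψ₀.one_of_mem_closedBall ?_
        rw [Metric.mem_closedBall, dist_eq_norm]
        rw [Metric.mem_ball, dist_eq_norm] at hx
        have h4 : x + (1 : ℝ) • q - b = x - a := by
          rw [hq, one_smul]
          abel
        rw [h4]
        exact hx.le
      simp only [hf, h3, mul_one]
    rw [setIntegral_congr_fun Metric.isOpen_ball.measurableSet h2]
    simp only [integral_const, smul_eq_mul, mul_one]
    exact ENNReal.toReal_pos (by simpa using (Metric.measure_ball_pos volume a (by linarith)).ne')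
      (by simpa using measure_ball_lt_top.ne)
  refine ⟨fun x => ψ₀ (x + c • q), hψ₀.comp (by fun_prop), fun x => ψ₀.nonneg, fun x => ψ₀.le_one,
    ⟨b - c • q, ?_, ?_⟩, ?_⟩
  · refine ⟨c, 1 - c, hc.1.le, by linarith [hc.2], by ring, ?_⟩
    rw [hq]
    module
  · refine closure_minimal (fun x hx => ?_) Metric.isClosed_closedBall
    have h2 : x + c • q ∈ Function.support ψ₀ := hx
    rw [ψ₀.support_eq, Metric.mem_ball, dist_eq_norm] at h2
    rw [Metric.mem_closedBall, dist_eq_norm]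
    have h3 : x - (b - c • q) = x + c • q - b := by abel
    rw [h3]
    exact h2.le
  · have h2 : ∀ x, fderiv ℝ (fun y => ψ₀ (y + c • q) * ψ₀ (y + c • q)) x q
        = fderiv ℝ f (x + c • q) q := fun x => by
      rw [← fderiv_comp_add_right]
    simp only [h2]
    rw [hcs, h0]
    simpa using h1

variable {n : ℕ} {φ : (Fin n → ℝ) → ℝ}

/-- Splitting a connected open set into two nonempty open pieces strictly increases perimeter. -/
lemma anisoPerimeter_add_pos_le_of_split (hφ : IsNorm φ) {A B C : Set (Fin n → ℝ)} (hAo : IsOpen A)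
    (hBo : IsOpen B) (hCo : IsOpen C) (hC : IsPreconnected C) (hAn : A.Nonempty)
    (hBn : B.Nonempty) (hd : Disjoint A B) (hAC : A ⊆ C) (hBC : B ⊆ C) (hCf : volume C ≠ ⊤)
    (h0 : volume (C \ (A ∪ B)) = 0) :
    ∃ κ : ℝ≥0∞, κ ≠ 0 ∧ anisoPerimeter φ C + κ ≤ anisoPerimeter φ A + anisoPerimeter φ B := by
  have hAf : volume A ≠ ⊤ := (lt_of_le_of_lt (measure_mono hAC) hCf.lt_top).ne
  obtain ⟨z, hzC, hzA, hzB⟩ : (C ∩ (closure A ∩ closure B)).Nonempty := by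
    refine isPreconnected_closed_iff.1 hC _ _ isClosed_closure isClosed_closure (fun x hx => ?_)
      (hAn.mono fun x hx => ⟨hAC hx, subset_closure hx⟩)
      (hBn.mono fun x hx => ⟨hBC hx, subset_closure hx⟩)
    rw [← closure_union]
    by_contra hcl
    have h1 : C ∩ (closure (A ∪ B))ᶜ ⊆ C \ (A ∪ B) := fun y hy => ⟨hy.1, fun h =>
      hy.2 (subset_closure h)⟩
    exact (hCo.inter isClosed_closure.isOpen_compl).measure_ne_zero volume ⟨x, hx, hcl⟩
      (measure_mono_null h1 h0)
  obtain ⟨r, hr, hrC⟩ := Metric.isOpen_iff.1 hCo z hzC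
  obtain ⟨a, haA, haz⟩ := Metric.mem_closure_iff.1 hzA (r / 2) (half_pos hr)
  obtain ⟨b, hbB, hbz⟩ := Metric.mem_closure_iff.1 hzB (r / 2) (half_pos hr)
  obtain ⟨εa, hεa, hεaA⟩ := Metric.isOpen_iff.1 hAo a haA
  obtain ⟨εb, hεb, hεbB⟩ := Metric.isOpen_iff.1 hBo b hbB
  set ε := min (min εa εb) (r / 2) with hε
  have hε0 : 0 < ε := lt_min (lt_min hεa hεb) (half_pos hr)
  obtain ⟨ψ, hψ, hψ0, hψ1, ⟨c, hc, hcs⟩, hpos⟩ := exists_bump_integral_fderiv_pos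
    hAf hε0 ((Metric.ball_subset_ball ((min_le_left _ _).trans (min_le_left _ _))).trans hεaA)
    (hd.symm.mono_left ((Metric.ball_subset_ball
      ((min_le_left _ _).trans (min_le_right _ _))).trans hεbB))
  have hψC : tsupport ψ ⊆ C := by
    refine hcs.trans (Subset.trans (fun x hx => ?_) hrC)
    have h1 : c ∈ Metric.ball z (r / 2) := (convex_ball z (r / 2)).segment_subset
      (by rwa [Metric.mem_ball, dist_comm]) (by rwa [Metric.mem_ball, dist_comm]) hc
    rw [Metric.mem_ball] at h1 ⊢
    rw [Metric.mem_closedBall] at hx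
    have h2 : ε ≤ r / 2 := min_le_right _ _
    linarith [dist_triangle x c z]
  have hψs : HasCompactSupport ψ :=
    (ProperSpace.isCompact_closedBall c (ε / 2)).of_isClosed_subset (isClosed_tsupport ψ) hcs
  set q := b - a with hq
  set t := (φ q + 1)⁻¹ with ht
  have hφq : 0 < φ q + 1 := by linarith [hφ.nonneg q]
  have ht0 : 0 < t := inv_pos.2 hφq
  have htest : ∀ s : ℝ, |s| ≤ t → IsTestField φ fun x => ψ x • (s • q) := by
    intro s hs
    refine ⟨hψ.smul contDiff_const, hψs.smul_right, fun x => ?_⟩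
    rw [hφ.smul_eq, hφ.smul_eq, abs_of_nonneg (hψ0 x)]
    have h1 : |s| * φ q ≤ 1 := by
      refine (mul_le_mul_of_nonneg_right hs (hφ.nonneg q)).trans ?_
      rw [ht, inv_mul_le_iff₀ hφq]
      linarith
    exact mul_le_one₀ (hψ1 x) (mul_nonneg (abs_nonneg _) (hφ.nonneg _)) h1
  set J := ∫ x in A, fderiv ℝ (fun y => ψ y * ψ y) x q with hJ
  have hψ2 : ContDiff ℝ 1 fun y => ψ y * ψ y := hψ.mul hψ
  have hψ2s : HasCompactSupport fun y => ψ y * ψ y := hψs.mul_right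
  have hg : Continuous fun x => fderiv ℝ (fun y => ψ y * ψ y) x q :=
    (hψ2.continuous_fderiv one_ne_zero).clm_apply continuous_const
  have hgi : Integrable fun x => fderiv ℝ (fun y => ψ y * ψ y) x q :=
    hg.integrable_of_hasCompactSupport
      (hψ2s.fderiv_apply (𝕜 := ℝ) q)
  have hsplit : ∀ g : (Fin n → ℝ) → ℝ, Integrable g →
      ∫ x in C, g x = (∫ x in A, g x) + ∫ x in B, g x := by
    intro g hgint
    rw [← setIntegral_union hd hBo.measurableSet hgint.integrableOn hgint.integrableOn]
    refine setIntegral_congr_set ?_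
    exact (ae_eq_set.2 ⟨h0, by rw [sdiff_eq_empty.2 (union_subset hAC hBC), measure_empty]⟩)
  have hzero : ∀ ξ : (Fin n → ℝ) → (Fin n → ℝ), ContDiff ℝ 1 ξ → HasCompactSupport ξ →
      tsupport ξ ⊆ C → ∫ x in C, diverg ξ x = 0 := by
    intro ξ h1 h2 h3
    rw [setIntegral_eq_integral_of_forall_compl_eq_zero, integral_diverg_eq_zero h1 h2]
    intro x hx
    by_contra h
    exact hx (h3 (support_diverg_subset h))
  have hmain : ∀ η, IsTestField φ η → (∫ x in C, diverg η x) + 2 * (t * J)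
      = (∫ x in A, diverg (fun x => η x + ψ x • (ψ x • (t • q) - η x)) x)
        + ∫ x in B, diverg (fun x => η x + ψ x • (ψ x • ((-t) • q) - η x)) x := by
    intro η hη
    have hξ : ContDiff ℝ 1 fun x => ψ x • η x := contDiff_smul_field hψ hη.1
    have hξs : HasCompactSupport fun x => ψ x • η x := hasCompactSupport_smul_field ψ hη.2.1
    have hξi : Integrable (diverg fun x => ψ x • η x) :=
      (diverg_continuous hξ).integrable_of_hasCompactSupport (diverg_hasCompactSupport hξs)
    have hdiv : ∀ (s : ℝ) x, diverg (fun x => η x + ψ x • (ψ x • (s • q) - η x)) x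
        = diverg η x - diverg (fun x => ψ x • η x) x
          + s * fderiv ℝ (fun y => ψ y * ψ y) x q := by
      intro s x
      have h1 : (fun x => η x + ψ x • (ψ x • (s • q) - η x))
          = fun x => η x + (-(ψ x • η x) + (ψ x * ψ x) • (s • q)) := by
        funext y
        rw [smul_sub, smul_smul]
        abel
      have hd1 : DifferentiableAt ℝ η x := hη.1.differentiable one_ne_zero x
      have hd2 : DifferentiableAt ℝ (fun x => ψ x • η x) x := hξ.differentiable one_ne_zero x
      have hd3 : DifferentiableAt ℝ (fun x => ψ x * ψ x) x := hψ2.differentiable one_ne_zero x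
      have hd4 : DifferentiableAt ℝ (fun x => -(ψ x • η x)) x := hd2.neg
      have hd5 : DifferentiableAt ℝ (fun x => (ψ x * ψ x) • (s • q)) x := hd3.smul_const _
      have hd6 : DifferentiableAt ℝ (fun x => -(ψ x • η x) + (ψ x * ψ x) • (s • q)) x :=
        hd4.add hd5
      rw [h1, diverg_add hd1 hd6, diverg_add hd4 hd5, diverg_neg,
        diverg_smul hd3 (differentiableAt_const _), diverg_const, map_smul, smul_eq_mul]
      ring
    simp only [hdiv]
    have hηi := hη.integrable_diverg
    have hInt : ∀ (S : Set (Fin n → ℝ)) (s : ℝ),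
        ∫ x in S, (diverg η x - diverg (fun x => ψ x • η x) x
          + s * fderiv ℝ (fun y => ψ y * ψ y) x q)
        = (∫ x in S, diverg η x) - (∫ x in S, diverg (fun x => ψ x • η x) x)
          + s * ∫ x in S, fderiv ℝ (fun y => ψ y * ψ y) x q := by
      intro S s
      have h1 : IntegrableOn (fun x => diverg η x - diverg (fun x => ψ x • η x) x) S :=
        (hηi.sub hξi).integrableOn
      rw [integral_add h1 (hgi.const_mul s).integrableOn,
        integral_sub hηi.integrableOn hξi.integrableOn, integral_const_mul]
    rw [hInt, hInt, hsplit _ hηi]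
    have hz1 := hzero _ hξ hξs ((tsupport_smul_subset_left ψ η).trans hψC)
    rw [hsplit _ hξi] at hz1
    have hz2 : ∫ x in C, fderiv ℝ (fun y => ψ y * ψ y) x q = 0 := by
      have h1 := hzero (fun x => (ψ x * ψ x) • q) (hψ2.smul contDiff_const) hψ2s.smul_right
        ((tsupport_smul_subset_left (fun x => ψ x * ψ x) (fun _ => q)).trans
          ((tsupport_mul_subset_left (f := ψ) (g := ψ)).trans hψC))
      rw [← h1]
      refine integral_congr_ae (Eventually.of_forall fun x => ?_)
      simp only
      rw [diverg_smul (hψ2.differentiable one_ne_zero x) (differentiableAt_const _), diverg_const,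
        mul_zero, zero_add]
    rw [hsplit _ hgi] at hz2
    rw [← hJ] at hz2 ⊢
    linear_combination t * hz2 + hz1
  have hκ : 0 < 2 * (t * J) := by positivity
  have hkey : ∀ η, IsTestField φ η →
      ENNReal.ofReal ((∫ x in C, diverg η x) + 2 * (t * J))
        ≤ anisoPerimeter φ A + anisoPerimeter φ B := by
    intro η hη
    have h1 := le_anisoTV (hφ.isTestField_combo hψ hψ0 hψ1 hη
      (htest t (abs_of_pos ht0).le)) (A.indicator 1)
    have h2 := le_anisoTV (hφ.isTestField_combo hψ hψ0 hψ1 hη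
      (htest (-t) (by rw [abs_neg, abs_of_pos ht0]))) (B.indicator 1)
    rw [integral_indicator_one_mul hAo.measurableSet] at h1
    rw [integral_indicator_one_mul hBo.measurableSet] at h2
    rw [hmain η hη]
    exact ENNReal.ofReal_add_le.trans (add_le_add h1 h2)
  have hκle : ENNReal.ofReal (2 * (t * J)) ≤ anisoPerimeter φ A + anisoPerimeter φ B := by
    simpa [diverg_const] using hkey _ hφ.isTestField_zero
  refine ⟨ENNReal.ofReal (2 * (t * J)), by simpa using hκ, ?_⟩
  refine (add_le_add_left (anisoTV_le (c := anisoPerimeter φ A + anisoPerimeter φ B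
    - ENNReal.ofReal (2 * (t * J))) fun η hη => ?_) _).trans (tsub_add_cancel_of_le hκle).le
  rw [integral_indicator_one_mul hCo.measurableSet]
  refine ENNReal.le_sub_of_add_le_right ENNReal.ofReal_ne_top ?_
  rcases le_total 0 (∫ x in C, diverg η x) with h | h
  · rw [← ENNReal.ofReal_add h hκ.le]
    exact hkey η hη
  · rw [ENNReal.ofReal_of_nonpos h, zero_add]
    exact hκle

end ChordStrictness

section ConvexMinimizer

lemma toReal_volume_eq_diff_add {n : ℕ} {A E : Set (Fin n → ℝ)} (hA : MeasurableSet A)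
    (hE : volume E ≠ ⊤) (hAE : volume (A \ E) = 0) :
    (volume E).toReal = (volume (E \ A)).toReal + (volume A).toReal := by
  have h1 : volume (E ∩ A) = volume A := by
    refine measure_congr (ae_eq_set.2 ⟨?_, ?_⟩)
    · rw [sdiff_eq_empty.2 inter_subset_right, measure_empty]
    · rwa [sdiff_inter_self_eq_sdiff]
  rw [← h1, ← ENNReal.toReal_add (measure_ne_top_of_subset sdiff_subset hE)
    (measure_ne_top_of_subset inter_subset_left hE), measure_sdiff_add_inter _ hA]

/-- A set satisfying the mass bound with equality is convex up to a null set. -/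
lemma MassBound.exists_convex_ae_eq {φ : (Fin 2 → ℝ) → ℝ} (hφ : IsNorm φ) {Ω E : Set (Fin 2 → ℝ)}
    (hΩo : IsOpen Ω) (hΩb : Bornology.IsBounded Ω) (hΩ : Convex ℝ Ω) (hEΩ : E ⊆ Ω)
    (hEm : MeasurableSet E) (hP : anisoPerimeter φ E ≠ ⊤)
    (hB : MassBound φ Ω (volume E).toReal (anisoPerimeter φ E)) :
    ∃ A, IsOpen A ∧ Convex ℝ A ∧ A ⊆ Ω ∧ E =ᵐ[volume] A := by
  have hfin : ∀ S ⊆ Ω, volume S ≠ ⊤ := fun S hS => (hΩb.subset hS).measure_lt_top.ne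
  by_cases hE0 : volume E = 0
  · exact ⟨∅, isOpen_empty, convex_empty, empty_subset _, ae_eq_empty.2 hE0⟩
  obtain ⟨A, hAo, hA, hAn, hAΩ, hAE, hAP⟩ := hB.exists_convex_piece hφ hΩo hΩb hΩ hEΩ hEm hE0 hP
  refine ⟨A, hAo, hA, hAΩ, ?_⟩
  by_contra hne
  have hD0 : volume (E \ A) ≠ 0 := fun h => hne (ae_eq_set.2 ⟨h, hAE⟩)
  have hDΩ : E \ A ⊆ Ω := sdiff_subset.trans hEΩ
  have hDm : MeasurableSet (E \ A) := hEm.diff hAo.measurableSet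
  have hPA : anisoPerimeter φ A ≠ ⊤ := ne_top_of_le_ne_top hP (le_self_add.trans hAP)
  have hPD : anisoPerimeter φ (E \ A) ≠ ⊤ := ne_top_of_le_ne_top hP (le_add_self.trans hAP)
  have hEvol := toReal_volume_eq_diff_add hAo.measurableSet (hfin E hEΩ) hAE
  have hBD : MassBound φ Ω (volume (E \ A)).toReal (anisoPerimeter φ (E \ A)) := by
    rw [hEvol] at hB
    exact hB.of_add hAo.measurableSet hAΩ (hfin A hAΩ) rfl hPA (by rwa [add_comm])
  obtain ⟨B, hBo, hBc, hBn, hBΩ, hBE, hBP⟩ :=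
    hBD.exists_convex_piece hφ hΩo hΩb hΩ hDΩ hDm hD0 hPD
  have hPB : anisoPerimeter φ B ≠ ⊤ := ne_top_of_le_ne_top hPD (le_self_add.trans hBP)
  have hPR : anisoPerimeter φ ((E \ A) \ B) ≠ ⊤ := ne_top_of_le_ne_top hPD (le_add_self.trans hBP)
  have hDvol := toReal_volume_eq_diff_add hBo.measurableSet (hfin _ hDΩ) hBE
  have hAB : Disjoint A B := by
    rw [disjoint_iff_inter_eq_empty]
    refine (hAo.inter hBo).eq_empty_of_measure_zero (μ := volume) (measure_mono_null ?_ hBE)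
    exact fun x hx => ⟨hx.2, fun h => h.2 hx.1⟩
  have hBsum : MassBound φ Ω ((volume A).toReal + (volume B).toReal)
      (anisoPerimeter φ A + anisoPerimeter φ B) := by
    have h1 : (volume E).toReal = ((volume A).toReal + (volume B).toReal)
        + (volume ((E \ A) \ B)).toReal := by
      rw [hEvol, hDvol]
      ring
    rw [h1] at hB
    refine hB.of_add (hDm.diff hBo.measurableSet) (sdiff_subset.trans hDΩ)
      (hfin _ (sdiff_subset.trans hDΩ)) rfl hPR ?_
    rw [add_assoc]
    exact (add_le_add_right hBP _).trans hAP
  obtain ⟨A', B', hAo', hBo', hAc', hAn', hBn', hAΩ', hBΩ', hd', hvA, hvB, hPA', hPB', hPC⟩ :=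
    exists_merge hφ hΩo hΩ hΩb hAo hBo hA hBc hAn hBn hAΩ hBΩ hAB
  set C := convexHull ℝ (A' ∪ B') with hCdef
  have hCo : IsOpen C := (hAo'.union hBo').convexHull
  have hCΩ : C ⊆ Ω := convexHull_min (union_subset hAΩ' hBΩ') hΩ
  have hABC : A' ∪ B' ⊆ C := subset_convexHull ℝ _
  have hCi := integrable_indicator_one hCo.measurableSet (hfin C hCΩ)
  have hC0 : ∀ x ∉ Ω, C.indicator (1 : (Fin 2 → ℝ) → ℝ) x = 0 := fun x hx =>
    indicator_of_notMem (fun h => hx (hCΩ h)) _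
  have hApos : 0 < (volume A).toReal :=
    ENNReal.toReal_pos (hAo.measure_ne_zero volume hAn) (hfin A hAΩ)
  have hm : 0 < (volume A).toReal + (volume B).toReal :=
      add_pos_of_pos_of_nonneg hApos toReal_nonneg
  have hPA0 : anisoPerimeter φ A ≠ 0 :=
    anisoPerimeter_ne_zero hφ hAo.measurableSet (hΩb.subset hAΩ) (hAo.measure_ne_zero volume hAn)
  obtain ⟨x₀, hx₀⟩ := hAn
  have hCle : (volume C).toReal ≤ (volume A).toReal + (volume B).toReal := by
    rw [← integral_indicator_one' hCo.measurableSet]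
    exact hBsum.integral_le hΩ (hAΩ hx₀) hm (by simp [hPA0]) (ENNReal.add_ne_top.2 ⟨hPA, hPB⟩) hCi
      hC0 (exists_nat_indicator_one C) hPC
  have hU : volume (A' ∪ B') = volume A + volume B := by
    rw [measure_union hd' hBo'.measurableSet, hvA, hvB]
  have hCle' : volume C ≤ volume (A' ∪ B') := by
    rw [hU, ← ENNReal.toReal_le_toReal (hfin C hCΩ)
      (ENNReal.add_ne_top.2 ⟨hfin A hAΩ, hfin B hBΩ⟩),
      ENNReal.toReal_add (hfin A hAΩ) (hfin B hBΩ)]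
    exact hCle
  have hC : volume C = volume A + volume B := hU ▸ hCle'.antisymm (measure_mono hABC)
  have hnull : volume (C \ (A' ∪ B')) = 0 := by
    rw [measure_sdiff hABC (hAo'.union hBo').measurableSet.nullMeasurableSet
      (hfin _ (hABC.trans hCΩ))]
    exact tsub_eq_zero_of_le hCle'
  obtain ⟨κ, hκ, hκle⟩ := anisoPerimeter_add_pos_le_of_split hφ hAo' hBo' hCo
    (convex_convexHull ℝ _).isPreconnected hAn' hBn' hd' (subset_union_left.trans hABC)
    (subset_union_right.trans hABC) (hfin C hCΩ) hnull
  have h1 : anisoPerimeter φ A + anisoPerimeter φ B ≤ anisoPerimeter φ C :=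
    hBsum _ hCi hC0 (exists_nat_indicator_one C) (by
      rw [integral_indicator_one' hCo.measurableSet, hC,
        ENNReal.toReal_add (hfin A hAΩ) (hfin B hBΩ)])
  have h2 : anisoPerimeter φ C + κ ≤ anisoPerimeter φ C + 0 := by
    rw [add_zero]
    exact hκle.trans ((add_le_add hPA' hPB').trans h1)
  have hPCf : anisoPerimeter φ C ≠ ⊤ :=
    ne_top_of_le_ne_top (ENNReal.add_ne_top.2 ⟨hPA, hPB⟩) hPC
  exact hκ (nonpos_iff_eq_zero.1 ((ENNReal.add_le_add_iff_left hPCf).1 h2))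

end ConvexMinimizer

section DensityPoints

variable {n : ℕ}

lemma densityPoints_congr {E F : Set (Fin n → ℝ)} (h : E =ᵐ[volume] F) :
    densityPoints E = densityPoints F := by
  have h1 : ∀ S : Set (Fin n → ℝ), volume (E ∩ S) = volume (F ∩ S) := fun S =>
    measure_congr (h.inter (ae_eq_refl S))
  simp only [densityPoints, h1]

/-- An open convex set coincides with its density points. -/
lemma IsOpen.densityPoints_eq {A : Set (Fin n → ℝ)} (hAo : IsOpen A) (hA : Convex ℝ A) :
    densityPoints A = A := by
  have hpos : ∀ (x : Fin n → ℝ) {r : ℝ}, 0 < r → volume (Metric.ball x r) ≠ 0 :=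
    fun x r hr => (Metric.measure_ball_pos volume x hr).ne'
  refine Subset.antisymm (fun x hx => ?_) fun x hx => ?_
  · by_contra hxA
    have hhalf : ∀ r : ℝ, 0 < r →
        volume (A ∩ Metric.ball x r) / volume (Metric.ball x r) ≤ 2⁻¹ := by
      intro r hr
      set S := A ∩ Metric.ball x r with hS
      have hSm : MeasurableSet S := (hAo.inter Metric.isOpen_ball).measurableSet
      set T := (fun y => x + x - y) ⁻¹' S with hT
      have hTm : MeasurableSet T := hSm.preimage (by fun_prop)
      have hTvol : volume T = volume S :=
        (volume.measurePreserving_sub_left (x + x)).measure_preimage hSm.nullMeasurableSet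
      have hd : Disjoint S T := by
        rw [Set.disjoint_left]
        intro y hy hyT
        refine hxA ?_
        have h1 := hA hy.1 (show x + x - y ∈ A from hyT.1) (by norm_num : (0 : ℝ) ≤ 1 / 2)
          (by norm_num : (0 : ℝ) ≤ 1 / 2) (by norm_num)
        convert h1 using 1
        module
      have hsub : S ∪ T ⊆ Metric.ball x r := by
        refine union_subset inter_subset_right fun y hy => ?_
        have h1 : x + x - y ∈ Metric.ball x r := hy.2
        rw [Metric.mem_ball, dist_eq_norm] at h1 ⊢
        rw [norm_sub_rev]
        have h3 : x - y = x + x - y - x := by abel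
        rwa [h3]
      have h2 : 2 * volume S ≤ volume (Metric.ball x r) := by
        rw [two_mul]
        nth_rewrite 2 [← hTvol]
        rw [← measure_union hd hTm]
        exact measure_mono hsub
      refine ENNReal.div_le_of_le_mul ?_
      rw [← ENNReal.div_eq_inv_mul, ENNReal.le_div_iff_mul_le (by simp) (by simp), mul_comm]
      exact h2
    have h1 : (1 : ℝ≥0∞) ≤ 2⁻¹ := le_of_tendsto (show Tendsto _ _ _ from hx)
      (eventually_nhdsWithin_of_forall fun r hr => hhalf r hr)
    exact absurd h1 (not_le.2 (ENNReal.inv_lt_one.2 ENNReal.one_lt_two))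
  · obtain ⟨ε, hε, hεA⟩ := Metric.isOpen_iff.1 hAo x hx
    refine tendsto_const_nhds.congr' ?_
    filter_upwards [Ioo_mem_nhdsGT hε] with r hr
    rw [inter_eq_self_of_subset_right ((Metric.ball_subset_ball hr.2.le).trans hεA),
      ENNReal.div_self (hpos x hr.1) measure_ball_lt_top.ne]

end DensityPoints

section LevelSets

variable {n : ℕ} {φ : (Fin n → ℝ) → ℝ} {Ω : Set (Fin n → ℝ)} {m : ℝ} {u : (Fin n → ℝ) → ℝ}

lemma Admissible.exists_measurable_ae_eq (hΩ : MeasurableSet Ω) (hu : Admissible φ Ω m u) :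
    ∃ v : (Fin n → ℝ) → ℝ, Measurable v ∧ u =ᵐ[volume] v ∧ (∀ x ∉ Ω, v x = 0) ∧
      ∀ x, ∃ k : ℕ, v x = k := by
  obtain ⟨⟨hui, -⟩, h0, hN, -⟩ := hu
  set w := hui.1.mk u with hw
  have hwm : Measurable w := hui.1.stronglyMeasurable_mk.measurable
  refine ⟨Ω.indicator fun x => (⌊w x⌋₊ : ℝ), ?_, ?_, fun x hx => indicator_of_notMem hx _, ?_⟩
  · exact (measurable_from_nat.comp (Nat.measurable_floor.comp hwm)).indicator hΩ
  · filter_upwards [hui.1.ae_eq_mk, h0, hN] with x hx hx0 hxN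
    by_cases hxΩ : x ∈ Ω
    · obtain ⟨k, hk⟩ := hxN
      rw [indicator_of_mem hxΩ, hw, ← hx, hk, Nat.floor_natCast]
    · rw [indicator_of_notMem hxΩ, hx0 hxΩ]
  · intro x
    by_cases hxΩ : x ∈ Ω
    · exact ⟨⌊w x⌋₊, indicator_of_mem hxΩ _⟩
    · exact ⟨0, by rw [indicator_of_notMem hxΩ, Nat.cast_zero]⟩

lemma IsMinimizer.congr {v : (Fin n → ℝ) → ℝ} (hu : IsMinimizer φ Ω m u) (h : u =ᵐ[volume] v) :
    IsMinimizer φ Ω m v := by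
  obtain ⟨⟨⟨hui, hTV⟩, h0, hN, hm⟩, hmin⟩ := hu
  refine ⟨⟨⟨hui.congr h, by rwa [← anisoTV_congr h]⟩, ?_, ?_, ?_⟩, fun w hw => ?_⟩
  · filter_upwards [h, h0] with x hx hx0 using fun hxΩ => hx ▸ hx0 hxΩ
  · filter_upwards [h, hN] with x hx hxN using hx ▸ hxN
  · rw [← hm]
    exact (integral_congr_ae (ae_restrict_of_ae h)).symm
  · rw [← anisoTV_congr h]
    exact hmin w hw

/-- The level sets of a minimizer satisfy the mass bound with equality. -/
lemma IsMinimizer.massBound_levelSet (hφ : IsNorm φ) (hu : IsMinimizer φ Ω m u) (hum : Measurable u)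
    (h0 : ∀ x ∉ Ω, u x = 0) (hN : ∀ x, ∃ k : ℕ, u x = k) {j : ℕ} (hj : 1 ≤ j)
    (hEf : volume {x | (j : ℝ) ≤ u x} ≠ ⊤) :
    anisoPerimeter φ {x | (j : ℝ) ≤ u x} ≠ ⊤ ∧
      MassBound φ Ω (volume {x | (j : ℝ) ≤ u x}).toReal (anisoPerimeter φ {x | (j : ℝ) ≤ u x}) := by
  obtain ⟨⟨⟨hui, hTV⟩, -, -, hm⟩, hmin⟩ := hu
  have hle := anisoTV_sub_indicator_add_le hφ hui hN hj
  set E := {x | (j : ℝ) ≤ u x} with hE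
  have hEm : MeasurableSet E := measurableSet_le measurable_const hum
  have hEi := integrable_indicator_one hEm hEf
  have hj' : (1 : ℝ) ≤ j := by exact_mod_cast hj
  set u₀ : (Fin n → ℝ) → ℝ := fun x => u x - E.indicator 1 x with hu₀
  have hu₀i : Integrable u₀ := hui.sub hEi
  have hTV₀ : anisoTV φ u₀ ≠ ⊤ := ne_top_of_le_ne_top hTV (le_self_add.trans hle)
  have hu₀0 : ∀ x ∉ Ω, u₀ x = 0 := by
    intro x hx
    have hxE : x ∉ E := fun h => by
      have h1 : (j : ℝ) ≤ u x := h
      rw [h0 x hx] at h1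
      linarith
    simp only [hu₀, indicator_of_notMem hxE, h0 x hx, sub_zero]
  have hu₀N : ∀ x, ∃ k : ℕ, u₀ x = k := by
    intro x
    obtain ⟨k, hk⟩ := hN x
    by_cases hxE : x ∈ E
    · have h1 : (j : ℝ) ≤ u x := hxE
      rw [hk] at h1
      refine ⟨k - 1, ?_⟩
      have h2 : 1 ≤ k := hj.trans (by exact_mod_cast h1)
      simp only [hu₀, indicator_of_mem hxE, hk, Pi.one_apply]
      rw [Nat.cast_sub h2, Nat.cast_one]
    · exact ⟨k, by simp only [hu₀, indicator_of_notMem hxE, hk, sub_zero]⟩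
  refine ⟨ne_top_of_le_ne_top hTV (le_add_self.trans hle), fun w hw hw0 hwN hwm => ?_⟩
  by_cases hwT : anisoTV φ w = ⊤
  · rw [hwT]
    exact le_top
  have hvTV := anisoTV_add_le (φ := φ) hu₀i hw
  have hvi : Integrable fun x => u₀ x + w x := hu₀i.add hw
  have hv0 : ∀ x ∉ Ω, u₀ x + w x = 0 := fun x hx => by rw [hu₀0 x hx, hw0 x hx, add_zero]
  have hInt : ∫ x in Ω, (u₀ x + w x) = m := by
    rw [setIntegral_eq_integral_of_forall_compl_eq_zero hv0, integral_add hu₀i hw, hwm]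
    have h1 : ∫ x, u₀ x = (∫ x, u x) - ∫ x, E.indicator (1 : (Fin n → ℝ) → ℝ) x :=
      integral_sub hui hEi
    rw [h1, integral_indicator_one' hEm, sub_add_cancel, ← hm,
      setIntegral_eq_integral_of_forall_compl_eq_zero h0]
  have h1 := hmin _ ⟨⟨hvi, ne_top_of_le_ne_top (ENNReal.add_ne_top.2 ⟨hTV₀, hwT⟩) hvTV⟩,
    Eventually.of_forall hv0, Eventually.of_forall fun x => by
      obtain ⟨a, ha⟩ := hu₀N x
      obtain ⟨b, hb⟩ := hwN x
      exact ⟨a + b, by rw [ha, hb]; push_cast; rfl⟩, hInt⟩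
  exact (ENNReal.add_le_add_iff_left hTV₀).1 (hle.trans (h1.trans hvTV))

end LevelSets

/-- Every level set `E_j = {u ≥ j}`, `j ≥ 1`, of a minimizer `u` of
problem (1) in a bounded convex open set `Ω ⊆ ℝ²` (identified with its set of
density-1 points) is a minimizer of the isoperimetric problem (10) with volume
constraint `m := |E_j|`; in particular it is convex. -/
theorem level_sets_isop_minimizers (φ : (Fin 2 → ℝ) → ℝ) (hφ : IsNorm φ)
    (Ω : Set (Fin 2 → ℝ)) (hΩopen : IsOpen Ω) (hΩbdd : Bornology.IsBounded Ω)
    (hΩconv : Convex ℝ Ω) (m : ℝ) (hm : 0 < m)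
    (u : (Fin 2 → ℝ) → ℝ) (hu : IsMinimizer φ Ω m u) (j : ℕ) (hj : 1 ≤ j) :
    IsIsopMinimizer φ Ω ((volume (densityPoints {x | (j : ℝ) ≤ u x})).toReal)
      (densityPoints {x | (j : ℝ) ≤ u x}) ∧
    Convex ℝ (densityPoints {x | (j : ℝ) ≤ u x}) := by
  obtain ⟨v, hvm, huv, hv0, hvN⟩ := hu.1.exists_measurable_ae_eq hΩopen.measurableSet
  set E := {x | (j : ℝ) ≤ v x} with hE
  have huE : ({x | (j : ℝ) ≤ u x} : Set (Fin 2 → ℝ)) =ᵐ[volume] E := by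
    filter_upwards [huv] with x hx
    exact congrArg (fun t : ℝ => (j : ℝ) ≤ t) hx
  have hEm : MeasurableSet E := measurableSet_le measurable_const hvm
  have hEΩ : E ⊆ Ω := by
    intro x hx
    by_contra hxΩ
    have h1 : (j : ℝ) ≤ v x := hx
    rw [hv0 x hxΩ] at h1
    have h2 : (1 : ℝ) ≤ j := by exact_mod_cast hj
    linarith
  obtain ⟨hP, hB⟩ := (hu.congr huv).massBound_levelSet hφ hvm hv0 hvN hj
    (hΩbdd.subset hEΩ).measure_lt_top.ne
  obtain ⟨A, hAo, hA, hAΩ, hEA⟩ := hB.exists_convex_ae_eq hφ hΩopen hΩbdd hΩconv hEΩ hEm hP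
  rw [densityPoints_congr (huE.trans hEA), hAo.densityPoints_eq hA]
  refine ⟨⟨hAo.measurableSet, hAΩ, rfl, fun F hF hFΩ hFvol => ?_⟩, hA⟩
  rw [← anisoPerimeter_congr hEA]
  refine hB _ (integrable_indicator_one hF (hΩbdd.subset hFΩ).measure_lt_top.ne)
    (fun x hx => indicator_of_notMem (fun h => hx (hFΩ h)) _) (exists_nat_indicator_one F) ?_
  rw [integral_indicator_one' hF, hFvol, measure_congr hEA]

end
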